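/- Fix an integer n > 2. There exists a constant C, depending only on n, such that for every odd prime power q, every monic polynomial f₀ ∈ F_q[T] of degree n, and every integer m with 2 ≤ m ≤ n − 1, the number N of polynomials h ∈ F_q[T] with deg h ≤ m (including h = 0) such that f₀ + h is a sum of two squares satisfies |N/q^{m+1} − (1/4^n)·binom(2n, n)| ≤ C·q^{−1/2}. -/

import Mathlib

namespace S2S

open Finset

/-- a signed permutation all of whose cycles are positive -/
def Pos {α : Type*} (π : Equiv.Perm α) (ε : α → ℤˣ) : Prop :=
  ∃ δ : α → ℤˣ, ∀ i, ε i = δ i * δ (π i)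

lemma units_sq (u : ℤˣ) : u * u = 1 := by
  rcases Int.units_eq_one_or u with h | h <;> simp [h]

noncomputable def posCount (α : Type*) : ℕ :=
  Nat.card {p : Equiv.Perm α × (α → ℤˣ) // Pos p.1 p.2}

lemma pos_congr {α β : Type*} (e : α ≃ β) : posCount α = posCount β := by
  unfold posCount
  refine Nat.card_congr ?_
  refine Equiv.subtypeEquiv (Equiv.prodCongr e.permCongr (Equiv.arrowCongr e (Equiv.refl _))) ?_
  rintro ⟨π, ε⟩
  constructor
  · rintro ⟨δ, h⟩
    refine ⟨fun b => δ (e.symm b), fun i => ?_⟩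
    simpa [Equiv.arrowCongr, Equiv.permCongr_apply] using h (e.symm i)
  · rintro ⟨δ, h⟩
    refine ⟨fun b => δ (e b), fun i => ?_⟩
    have := h (e i)
    simpa [Equiv.arrowCongr, Equiv.permCongr_apply] using this

lemma pos_none {α : Type*} [DecidableEq α] (π : Equiv.Perm α) (ε : Option α → ℤˣ) :
    Pos (Equiv.Perm.decomposeOption.symm (none, π)) ε ↔
      ε none = 1 ∧ Pos π (fun i => ε (some i)) := by
  constructor
  · rintro ⟨δ, h⟩
    refine ⟨by simpa [units_sq] using h none, fun i => δ (some i), fun i => by simpa using h (some i)⟩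
  · rintro ⟨h0, δ, h⟩
    refine ⟨fun o => o.elim 1 δ, ?_⟩
    rintro (_ | i)
    · simpa using h0
    · simpa using h i

lemma pos_some {α : Type*} [DecidableEq α] (π : Equiv.Perm α) (j : α) (ε : Option α → ℤˣ) :
    Pos (Equiv.Perm.decomposeOption.symm (some j, π)) ε ↔
      Pos π (fun i => if π i = j then ε (some i) * ε none else ε (some i)) := by
  have key : ∀ i, Equiv.Perm.decomposeOption.symm (some j, π) (some i)
      = if π i = j then none else some (π i) := by
    intro i
    by_cases h : π i = j
    · simp [h]
    · simp only [Equiv.Perm.decomposeOption_symm_apply, Equiv.Perm.coe_mul, Function.comp_apply,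
        Equiv.optionCongr_apply, Option.map_some, h, if_false]
      rw [Equiv.swap_apply_of_ne_of_ne] <;> simp [h]
  have key0 : Equiv.Perm.decomposeOption.symm (some j, π) none = some j := by simp
  constructor
  · rintro ⟨δ, h⟩
    refine ⟨fun i => δ (some i), fun i => ?_⟩
    have h1 := h (some i)
    have h0 := h none
    rw [key] at h1
    rw [key0] at h0
    by_cases hi : π i = j
    · simp only [hi, if_true] at h1 ⊢
      rw [h1, h0, mul_mul_mul_comm, ← mul_assoc, mul_assoc (δ (some i)), units_sq, mul_one]
    · simpa [hi] using h1
  · rintro ⟨δ, h⟩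
    refine ⟨fun o => o.elim (ε none * δ j) δ, ?_⟩
    rintro (_ | i)
    · rw [key0]; simp [mul_assoc]
    · rw [key]
      have h1 := h i
      by_cases hi : π i = j
      · simp only [hi, if_true] at h1 ⊢
        simp only [Option.elim]
        calc ε (some i) = ε (some i) * ε none * ε none := by rw [mul_assoc, units_sq, mul_one]
          _ = _ := by rw [h1]; ac_rfl
      · simpa [hi] using h1

/-- building a signed permutation of `Option α` -/
noncomputable def posMap {α : Type*} [DecidableEq α] :
    Option (α × ℤˣ) × {p : Equiv.Perm α × (α → ℤˣ) // Pos p.1 p.2} →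
    {p : (Option α × Equiv.Perm α) × (Option α → ℤˣ) //
      Pos (Equiv.Perm.decomposeOption.symm p.1) p.2}
  | (none, p) => ⟨((none, p.1.1), fun o => o.elim 1 p.1.2), (pos_none _ _).2 ⟨rfl, p.2⟩⟩
  | (some (j, e), p) => ⟨((some j, p.1.1),
        fun o => o.elim e (fun i => if p.1.1 i = j then p.1.2 i * e else p.1.2 i)), by
        rw [pos_some]
        have := p.2
        convert this using 2 with i
        by_cases h : p.1.1 i = j <;> simp [h, mul_assoc]⟩

lemma posMap_bij {α : Type*} [DecidableEq α] : Function.Bijective (posMap (α := α)) := by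
  constructor
  · rintro ⟨_ | ⟨j, e⟩, ⟨⟨π, ε⟩, hp⟩⟩ ⟨_ | ⟨j', e'⟩, ⟨⟨π', ε'⟩, hp'⟩⟩ h
    · simp only [posMap, Subtype.mk.injEq, Prod.mk.injEq, true_and] at h
      obtain ⟨rfl, h⟩ := h
      have : ε = ε' := funext fun i => congrFun h (some i)
      subst this; rfl
    · simp [posMap] at h
    · simp [posMap] at h
    · simp only [posMap, Subtype.mk.injEq, Prod.mk.injEq, Option.some.injEq] at h
      obtain ⟨⟨rfl, rfl⟩, h⟩ := h
      have he : e = e' := congrFun h none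
      subst he
      have : ε = ε' := funext fun i => by
        have := congrFun h (some i)
        simp only [Option.elim] at this
        by_cases hi : π i = j <;> simpa [hi] using this
      subst this; rfl
  · rintro ⟨⟨⟨_ | j, π⟩, ε⟩, hp⟩
    · have h := (pos_none _ _).1 hp
      refine ⟨(none, ⟨(π, fun i => ε (some i)), h.2⟩), ?_⟩
      simp only [posMap, Subtype.mk.injEq, Prod.mk.injEq, true_and]
      funext o
      rcases o with _ | i
      · exact h.1.symm
      · rfl
    · have h := (pos_some _ _ _).1 hp
      refine ⟨(some (j, ε none), ⟨(π, fun i => if π i = j then ε (some i) * ε none else ε (some i)), h⟩), ?_⟩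
      simp only [posMap, Subtype.mk.injEq, Prod.mk.injEq, true_and]
      funext o
      rcases o with _ | i
      · rfl
      · by_cases hi : π i = j <;> simp [hi, mul_assoc]

lemma posCount_option (α : Type*) [Fintype α] [DecidableEq α] :
    posCount (Option α) = (2 * Fintype.card α + 1) * posCount α := by
  unfold posCount
  rw [Nat.card_congr (Equiv.subtypeEquiv (Equiv.prodCongr Equiv.Perm.decomposeOption
    (Equiv.refl (Option α → ℤˣ))) (q := fun p => Pos (Equiv.Perm.decomposeOption.symm p.1) p.2)
    (by rintro ⟨π, ε⟩; simp only [Equiv.prodCongr_apply, Prod.map, Equiv.symm_apply_apply]; rfl)),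
    ← Nat.card_congr (Equiv.ofBijective _ posMap_bij), Nat.card_prod]
  congr 1
  simp [Nat.card_eq_fintype_card, Fintype.card_option, mul_comm]

lemma posCount_fin (n : ℕ) :
    posCount (Fin n) * n.factorial * 2 ^ n = (2 * n).factorial := by
  induction n with
  | zero =>
    have : posCount (Fin 0) = 1 := by
      unfold posCount
      rw [Nat.card_eq_one_iff_unique]
      refine ⟨⟨fun a b => Subtype.ext (Subsingleton.elim _ _)⟩, ⟨⟨(1, 1), ⟨1, fun i => i.elim0⟩⟩⟩⟩
    simp [this]
  | succ n ih =>
    rw [pos_congr (finSuccEquiv n), posCount_option, Fintype.card_fin,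
      show 2 * (n + 1) = 2 * n + 1 + 1 by ring, Nat.factorial_succ (2 * n + 1), Nat.factorial_succ (2 * n), ← ih,
      Nat.factorial_succ]
    ring

/-- proportion of positive signed permutations -/
lemma pos_ratio (n : ℕ) : (posCount (Fin n) : ℝ) / (2 ^ n * n.factorial)
    = (Nat.choose (2 * n) n : ℝ) / 4 ^ n := by
  have h := posCount_fin n
  have h2 : (Nat.choose (2 * n) n) * n.factorial * n.factorial = (2 * n).factorial := by
    have := Nat.choose_mul_factorial_mul_factorial (show n ≤ 2 * n by omega)
    rwa [show 2 * n - n = n by omega] at this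
  have hf : (n.factorial : ℝ) ≠ 0 := by exact_mod_cast n.factorial_ne_zero
  rw [div_eq_div_iff (by positivity) (by positivity)]
  have h' : (posCount (Fin n) : ℝ) * n.factorial * 2 ^ n
    = (Nat.choose (2 * n) n : ℝ) * n.factorial * n.factorial := by exact_mod_cast h.trans h2.symm
  have : (4:ℝ) ^ n = 2 ^ n * 2 ^ n := by rw [← mul_pow]; norm_num
  rw [this]
  apply mul_right_cancel₀ hf
  linear_combination (2:ℝ)^n * h'

end S2S


namespace S2S

open Finset Polynomial

/-- `f` is a sum of two squares `A² + X B²` -/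
def SoS {F : Type*} [Field F] (f : F[X]) : Prop := ∃ A B : F[X], f = A ^ 2 + X * B ^ 2

lemma arrange {Ω : Type*} [Field Ω] {n : ℕ} (s σ : Fin n → Ω)
    (h : ∏ i, (X + C (s i ^ 2)) = ∏ i, (X + C (σ i ^ 2)))
    (hinj : Function.Injective (fun i => σ i ^ 2)) :
    ∃ π : Equiv.Perm (Fin n), ∃ ε : Fin n → ℤˣ, ∀ i, s i = ((ε i : ℤ) : Ω) * σ (π i) := by
  have h1 : ∀ i, ∃ j, s i ^ 2 = σ j ^ 2 := by
    intro i
    have := congrArg (eval (-(s i ^ 2))) h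
    rw [eval_prod, eval_prod, Finset.prod_eq_zero (mem_univ i) (by simp)] at this
    obtain ⟨j, _, hj⟩ := Finset.prod_eq_zero_iff.1 this.symm
    refine ⟨j, ?_⟩
    simp at hj
    linear_combination -hj
  have h2 : ∀ i, ∃ j, s j ^ 2 = σ i ^ 2 := by
    intro i
    have := congrArg (eval (-(σ i ^ 2))) h
    rw [eval_prod, eval_prod, Finset.prod_eq_zero (s := univ) (f := fun j => eval (-(σ i ^ 2)) (X + C (σ j ^ 2))) (mem_univ i) (by simp)] at this
    obtain ⟨j, _, hj⟩ := Finset.prod_eq_zero_iff.1 this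
    refine ⟨j, ?_⟩
    simp at hj
    linear_combination hj
  choose p hp using h1
  have hsurj : Function.Surjective p := by
    intro j
    obtain ⟨i, hi⟩ := h2 j
    exact ⟨i, hinj (by simp only; rw [← hp, hi])⟩
  have hbij := Finite.injective_iff_bijective.1 (Finite.injective_iff_surjective.2 hsurj)
  refine ⟨Equiv.ofBijective p hbij, ?_⟩
  have : ∀ i, ∃ e : ℤˣ, s i = ((e : ℤ) : Ω) * σ (p i) := by
    intro i
    rcases sq_eq_sq_iff_eq_or_eq_neg.1 (hp i) with h | h
    · exact ⟨1, by simp [h]⟩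
    · exact ⟨-1, by simp [h]⟩
  choose ε hε using this
  exact ⟨ε, hε⟩

lemma sign_sq {Ω : Type*} [Ring Ω] (e : ℤˣ) : ((e : ℤ) : Ω) ^ 2 = 1 := by
  rcases Int.units_eq_one_or e with h | h <;> simp [h]

lemma sign_unique {Ω : Type*} [Field Ω] (h2 : (2 : Ω) ≠ 0) {e e' : ℤˣ} {x : Ω} (hx : x ≠ 0)
    (h : ((e : ℤ) : Ω) * x = ((e' : ℤ) : Ω) * x) : e = e' := by
  have := mul_right_cancel₀ hx h
  have hne : (1 : Ω) ≠ -1 := fun h => h2 (by linear_combination h)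
  rcases Int.units_eq_one_or e with rfl | rfl <;> rcases Int.units_eq_one_or e' with rfl | rfl <;>
    simp_all [hne.symm]

lemma arrange_unique {Ω : Type*} [Field Ω] (h2 : (2 : Ω) ≠ 0) {n : ℕ} (s : Fin n → Ω)
    (hinj : Function.Injective (fun i => s i ^ 2)) (h0 : ∀ i, s i ≠ 0)
    {π π' : Equiv.Perm (Fin n)} {ε ε' : Fin n → ℤˣ}
    (h : ∀ i, ((ε i : ℤ) : Ω) * s (π i) = ((ε' i : ℤ) : Ω) * s (π' i)) : π = π' ∧ ε = ε' := by
  have h1 : π = π' := by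
    ext i : 1
    apply hinj
    have := congrArg (· ^ 2) (h i)
    simpa [mul_pow, sign_sq] using this
  subst h1
  exact ⟨rfl, funext fun i => sign_unique h2 (h0 _) (h i)⟩

lemma prod_perm_sign {Ω : Type*} [CommRing Ω] {n : ℕ} (s : Fin n → Ω) (π : Equiv.Perm (Fin n))
    (ε : Fin n → ℤˣ) :
    ∏ i, (X + C ((((ε i : ℤ) : Ω) * s (π i)) ^ 2)) = ∏ i, (X + C (s i ^ 2)) := by
  rw [← Equiv.prod_comp π (fun i => X + C (s i ^ 2))]
  refine Finset.prod_congr rfl fun i _ => ?_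
  rw [mul_pow, sign_sq, one_mul]

lemma even_odd {F : Type*} [Field F] (G : F[X]) :
    ∃ A B : F[X], G = A.comp (-X ^ 2) + X * B.comp (-X ^ 2) := by
  induction G using Polynomial.induction_on with
  | C a => exact ⟨C a, 0, by simp⟩
  | add p q hp hq =>
    obtain ⟨A, B, h⟩ := hp
    obtain ⟨A', B', h'⟩ := hq
    refine ⟨A + A', B + B', ?_⟩
    rw [add_comp, add_comp]
    linear_combination h + h'
  | monomial n a h =>
    obtain ⟨A, B, h⟩ := h
    refine ⟨-X * B, A, ?_⟩
    rw [pow_succ, ← mul_assoc, h]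
    simp only [neg_mul, neg_comp, mul_comp, X_comp]
    ring

lemma fixed_mem {F k : Type*} [Field F] [Fintype F] [Field k] [Algebra F k] (x : k)
    (hx : x ^ Fintype.card F = x) : ∃ y : F, algebraMap F k y = x := by
  classical
  by_contra hne
  push Not at hne
  have hc : 1 < Fintype.card F := Fintype.one_lt_card
  have := Polynomial.eq_zero_of_natDegree_lt_card_of_eval_eq_zero' (X ^ Fintype.card F - X : k[X])
    (insert x (univ.image (algebraMap F k))) (by
      intro i hi
      rcases Finset.mem_insert.1 hi with rfl | hi
      · simp [hx]
      · obtain ⟨y, _, rfl⟩ := Finset.mem_image.1 hi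
        simp [← map_pow, FiniteField.pow_card]) (by
      rw [FiniteField.X_pow_card_sub_X_natDegree_eq k hc, Finset.card_insert_of_notMem,
        Finset.card_image_of_injective _ (algebraMap F k).injective, Finset.card_univ]
      · exact Nat.lt_succ_self _
      · simp only [mem_image, mem_univ, true_and, not_exists]
        exact hne)
  exact FiniteField.X_pow_card_sub_X_ne_zero k hc this

lemma frob_aeval {F k : Type*} [Field F] [Fintype F] [Field k] [Algebra F k] (A : F[X]) (x : k) :
    (aeval x A) ^ Fintype.card F = aeval (x ^ Fintype.card F) A := by
  have := (Polynomial.aeval_algHom_apply (FiniteField.frobeniusAlgHom F k) x A)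
  simpa using this.symm

lemma sign_frob {F k : Type*} [Field F] [Fintype F] [Field k] [Algebra F k] (e : ℤˣ) :
    ((e : ℤ) : k) ^ Fintype.card F = ((e : ℤ) : k) := by
  have := map_intCast (FiniteField.frobeniusAlgHom F k) (e : ℤ)
  rwa [FiniteField.coe_frobeniusAlgHom] at this

lemma sos_iff {F k : Type*} [Field F] [Fintype F] [Field k] [Algebra F k] (h2 : (2 : k) ≠ 0)
    {n : ℕ} (f : F[X]) (s : Fin n → k) (hf : f.map (algebraMap F k) = ∏ i, (X + C (s i ^ 2)))
    (hinj : Function.Injective (fun i => s i ^ 2)) (h0 : ∀ i, s i ≠ 0)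
    (π : Equiv.Perm (Fin n)) (ε : Fin n → ℤˣ)
    (hfr : ∀ i, s i ^ Fintype.card F = ((ε i : ℤ) : k) * s (π i)) :
    SoS f ↔ Pos π ε := by
  constructor
  · rintro ⟨A, B, rfl⟩
    set g : k → k := fun y => aeval (-y ^ 2) A + y * aeval (-y ^ 2) B with hg
    have hgf : ∀ y, g y ^ Fintype.card F = g (y ^ Fintype.card F) := by
      intro y
      have e1 := map_add (FiniteField.frobeniusAlgHom F k) (aeval (-y ^ 2) A) (y * aeval (-y ^ 2) B)
      simp only [FiniteField.coe_frobeniusAlgHom] at e1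
      have e2 : (-y ^ 2) ^ Fintype.card F = - (y ^ Fintype.card F) ^ 2 := by
        have := map_neg (FiniteField.frobeniusAlgHom F k) (y ^ 2)
        simp only [FiniteField.coe_frobeniusAlgHom] at this
        rw [this, ← pow_mul, ← pow_mul, mul_comm]
      rw [hg, e1, mul_pow, frob_aeval, frob_aeval, e2]
    have hev : ∀ x : k, aeval x (A ^ 2 + X * B ^ 2) = ∏ i, (x + s i ^ 2) := by
      intro x
      have := congrArg (eval x) hf
      rw [eval_map_algebraMap, eval_prod] at this
      simpa using this
    have hgg : ∀ y, g y * g (-y) = ∏ i, (-y ^ 2 + s i ^ 2) := by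
      intro y
      rw [← hev, hg]
      simp
      ring
    have hex : ∀ i, ∃ d : ℤˣ, g ((d : ℤ) * s i) = 0 := by
      intro i
      have := hgg (s i)
      rw [Finset.prod_eq_zero (mem_univ i) (by ring)] at this
      rcases mul_eq_zero.1 this with h | h
      · exact ⟨1, by simpa using h⟩
      · exact ⟨-1, by simpa using h⟩
    have hnot : ∀ i, ¬ (g (s i) = 0 ∧ g (-s i) = 0) := by
      rintro i ⟨h, h'⟩
      simp only [hg, neg_sq] at h h'
      have hA : aeval (-s i ^ 2) A = 0 := by
        have : 2 * aeval (-s i ^ 2) A = 0 := by linear_combination h + h'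
        exact (mul_eq_zero.1 this).resolve_left h2
      have hB : aeval (-s i ^ 2) B = 0 := by
        have : 2 * s i * aeval (-s i ^ 2) B = 0 := by linear_combination h - h'
        exact (mul_eq_zero.1 this).resolve_left (mul_ne_zero h2 (h0 i))
      have hd := congrArg (fun p => eval (-s i ^ 2) (derivative p)) hf
      simp only [derivative_map, eval_map_algebraMap] at hd
      rw [Polynomial.derivative_prod_finset] at hd
      simp [hA, hB, derivative_pow] at hd
      rw [eval_finsetSum, Finset.sum_eq_single i] at hd
      · rw [eval_prod] at hd
        obtain ⟨j, hj, hj'⟩ := Finset.prod_eq_zero_iff.1 hd.symm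
        simp at hj'
        apply (Finset.mem_erase.1 hj).1
        apply hinj
        simp only
        linear_combination hj'
      · intro j _ hj
        rw [eval_prod]
        apply Finset.prod_eq_zero (i := i)
        · simp [hj.symm]
        · simp
      · simp
    choose δ hδ using hex
    have huniq : ∀ i (u : ℤˣ), g ((u : ℤ) * s i) = 0 → u = δ i := by
      intro i u hu
      have hd := hδ i
      by_contra hne
      apply hnot i
      rcases Int.units_eq_one_or u with h | h <;> rcases Int.units_eq_one_or (δ i) with h' | h' <;>
        simp_all
    refine ⟨δ, fun i => ?_⟩
    have h1 := hgf ((δ i : ℤ) * s i)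
    rw [hδ, zero_pow Fintype.card_ne_zero, mul_pow, sign_frob, hfr] at h1
    have h3 := huniq (π i) (δ i * ε i) (by push_cast; rw [mul_assoc]; exact h1.symm)
    rw [← h3, ← mul_assoc, units_sq, one_mul]
  · rintro ⟨δ, hδ⟩
    set r : Fin n → k := fun i => (δ i : ℤ) * s i with hr
    have hrf : ∀ i, r i ^ Fintype.card F = r (π i) := by
      intro i
      rw [hr]
      simp only
      rw [mul_pow, sign_frob, hfr, hδ, ← mul_assoc]
      congr 1
      push_cast
      rw [← mul_assoc, ← pow_two, sign_sq, one_mul]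
    set g : k[X] := ∏ i, (C (r i) - X) with hgdef
    have hfix : g.map (FiniteField.frobeniusAlgHom F k : k →+* k) = g := by
      rw [hgdef, Polynomial.map_prod]
      conv_rhs => rw [← Equiv.prod_comp π]
      refine Finset.prod_congr rfl fun i _ => ?_
      rw [Polynomial.map_sub, map_C, map_X]
      simp [hrf]
    have hlift : g ∈ Polynomial.lifts (algebraMap F k) := by
      rw [Polynomial.lifts_iff_coeff_lifts]
      intro m
      have := congrArg (fun p => coeff p m) hfix
      simp only [coeff_map] at this
      obtain ⟨y, hy⟩ := fixed_mem (F := F) (g.coeff m) (by simpa using this)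
      exact ⟨y, hy⟩
    obtain ⟨G, hG⟩ := (Polynomial.mem_lifts _).1 hlift
    obtain ⟨A, B, hAB⟩ := even_odd G
    refine ⟨A, B, ?_⟩
    have key : f.comp (-X ^ 2) = (A ^ 2 + X * B ^ 2).comp (-X ^ 2) := by
      have h1 : f.comp (-X ^ 2) = G * G.comp (-X) := by
        apply Polynomial.map_injective (algebraMap F k) (algebraMap F k).injective
        rw [Polynomial.map_comp, hf, Polynomial.map_mul, Polynomial.map_comp, hG, hgdef,
          Polynomial.prod_comp, Polynomial.prod_comp, ← Finset.prod_mul_distrib]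
        refine Finset.prod_congr rfl fun i _ => ?_
        simp only [Polynomial.map_neg, Polynomial.map_pow, map_X, add_comp, X_comp, C_comp, sub_comp]
        have : s i ^ 2 = r i ^ 2 := by simp [hr, mul_pow, sign_sq]
        rw [this, C_pow]
        ring
      rw [h1, hAB]
      simp only [add_comp, mul_comp, X_comp, pow_comp, comp_assoc, neg_comp]
      simp
      ring
    have h4 : (f - (A ^ 2 + X * B ^ 2)).comp (-X ^ 2) = 0 := by rw [sub_comp, key, sub_self]
    rw [Polynomial.comp_eq_zero_iff] at h4
    rcases h4 with h4 | h4
    · exact sub_eq_zero.1 h4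
    · exfalso
      have := congrArg (fun p => coeff p 2) h4.2
      simp at this

end S2S


namespace S2S

open Finset Polynomial

section fp
variable {B : Type*} [CommRing B]
local notation "τ" => (PowerSeries.X : PowerSeries B)

lemma ps_eq_zero {y : PowerSeries B} (h : ∀ m, τ ^ m ∣ y) : y = 0 := by
  ext m
  exact PowerSeries.X_pow_dvd_iff.1 (h (m + 1)) m (Nat.lt_succ_self m)

lemma fp_unique (Φ : PowerSeries B → PowerSeries B) (hΦ : ∀ v w, v - w ∣ Φ v - Φ w)
    {a v w : PowerSeries B} (hv : v = a + τ * Φ v) (hw : w = a + τ * Φ w) : v = w := by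
  rw [← sub_eq_zero]
  apply ps_eq_zero
  intro m
  induction m with
  | zero => simp
  | succ m ih =>
    have : v - w = τ * (Φ v - Φ w) := by linear_combination hv - hw
    rw [this, pow_succ']
    exact mul_dvd_mul_left _ (ih.trans (hΦ v w))

lemma fp_exists (Φ : PowerSeries B → PowerSeries B) (hΦ : ∀ v w, v - w ∣ Φ v - Φ w)
    (a : PowerSeries B) : ∃ v, v = a + τ * Φ v := by
  let g : PowerSeries B → PowerSeries B := fun v => a + τ * Φ v
  let u : ℕ → PowerSeries B := fun m => g^[m] a
  have hu : ∀ m, u (m + 1) = a + τ * Φ (u m) := fun m => Function.iterate_succ_apply' g m a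
  have h1 : ∀ m, τ ^ (m + 1) ∣ u (m + 1) - u m := by
    intro m
    induction m with
    | zero => rw [hu]; exact ⟨Φ (u 0), by simp [u]⟩
    | succ m ih =>
      have : u (m + 1 + 1) - u (m + 1) = τ * (Φ (u (m + 1)) - Φ (u m)) := by
        rw [hu (m + 1)]
        nth_rewrite 2 [hu m]
        ring
      rw [this, pow_succ']
      exact mul_dvd_mul_left _ (ih.trans (hΦ _ _))
  have h2 : ∀ j m, j ≤ m → PowerSeries.coeff j (u m) = PowerSeries.coeff j (u j) := by
    intro j m hjm
    induction m, hjm using Nat.le_induction with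
    | base => rfl
    | succ m hm ih =>
      have := PowerSeries.X_pow_dvd_iff.1 (h1 m) j (by omega)
      rw [map_sub, sub_eq_zero] at this
      rw [this, ih]
  let v : PowerSeries B := PowerSeries.mk fun m => PowerSeries.coeff m (u m)
  have h3 : ∀ m, τ ^ (m + 1) ∣ v - u m := by
    intro m
    rw [PowerSeries.X_pow_dvd_iff]
    intro j hj
    rw [map_sub, PowerSeries.coeff_mk, h2 j m (by omega), sub_self]
  refine ⟨v, ?_⟩
  rw [← sub_eq_zero]
  apply ps_eq_zero
  intro m
  have e : v - (a + τ * Φ v) = (v - u (m + 1)) + τ * (Φ (u m) - Φ v) := by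
    rw [hu]; ring
  rw [e]
  apply dvd_add
  · exact (pow_dvd_pow _ (by omega)).trans (h3 (m + 1))
  · refine dvd_mul_of_dvd_right ?_ _
    have := (h3 m).trans ((dvd_sub_comm).1 ((dvd_refl _ : v - u m ∣ v - u m)))
    exact (pow_dvd_pow _ (by omega)).trans (this.trans (hΦ _ _))

/-- quadratic Taylor remainder -/
lemma taylor_two {A : Type*} [CommRing A] (p : A[X]) (a : A) :
    ∃ Q : A[X], ∀ h, p.eval (a + h) = p.eval a + p.derivative.eval a * h + h ^ 2 * Q.eval h := by
  induction p using Polynomial.induction_on' with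
  | add p q hp hq =>
    obtain ⟨Q, hQ⟩ := hp
    obtain ⟨Q', hQ'⟩ := hq
    refine ⟨Q + Q', fun h => ?_⟩
    simp only [eval_add, derivative_add, hQ, hQ']
    ring
  | monomial m c =>
    induction m with
    | zero => exact ⟨0, fun h => by simp⟩
    | succ m ih =>
      obtain ⟨Q, hQ⟩ := ih
      refine ⟨C (derivative (monomial m c) |>.eval a) + (C a + X) * Q, fun h => ?_⟩
      have e : (monomial (m + 1) c : A[X]) = X * monomial m c := by
        rw [X_mul_monomial]
      rw [e]
      simp only [eval_add, eval_mul, eval_X, eval_C, derivative_mul, derivative_X, hQ, eval_one]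
      ring

/-- Hensel's lemma for power series over a ring. -/
lemma hensel (p : (PowerSeries B)[X]) (a : B) (u : B)
    (h0 : PowerSeries.constantCoeff (p.eval (PowerSeries.C a)) = 0)
    (h1 : PowerSeries.constantCoeff (p.derivative.eval (PowerSeries.C a)) * u = 1) :
    ∃ y, PowerSeries.constantCoeff y = a ∧ p.eval y = 0 := by
  obtain ⟨Q, hQ⟩ := taylor_two p (PowerSeries.C a)
  obtain ⟨b, hb⟩ := PowerSeries.X_dvd_iff.2 h0
  obtain ⟨c, hc⟩ := PowerSeries.X_dvd_iff.2 (show PowerSeries.constantCoeff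
    (p.derivative.eval (PowerSeries.C a) * PowerSeries.C u - 1) = 0 by simp [h1])
  set U := PowerSeries.C u
  obtain ⟨y, hy⟩ := fp_exists (fun y => - (c * y + U ^ 2 * y ^ 2 * Q.eval (τ * (U * y)))) (by
    intro v w
    have e := Polynomial.sub_dvd_eval_sub v w
      (-(C c * X + C U ^ 2 * X ^ 2 * Q.comp (C τ * (C U * X))))
    simpa only [eval_comp, eval_neg, eval_add, eval_mul, eval_C, eval_pow, eval_X] using e) (-b)
  refine ⟨PowerSeries.C a + τ * (U * y), by simp, ?_⟩
  rw [hQ, hb]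
  linear_combination τ * hy + τ * y * hc

lemma hensel_unique {k : Type*} [Field k] (p : (PowerSeries k)[X]) {y z : PowerSeries k}
    (hy : p.eval y = 0) (hz : p.eval z = 0)
    (hc : PowerSeries.constantCoeff y = PowerSeries.constantCoeff z)
    (h1 : PowerSeries.constantCoeff (p.derivative.eval y) ≠ 0) : y = z := by
  obtain ⟨Q, hQ⟩ := taylor_two p y
  have h2 := hQ (z - y)
  rw [add_sub_cancel, hy, hz, zero_add] at h2
  have h3 : (z - y) * (p.derivative.eval y + (z - y) * Q.eval (z - y)) = 0 := by
    linear_combination -h2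
  rcases mul_eq_zero.1 h3 with h | h
  · exact (sub_eq_zero.1 h).symm
  · exfalso
    apply h1
    have := congrArg PowerSeries.constantCoeff h
    simpa [hc] using this

lemma ps_sqrt {k : Type*} [Field k] [IsAlgClosed k] (h2 : (2 : k) ≠ 0) (y : PowerSeries k)
    (hy : PowerSeries.constantCoeff y ≠ 0) :
    ∃ z, PowerSeries.constantCoeff z ≠ 0 ∧ z ^ 2 = y := by
  obtain ⟨a, ha⟩ := IsAlgClosed.exists_pow_nat_eq (PowerSeries.constantCoeff y) (n := 2) (by norm_num)
  have ha0 : a ≠ 0 := by rintro rfl; apply hy; rw [← ha]; simp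
  obtain ⟨z, hz, hz'⟩ := hensel (X ^ 2 - C y) a (2 * a)⁻¹ (by simp [ha])
    (by rw [derivative_sub, derivative_C, derivative_X_pow]; simp; rw [map_ofNat]; field_simp)
  refine ⟨z, by rwa [hz], ?_⟩
  simpa [sub_eq_zero] using hz'

end fp

end S2S


namespace S2S

open Finset Polynomial

/-- the pencil `f + T (X - 1)` -/
noncomputable def fam {k B : Type*} [Field k] [CommRing B] [Algebra k B] (f : k[X]) (T : B) : B[X] :=
  f.map (algebraMap k B) + C T * (X - 1)

lemma fam_map {k B B' : Type*} [Field k] [CommRing B] [Algebra k B] [CommRing B'] [Algebra k B']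
    (f : k[X]) (T : B) (φ : B →ₐ[k] B') : (fam f T).map (φ : B →+* B') = fam f (φ T) := by
  simp [fam, Polynomial.map_map]

lemma fam_eval {k B : Type*} [Field k] [CommRing B] [Algebra k B] (f : k[X]) (T x : B) :
    (fam f T).eval x = aeval x f + T * (x - 1) := by
  simp [fam, eval_map_algebraMap]

lemma fam_deriv_eval {k B : Type*} [Field k] [CommRing B] [Algebra k B] (f : k[X]) (T x : B) :
    (fam f T).derivative.eval x = aeval x (derivative f) + T := by
  simp [fam, derivative_map, eval_map_algebraMap]

lemma fam_monic {k B : Type*} [Field k] [CommRing B] [Nontrivial B] [Algebra k B] (f : k[X]) (T : B)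
    (hf : f.Monic) {n : ℕ} (hn : f.natDegree = n) (h2 : 2 ≤ n) :
    (fam f T).Monic ∧ (fam f T).natDegree = n := by
  have h1 : (f.map (algebraMap k B)).Monic := hf.map _
  have h3 : (f.map (algebraMap k B)).natDegree = n := by rw [hf.natDegree_map, hn]
  have h4 : (C T * (X - 1) : B[X]).natDegree < (f.map (algebraMap k B)).natDegree := by
    rw [h3]
    refine lt_of_le_of_lt (natDegree_C_mul_le _ _) ?_
    have : (X - 1 : B[X]).natDegree ≤ 1 := by
      rw [← C_1]; exact (natDegree_X_sub_C_le _)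
    omega
  constructor
  · exact h1.add_of_left (degree_lt_degree h4)
  · rw [fam, natDegree_add_eq_left_of_natDegree_lt h4, h3]

lemma prod_of_roots {B : Type*} [CommRing B] [IsDomain B] {n : ℕ} (p : B[X]) (hp : p.Monic)
    (hn : p.natDegree = n) (x : Fin n → B) (hx : ∀ i, p.eval (x i) = 0)
    (hinj : Function.Injective x) : p = ∏ i, (X - C (x i)) := by
  rw [← sub_eq_zero]
  have hm : (∏ i, (X - C (x i))).Monic := monic_prod_of_monic _ _ fun i _ => monic_X_sub_C _
  have hd : (∏ i, (X - C (x i))).natDegree = n := by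
    rw [natDegree_prod_of_monic _ _ fun i _ => monic_X_sub_C _]; simp
  by_cases h0 : n = 0
  · subst h0
    rw [eq_one_of_monic_natDegree_zero hp hn]; simp
  apply Polynomial.eq_zero_of_natDegree_lt_card_of_eval_eq_zero _ hinj
  · intro i
    rw [eval_sub, hx, eval_prod, Finset.prod_eq_zero (mem_univ i) (by simp), sub_zero]
  · rw [Fintype.card_fin]
    have h1 : (p - ∏ i, (X - C (x i))).degree < p.degree := by
      apply degree_sub_lt_left
      · rw [degree_eq_natDegree hp.ne_zero, degree_eq_natDegree hm.ne_zero, hd, hn]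
      · exact hp.ne_zero
      · rw [hp.leadingCoeff, hm.leadingCoeff]
    by_cases h2 : p - ∏ i, (X - C (x i)) = 0
    · rw [h2]; simp; omega
    · have := natDegree_lt_natDegree h2 h1
      omega

/-- The data of the big splitting field. -/
structure Setup {k K : Type*} [Field k] [Field K] [Algebra k K] [Algebra (RatFunc k) K]
    {n : ℕ} (f : k[X]) (s : Fin n → K) : Prop where
  hs : fam f (algebraMap (RatFunc k) K RatFunc.X) = ∏ i, (X + C (s i ^ 2))
  gen : Algebra.adjoin (RatFunc k) (Set.range s) = ⊤

lemma comp_splits {K : Type*} [Field K] {n : ℕ} (s : Fin n → K) :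
    ((∏ i, (X + C (s i ^ 2))).comp (-X ^ 2)) = ∏ i, ((C (s i) - X) * (C (s i) + X)) := by
  rw [Polynomial.prod_comp]
  refine Finset.prod_congr rfl fun i _ => ?_
  simp only [add_comp, X_comp, C_comp, C_pow, pow_comp]
  ring

lemma splits_aux {K : Type*} [Field K] {n : ℕ} (s : Fin n → K) :
    Splits ((∏ i, (X + C (s i ^ 2))).comp (-X ^ 2)) := by
  rw [comp_splits]
  apply Splits.prod
  intro i _
  apply Splits.mul
  · apply Splits.of_natDegree_le_one
    compute_degree
  · apply Splits.of_natDegree_le_one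
    compute_degree

section
variable {k K : Type*} [Field k] [Field K] [Algebra k K] [Algebra (RatFunc k) K]
  [IsScalarTower k (RatFunc k) K] {n : ℕ} {f : k[X]} {s : Fin n → K}

/-- the defining polynomial -/
noncomputable def defpoly (f : k[X]) : (RatFunc k)[X] := (fam f (RatFunc.X : RatFunc k)).comp (-X ^ 2)

lemma defpoly_map {Ω : Type*} [Field Ω] [Algebra k Ω] (φ : RatFunc k →ₐ[k] Ω) (f : k[X]) :
    (defpoly f).map (φ : RatFunc k →+* Ω) = (fam f (φ RatFunc.X)).comp (-X ^ 2) := by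
  rw [defpoly, Polynomial.map_comp, fam_map]
  simp

lemma Setup.splitting (h : Setup f s) : IsSplittingField (RatFunc k) K (defpoly f) := by
  have e : (defpoly f).map (algebraMap (RatFunc k) K) = (∏ i, (X + C (s i ^ 2))).comp (-X ^ 2) := by
    have := defpoly_map (IsScalarTower.toAlgHom k (RatFunc k) K) f
    rw [IsScalarTower.coe_toAlgHom, IsScalarTower.coe_toAlgHom', h.hs] at this
    exact this
  constructor
  · rw [e]; exact splits_aux s
  · rw [eq_top_iff, ← h.gen]
    apply Algebra.adjoin_mono
    rintro _ ⟨i, rfl⟩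
    rw [Polynomial.mem_rootSet']
    constructor
    · rw [e, comp_splits]
      rw [Finset.prod_ne_zero_iff]
      intro i _
      apply mul_ne_zero
      · intro h
        have := congrArg (fun p => coeff p 1) h
        simp at this
      · intro h
        have := congrArg (fun p => coeff p 1) h
        simp at this
    · rw [← eval_map_algebraMap, e, comp_splits, eval_prod]
      exact Finset.prod_eq_zero (mem_univ i) (by simp)

/-- any two embeddings differ by a Galois element -/
lemma embed_galois {F K Ω : Type*} [Field F] [Field K] [Field Ω] [Algebra F K] [Normal F K]
    (φ ψ : K →+* Ω) (h : ∀ x, φ (algebraMap F K x) = ψ (algebraMap F K x)) :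
    ∃ g : K ≃ₐ[F] K, ∀ x, ψ x = φ (g x) := by
  let _ : Algebra F Ω := (φ.comp (algebraMap F K)).toAlgebra
  let _ : Algebra K Ω := φ.toAlgebra
  have : IsScalarTower F K Ω := IsScalarTower.of_algebraMap_eq fun x => rfl
  let ψ' : K →ₐ[F] Ω := { ψ with commutes' := fun x => (h x).symm }
  refine ⟨Normal.algHomEquivAut F Ω K ψ', fun x => ?_⟩
  have : (Normal.algHomEquivAut F Ω K).symm (Normal.algHomEquivAut F Ω K ψ') = ψ' :=
    Equiv.symm_apply_apply _ _
  have h2 := congrArg (fun a : K →ₐ[F] Ω => a x) this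
  exact h2.symm

lemma aeval_inj {B : Type*} [CommRing B] [IsDomain B] [Algebra k B] [IsAlgClosed k] {y : B}
    (hy : ∀ a : k, y ≠ algebraMap k B a) : Function.Injective (aeval y : k[X] →ₐ[k] B) := by
  rw [injective_iff_map_eq_zero]
  intro p hp
  by_contra h0
  have e := (IsAlgClosed.splits p).eq_prod_roots
  rw [e, map_mul, map_multiset_prod, Multiset.map_map] at hp
  rcases mul_eq_zero.1 hp with h | h
  · simp [h0] at h
  · rw [Multiset.prod_eq_zero_iff, Multiset.mem_map] at h
    obtain ⟨a, _, ha⟩ := h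
    simp only [Function.comp, map_sub, aeval_X, aeval_C] at ha
    exact hy a (sub_eq_zero.1 ha)

lemma Setup.embed (h : Setup f s) {Ω : Type*} [Field Ω] [Algebra k Ω] (T : Ω)
    (hT : Function.Injective (aeval T : k[X] →ₐ[k] Ω)) (σ : Fin n → Ω)
    (hσ : fam f T = ∏ i, (X + C (σ i ^ 2)))
    (hinj : Function.Injective (fun i => σ i ^ 2)) :
    ∃ φ : K →ₐ[k] Ω, φ (algebraMap (RatFunc k) K RatFunc.X) = T ∧
      ∃ π : Equiv.Perm (Fin n), ∃ ε : Fin n → ℤˣ, ∀ i, φ (s i) = ((ε i : ℤ) : Ω) * σ (π i) := by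
  have := h.splitting
  let φ₀ : RatFunc k →ₐ[k] Ω := RatFunc.liftAlgHom (aeval T) (by
    intro p hp
    exact mem_nonZeroDivisors_of_ne_zero ((map_ne_zero_iff _ hT).2 (nonZeroDivisors.ne_zero hp)))
  have hφ₀ : φ₀ RatFunc.X = T := by
    have := RatFunc.liftAlgHom_apply_div (aeval T) (by
      intro p hp
      exact mem_nonZeroDivisors_of_ne_zero ((map_ne_zero_iff _ hT).2 (nonZeroDivisors.ne_zero hp)))
      (X : k[X]) 1
    simpa using this
  let _ : Algebra (RatFunc k) Ω := φ₀.toRingHom.toAlgebra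
  have : IsScalarTower k (RatFunc k) Ω := IsScalarTower.of_algebraMap_eq fun x => (φ₀.commutes x).symm
  let φ₁ : K →ₐ[RatFunc k] Ω := IsSplittingField.lift K (defpoly f) (by
    have := defpoly_map φ₀ f
    rw [hφ₀, hσ] at this
    have h2 := splits_aux σ
    rw [← this] at h2
    exact h2)
  have hφ₁ : φ₁ (algebraMap (RatFunc k) K RatFunc.X) = T := by
    rw [φ₁.commutes]; exact hφ₀
  refine ⟨φ₁.restrictScalars k, hφ₁, ?_⟩
  apply arrange _ _ _ hinj
  have h3 := congrArg (Polynomial.map ((φ₁.restrictScalars k : K →ₐ[k] Ω) : K →+* Ω)) h.hs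
  rw [fam_map] at h3
  rw [← hσ, ← hφ₁]
  refine Eq.trans ?_ h3.symm
  rw [Polynomial.map_prod]
  simp

end
end S2S


set_option linter.unusedSimpArgs false
namespace S2S

open Finset Polynomial

section
variable {k : Type*} [Field k]

/-- constant coefficient as an algebra map -/
noncomputable def ccA : PowerSeries k →ₐ[k] k :=
  { (PowerSeries.constantCoeff : PowerSeries k →+* k) with
    commutes' := fun a => by simp [PowerSeries.algebraMap_apply] }

lemma ccA_apply (y : PowerSeries k) : ccA y = PowerSeries.constantCoeff y := rfl

/-- `w ↦ -w` -/
noncomputable def negA : PowerSeries k →ₐ[k] PowerSeries k :=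
  { (PowerSeries.rescale (-1 : k) : PowerSeries k →+* PowerSeries k) with
    commutes' := fun a => by
      ext m
      simp only [PowerSeries.algebraMap_apply, Algebra.algebraMap_self, RingHom.id_apply,
        RingHom.toMonoidHom_eq_coe, OneHom.toFun_eq_coe, MonoidHom.toOneHom_coe, MonoidHom.coe_coe]
      rw [PowerSeries.coeff_rescale, PowerSeries.coeff_C]
      split_ifs with h <;> simp [h] }

lemma negA_coeff (y : PowerSeries k) (m : ℕ) :
    PowerSeries.coeff m (negA y) = (-1) ^ m * PowerSeries.coeff m y := PowerSeries.coeff_rescale _ _ _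

lemma negA_const (y : PowerSeries k) :
    PowerSeries.constantCoeff (negA y) = PowerSeries.constantCoeff y := by
  have := negA_coeff y 0
  simpa using this

lemma negA_X : negA (PowerSeries.X : PowerSeries k) = -PowerSeries.X := by
  ext m
  rw [negA_coeff, PowerSeries.coeff_X, map_neg, PowerSeries.coeff_X]
  split_ifs with h
  · simp [h]
  · simp

lemma negA_inj : Function.Injective (negA : PowerSeries k →ₐ[k] PowerSeries k) := by
  intro x y h
  ext m
  have := congrArg (PowerSeries.coeff m) h
  rw [negA_coeff, negA_coeff] at this
  exact mul_left_cancel₀ (pow_ne_zero _ (neg_ne_zero.2 one_ne_zero)) this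

lemma fam_eval_map {B B' : Type*} [CommRing B] [CommRing B'] [Algebra k B] [Algebra k B']
    (φ : B →ₐ[k] B') (f : k[X]) (T y : B) : φ ((fam f T).eval y) = (fam f (φ T)).eval (φ y) := by
  simp [fam_eval, aeval_algHom_apply]

lemma fam_deriv_eval_map {B B' : Type*} [CommRing B] [CommRing B'] [Algebra k B] [Algebra k B']
    (φ : B →ₐ[k] B') (f : k[X]) (T y : B) :
    φ ((fam f T).derivative.eval y) = (fam f (φ T)).derivative.eval (φ y) := by
  simp [fam_deriv_eval, aeval_algHom_apply]

lemma fam_hensel (f : k[X]) (T : PowerSeries k) (r : k) (h0 : (fam f (ccA T)).eval r = 0)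
    (h1 : (fam f (ccA T)).derivative.eval r ≠ 0) :
    ∃ y, ccA y = r ∧ (fam f T).eval y = 0 := by
  have e : ccA (PowerSeries.C r) = r := by simp [ccA_apply]
  apply hensel (fam f T) r ((fam f (ccA T)).derivative.eval r)⁻¹
  · rw [← ccA_apply, fam_eval_map, e, h0]
  · rw [← ccA_apply, fam_deriv_eval_map, e, mul_inv_cancel₀ h1]

lemma fam_hensel_unique (f : k[X]) (T : PowerSeries k) {y z : PowerSeries k}
    (hy : (fam f T).eval y = 0) (hz : (fam f T).eval z = 0) (hc : ccA y = ccA z)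
    (h1 : (fam f (ccA T)).derivative.eval (ccA y) ≠ 0) : y = z := by
  apply hensel_unique _ hy hz hc
  rw [← ccA_apply, fam_deriv_eval_map]
  exact h1

lemma sep_roots [IsAlgClosed k] {p : k[X]} {n : ℕ} (hm : p.Monic) (hn : p.natDegree = n)
    (hs : p.Separable) : ∃ r : Fin n → k, Function.Injective r ∧ ∀ i, p.eval (r i) = 0 := by
  classical
  have h1 : p.roots.toFinset.card = n := by
    rw [Multiset.toFinset_card_of_nodup (nodup_roots hs), ← hn]
    exact ((IsAlgClosed.splits p).natDegree_eq_card_roots).symm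
  refine ⟨fun i => ((p.roots.toFinset.equivFinOfCardEq h1).symm i : k), ?_, ?_⟩
  · intro i j h
    exact (p.roots.toFinset.equivFinOfCardEq h1).symm.injective (Subtype.ext h)
  · intro i
    have := ((p.roots.toFinset.equivFinOfCardEq h1).symm i).2
    rw [Multiset.mem_toFinset, mem_roots hm.ne_zero] at this
    exact this

lemma sep_deriv {p : k[X]} (hs : p.Separable) {r : k} (h : p.eval r = 0) :
    p.derivative.eval r ≠ 0 := by
  have := hs.eval₂_derivative_ne_zero (RingHom.id k) (x := r) (by simpa using h)
  simpa using this

lemma sq_eq_const (h2 : (2 : k) ≠ 0) {a b : PowerSeries k} (h : a ^ 2 = b ^ 2) (hc : ccA a = ccA b)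
    (h0 : ccA a ≠ 0) : a = b := by
  rcases sq_eq_sq_iff_eq_or_eq_neg.1 h with h | h
  · exact h
  · exfalso
    have e : ccA a = - ccA b := by rw [h, map_neg]
    rw [← hc] at e
    have : 2 * ccA a = 0 := by linear_combination e
    exact (mul_ne_zero h2 h0) this

lemma place_sign [IsAlgClosed k] (h2 : (2 : k) ≠ 0) {n : ℕ} (hn2 : 2 ≤ n) {f : k[X]} (hf : f.Monic)
    (hn : f.natDegree = n) (h3 : (fam f (f.eval 0)).Separable) :
    ∃ σ : Fin n → PowerSeries k, ∃ a : Fin n,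
      fam f (PowerSeries.C (f.eval 0) + PowerSeries.X ^ 2) = ∏ i, (X + C (σ i ^ 2)) ∧
      Function.Injective (fun i => σ i ^ 2) ∧ (∀ i, σ i ≠ 0) ∧
      ∀ i, negA (σ i) = if i = a then - σ i else σ i := by
  set t := f.eval 0 with ht
  set T : PowerSeries k := PowerSeries.C t + PowerSeries.X ^ 2 with hT
  have hcT : ccA T = t := by simp [hT, ccA_apply]
  have hnT : negA T = T := by
    rw [hT, map_add, map_pow, negA_X, neg_sq]
    congr 1
    exact negA.commutes t
  obtain ⟨hm, hd⟩ := fam_monic f t hf hn hn2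
  obtain ⟨hm', hd'⟩ := fam_monic f T hf hn hn2
  obtain ⟨r, hr, hr0⟩ := sep_roots hm hd h3
  have hder : ∀ i, (fam f t).derivative.eval (r i) ≠ 0 := fun i => sep_deriv h3 (hr0 i)
  have hy : ∀ i, ∃ y, ccA y = r i ∧ (fam f T).eval y = 0 := fun i => by
    apply fam_hensel <;> rw [hcT]
    · exact hr0 i
    · exact hder i
  choose y hyc hy0 using hy
  have hyinj : Function.Injective y := fun i j h => hr (by rw [← hyc, ← hyc, h])
  have hprod := prod_of_roots _ hm' hd' y hy0 hyinj
  have hyneg : ∀ i, negA (y i) = y i := by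
    intro i
    apply fam_hensel_unique f T
    · rw [← hnT, ← fam_eval_map, hy0, map_zero]
    · exact hy0 i
    · exact negA_const _
    · rw [hcT, ccA_apply, negA_const, ← ccA_apply, hyc]; exact hder i
  obtain ⟨a, ha⟩ : ∃ a, r a = 0 := by
    have e1 : (fam f t).eval 0 = 0 := by rw [fam_eval]; simp [ht, coeff_zero_eq_eval_zero]
    rw [prod_of_roots _ hm hd r hr0 hr, eval_prod] at e1
    obtain ⟨a, _, h⟩ := Finset.prod_eq_zero_iff.1 e1
    exact ⟨a, by simpa using h⟩
  have hσ : ∀ i, ∃ σ : PowerSeries k, σ ^ 2 = - y i ∧ σ ≠ 0 ∧ negA σ = if i = a then -σ else σ := by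
    intro i
    split_ifs with hi
    · subst hi
      set u := aeval (y i) f.divX + T with hu
      have hyu : y i * u = PowerSeries.X ^ 2 := by
        have e1 := hy0 i
        rw [fam_eval] at e1
        have e2 := congrArg (aeval (y i)) (divX_mul_X_add f)
        simp only [map_add, map_mul, aeval_X, aeval_C, coeff_zero_eq_eval_zero] at e2
        rw [← ht] at e2
        rw [← e2, PowerSeries.algebraMap_apply] at e1
        rw [hu, hT] at *
        simp only [Algebra.algebraMap_self, RingHom.id_apply] at e1
        linear_combination e1
      have hcu : ccA u ≠ 0 := by
        have e1 := hder i
        rw [fam_deriv_eval, ha] at e1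
        have e2 := congrArg derivative (divX_mul_X_add f)
        have e3 := congrArg (eval 0) e2
        simp only [derivative_add, derivative_mul, derivative_X, derivative_C, eval_add, eval_mul,
          eval_X, mul_zero, eval_one, mul_one, zero_add, eval_zero, add_zero] at e3
        rw [hu, map_add, hcT, ← aeval_algHom_apply, hyc, ha]
        rw [coe_aeval_eq_eval] at *
        rwa [e3]
      obtain ⟨z, hz, hz2⟩ := ps_sqrt h2 (-u) (by rw [← ccA_apply, map_neg]; exact neg_ne_zero.2 hcu)
      have hzz := PowerSeries.mul_inv_cancel z hz
      have hsq : (PowerSeries.X * z⁻¹) ^ 2 = - y i := by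
        rw [mul_pow, ← hyu]
        have : u = - z ^ 2 := by rw [hz2]; ring
        rw [this]
        linear_combination (-y i * (z * z⁻¹ + 1)) * hzz
      have hc1 : PowerSeries.coeff 1 (PowerSeries.X * z⁻¹) ≠ 0 := by
        have := PowerSeries.coeff_succ_X_mul 0 z⁻¹
        rw [zero_add] at this
        rw [this]
        simpa using hz
      refine ⟨PowerSeries.X * z⁻¹, hsq, ?_, ?_⟩
      · intro h; rw [h] at hc1; simp at hc1
      · have e1 : (negA (PowerSeries.X * z⁻¹)) ^ 2 = (PowerSeries.X * z⁻¹) ^ 2 := by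
          rw [← map_pow, hsq, map_neg, hyneg]
        rcases sq_eq_sq_iff_eq_or_eq_neg.1 e1 with h | h
        · exfalso
          have := congrArg (PowerSeries.coeff 1) h
          rw [negA_coeff] at this
          have : 2 * PowerSeries.coeff 1 (PowerSeries.X * z⁻¹) = 0 := by linear_combination -this
          exact mul_ne_zero h2 hc1 this
        · exact h
    · have hri : r i ≠ 0 := fun h => hi (hr (by rw [h, ha]))
      obtain ⟨z, hz, hz2⟩ := ps_sqrt h2 (-y i) (by
        rw [← ccA_apply, map_neg, hyc]; exact neg_ne_zero.2 hri)
      refine ⟨z, hz2, ?_, ?_⟩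
      · rintro rfl; simp at hz
      · apply sq_eq_const h2
        · rw [← map_pow, hz2, map_neg, hyneg]
        · exact negA_const _
        · rw [ccA_apply, negA_const]; exact hz
  choose σ hσ2 hσ0 hσn using hσ
  refine ⟨σ, a, ?_, ?_, hσ0, hσn⟩
  · rw [hprod]
    refine Finset.prod_congr rfl fun i _ => ?_
    rw [hσ2, C_neg, sub_eq_add_neg]
  · intro i j h
    simp only [hσ2] at h
    exact hyinj (neg_injective h)


lemma place_swap [IsAlgClosed k] (h2 : (2 : k) ≠ 0) {n : ℕ} (hn2 : 2 ≤ n) {f : k[X]} (hf : f.Monic)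
    (hn : f.natDegree = n) {x0 t0 : k} {m : k[X]} (hx0 : x0 ≠ 0) (hx1 : x0 ≠ 1)
    (hfm : fam f t0 = (X - C x0) ^ 2 * m) (hms : m.Separable) (hmx : m.eval x0 ≠ 0)
    (hm0 : m.eval 0 ≠ 0) :
    ∃ σ : Fin n → PowerSeries k, ∃ a b : Fin n, a ≠ b ∧
      fam f (PowerSeries.C t0 + PowerSeries.X ^ 2) = ∏ i, (X + C (σ i ^ 2)) ∧
      Function.Injective (fun i => σ i ^ 2) ∧ (∀ i, σ i ≠ 0) ∧
      ∀ i, negA (σ i ^ 2) = σ (Equiv.swap a b i) ^ 2 := by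
  set T : PowerSeries k := PowerSeries.C t0 + PowerSeries.X ^ 2 with hT
  have hcT : ccA T = t0 := by simp [hT, ccA_apply]
  have hnT : negA T = T := by
    rw [hT, map_add, map_pow, negA_X, neg_sq]
    congr 1
    exact negA.commutes t0
  obtain ⟨hmo, hd⟩ := fam_monic f t0 hf hn hn2
  obtain ⟨hmo', hd'⟩ := fam_monic f T hf hn hn2
  have hX2 : ((X - C x0) ^ 2).Monic := (monic_X_sub_C x0).pow 2
  have hmm : m.Monic := by
    rw [hfm] at hmo; exact hX2.of_mul_monic_left hmo
  obtain ⟨n, rfl⟩ : ∃ n', n = n' + 2 := ⟨n - 2, by omega⟩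
  have hmd : m.natDegree = n := by
    have h := hd
    rw [hfm, hX2.natDegree_mul hmm, (monic_X_sub_C x0).natDegree_pow, natDegree_X_sub_C] at h
    omega
  obtain ⟨r, hr, hr0⟩ := sep_roots hmm hmd hms
  have hrx : ∀ i, r i ≠ x0 := fun i h => hmx (by rw [← h]; exact hr0 i)
  have hder : ∀ i, (fam f t0).derivative.eval (r i) ≠ 0 := fun i => by
    have := mul_ne_zero (pow_ne_zero 2 (sub_ne_zero.2 (hrx i))) (sep_deriv hms (hr0 i))
    rw [hfm, derivative_mul]
    simpa [hr0 i] using this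
  have hy : ∀ i, ∃ y, ccA y = r i ∧ (fam f T).eval y = 0 := fun i => by
    apply fam_hensel <;> rw [hcT]
    · rw [hfm, eval_mul, hr0, mul_zero]
    · exact hder i
  choose y hyc hy0 using hy
  have hval : ∀ z : PowerSeries k, (fam f T).eval z =
      (z - PowerSeries.C x0) ^ 2 * aeval z m + PowerSeries.X ^ 2 * (z - 1) := by
    intro z
    have e1 := congrArg (aeval z) hfm
    simp only [fam, map_add, map_mul, aeval_C, map_sub, map_pow, aeval_X, map_one,
      Algebra.algebraMap_self, Polynomial.map_id] at e1
    rw [fam_eval, hT]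
    have e3 : ∀ a : k, algebraMap k (PowerSeries k) a = PowerSeries.C a := fun a => rfl
    rw [e3, e3] at e1
    linear_combination e1
  obtain ⟨c, hc⟩ := IsAlgClosed.exists_pow_nat_eq ((1 - x0) / m.eval x0) (n := 2) (by norm_num)
  have hc0 : c ≠ 0 := by
    rintro rfl
    rw [zero_pow two_ne_zero, eq_comm, div_eq_zero_iff, sub_eq_zero] at hc
    rcases hc with h | h
    · exact hx1 h.symm
    · exact hmx h
  have hc2 : c ^ 2 * m.eval x0 = 1 - x0 := by rw [hc]; field_simp
  have hz : ∀ c : k, c ≠ 0 → c ^ 2 * m.eval x0 = 1 - x0 → ∃ z, ccA z = c ∧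
      (fam f T).eval (PowerSeries.C x0 + PowerSeries.X * z) = 0 := by
    intro c hc0 hc2
    let p : (PowerSeries k)[X] := X ^ 2 * (m.map (algebraMap k (PowerSeries k))).comp
      (C (PowerSeries.C x0) + C PowerSeries.X * X) + C (PowerSeries.C x0 - 1) + C PowerSeries.X * X
    have hp : ∀ z, p.eval z = z ^ 2 * aeval (PowerSeries.C x0 + PowerSeries.X * z) m
        + (PowerSeries.C x0 - 1) + PowerSeries.X * z := by
      intro z
      simp only [p, eval_add, eval_mul, eval_pow, eval_X, eval_comp, eval_C, eval_map_algebraMap]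
    obtain ⟨z, hz1, hz2⟩ := hensel p c (2 * c * m.eval x0)⁻¹ (by
      rw [hp, ← ccA_apply]
      simp only [map_add, map_mul, map_pow, map_sub, map_one, ← aeval_algHom_apply]
      simp only [ccA_apply, PowerSeries.constantCoeff_C, PowerSeries.constantCoeff_X, zero_mul,
        add_zero, coe_aeval_eq_eval, hc2]
      ring) (by
      have : PowerSeries.constantCoeff (p.derivative.eval (PowerSeries.C c)) = 2 * c * m.eval x0 := by
        simp only [p, derivative_add, derivative_mul, derivative_C, derivative_X, derivative_comp,
          derivative_X_pow, eval_add, eval_mul, eval_pow, eval_X, eval_comp, eval_C,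
          eval_map_algebraMap, zero_mul, zero_add, mul_one, add_zero, derivative_map]
        rw [← ccA_apply]
        simp only [map_add, map_mul, map_pow, map_sub, map_one, ← aeval_algHom_apply]
        simp only [ccA_apply, PowerSeries.constantCoeff_C, PowerSeries.constantCoeff_X, zero_mul,
          add_zero, coe_aeval_eq_eval, mul_zero]
        norm_num
        left
        norm_num [map_ofNat]
      rw [this]
      exact mul_inv_cancel₀ (mul_ne_zero (mul_ne_zero h2 hc0) hmx))
    refine ⟨z, hz1, ?_⟩
    rw [hval]
    rw [hp] at hz2
    linear_combination PowerSeries.X ^ 2 * hz2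
  obtain ⟨zp, hzp, hxp⟩ := hz c hc0 hc2
  obtain ⟨zm, hzm, hxm⟩ := hz (-c) (neg_ne_zero.2 hc0) (by rw [neg_sq]; exact hc2)
  set xp := PowerSeries.C x0 + PowerSeries.X * zp with hxp'
  set xm := PowerSeries.C x0 + PowerSeries.X * zm with hxm'
  have cp : ccA xp = x0 := by simp [hxp', ccA_apply]
  have cm : ccA xm = x0 := by simp [hxm', ccA_apply]
  have c1 : ∀ z : PowerSeries k, PowerSeries.coeff 1 (PowerSeries.C x0 + PowerSeries.X * z) = ccA z := by
    intro z
    have := PowerSeries.coeff_succ_X_mul 0 z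
    rw [zero_add] at this
    rw [map_add, this, PowerSeries.coeff_C]; simp [ccA_apply]
  have cp1 : PowerSeries.coeff 1 xp = c := by rw [hxp', c1, hzp]
  have cm1 : PowerSeries.coeff 1 xm = -c := by rw [hxm', c1, hzm]
  have hcc : c ≠ -c := by
    intro h
    have : 2 * c = 0 := by linear_combination h
    exact mul_ne_zero h2 hc0 this
  have hpm : xp ≠ xm := by
    intro h
    rw [h, cm1] at cp1
    exact hcc cp1.symm
  have hyinj : Function.Injective y := fun i j h => hr (by rw [← hyc, ← hyc, h])
  have hyp : ∀ i, y i ≠ xp := fun i h => hrx i (by rw [← hyc, h, cp])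
  have hym : ∀ i, y i ≠ xm := fun i h => hrx i (by rw [← hyc, h, cm])
  let ys : Fin (n + 2) → PowerSeries k := Fin.cons xp (Fin.cons xm y)
  have ys0 : ys 0 = xp := rfl
  have ys1 : ys 1 = xm := rfl
  have yss : ∀ i : Fin n, ys i.succ.succ = y i := fun i => rfl
  have hcases : ∀ i : Fin (n + 2), i = 0 ∨ i = 1 ∨ ∃ j : Fin n, i = j.succ.succ := by
    intro i
    rcases Fin.eq_zero_or_eq_succ i with h | ⟨j, rfl⟩
    · exact Or.inl h
    · rcases Fin.eq_zero_or_eq_succ j with h | ⟨j, rfl⟩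
      · subst h; exact Or.inr (Or.inl rfl)
      · exact Or.inr (Or.inr ⟨j, rfl⟩)
  have hysinj : Function.Injective ys := by
    intro i j h
    rcases hcases i with rfl | rfl | ⟨i, rfl⟩ <;> rcases hcases j with rfl | rfl | ⟨j, rfl⟩
    · rfl
    · exact absurd h hpm
    · exact absurd h.symm (hyp j)
    · exact absurd h.symm hpm
    · rfl
    · exact absurd h.symm (hym j)
    · exact absurd h (hyp i)
    · exact absurd h (hym i)
    · rw [hyinj ((yss i).symm.trans (h.trans (yss j)))]
  have hys0 : ∀ i, (fam f T).eval (ys i) = 0 := by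
    intro i
    rcases hcases i with rfl | rfl | ⟨i, rfl⟩
    · exact hxp
    · exact hxm
    · exact hy0 i
  have hprod := prod_of_roots _ hmo' hd' ys hys0 hysinj
  have hroot : ∀ z, (fam f T).eval z = 0 → ∃ j, z = ys j := by
    intro z hz
    rw [hprod, eval_prod] at hz
    obtain ⟨j, _, h⟩ := Finset.prod_eq_zero_iff.1 hz
    exact ⟨j, by simpa [sub_eq_zero] using h⟩
  have hneg0 : ∀ i, (fam f T).eval (negA (ys i)) = 0 := by
    intro i
    rw [← hnT, ← fam_eval_map, hys0, map_zero]
  have hyneg : ∀ i, negA (y i) = y i := by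
    intro i
    apply fam_hensel_unique f T
    · exact hneg0 i.succ.succ
    · exact hy0 i
    · exact negA_const _
    · rw [hcT, ccA_apply, negA_const, ← ccA_apply, hyc]; exact hder i
  have hnp : negA xp = xm := by
    obtain ⟨j, hj⟩ := hroot _ (hneg0 0)
    rw [ys0] at hj
    rcases hcases j with rfl | rfl | ⟨j, rfl⟩
    · have := congrArg (PowerSeries.coeff 1) hj
      rw [negA_coeff, ys0, cp1] at this
      exact absurd (by linear_combination -this) hcc
    · exact hj
    · have := congrArg ccA hj
      rw [ccA_apply, negA_const, ← ccA_apply, cp, yss, hyc] at this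
      exact absurd this.symm (hrx j)
  have hnm : negA xm = xp := by
    rw [← hnp]
    ext l
    rw [negA_coeff, negA_coeff, ← mul_assoc, ← mul_pow]; simp
  have hσ : ∀ i, ∃ σ : PowerSeries k, PowerSeries.constantCoeff σ ≠ 0 ∧ σ ^ 2 = - ys i := by
    intro i
    apply ps_sqrt h2
    rw [map_neg, neg_ne_zero, ← ccA_apply]
    rcases hcases i with rfl | rfl | ⟨i, rfl⟩
    · rw [ys0, cp]; exact hx0
    · rw [ys1, cm]; exact hx0
    · rw [yss, hyc]; intro h; have h9 := hr0 i; rw [h] at h9; exact hm0 h9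
  choose σ hσ0 hσ2 using hσ
  refine ⟨σ, 0, 1, by simp, ?_, ?_, ?_, ?_⟩
  · rw [hprod]
    refine Finset.prod_congr rfl fun i _ => ?_
    rw [hσ2, C_neg, sub_eq_add_neg]
  · intro i j h
    simp only [hσ2] at h
    exact hysinj (neg_injective h)
  · intro i h
    apply hσ0 i
    rw [h, map_zero]
  · intro i
    rw [hσ2, hσ2, map_neg]
    congr 1
    rcases hcases i with rfl | rfl | ⟨i, rfl⟩
    · rw [Equiv.swap_apply_left]; exact hnp
    · rw [Equiv.swap_apply_right]; exact hnm
    · rw [Equiv.swap_apply_of_ne_of_ne (Fin.succ_ne_zero _), yss, hyneg]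
      intro h
      have : (i.succ.succ : Fin (n+2)) = (0 : Fin (n+1)).succ := h
      exact Fin.succ_ne_zero _ (Fin.succ_injective _ this)

end
end S2S


set_option linter.unusedSimpArgs false
namespace S2S

open Finset Polynomial

section
variable {k : Type*} [Field k]

lemma coeff_divX_iter (g : k[X]) (i m : ℕ) : (divX^[i] g).coeff m = g.coeff (m + i) := by
  induction i generalizing m with
  | zero => rfl
  | succ i ih => rw [Function.iterate_succ_apply', coeff_divX, ih]; congr 1; omega

/-- Eisenstein polynomial for the point stabilizer -/
noncomputable def eisP (g : k[X]) (N : ℕ) : k[X][X] :=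
  X ^ (N + 1) + ∑ i ∈ range (N + 1), C (C (-(g.coeff 0)⁻¹) * X * divX^[i + 2] g) * X ^ (N - i)

lemma eisP_coeff (g : k[X]) (N m : ℕ) (hm : m ≤ N) :
    (eisP g N).coeff m = C (-(g.coeff 0)⁻¹) * X * divX^[N - m + 2] g := by
  rw [eisP, coeff_add, coeff_X_pow, if_neg (by omega), zero_add, finsetSum_coeff,
    Finset.sum_eq_single (N - m)]
  · rw [coeff_C_mul, coeff_X_pow, if_pos (by omega), mul_one]
  · intro i hi hne
    rw [coeff_C_mul, coeff_X_pow, if_neg, mul_zero]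
    rw [mem_range] at hi
    omega
  · intro h; exact absurd (mem_range.2 (by omega)) h

lemma eisP_monic (g : k[X]) (N : ℕ) : (eisP g N).Monic ∧ (eisP g N).natDegree = N + 1 := by
  have h1 : (∑ i ∈ range (N + 1), C (C (-(g.coeff 0)⁻¹) * X * divX^[i + 2] g) *
      (X : k[X][X]) ^ (N - i)).degree < ((N + 1 : ℕ) : WithBot ℕ) := by
    refine lt_of_le_of_lt (degree_sum_le _ _) ?_
    rw [Finset.sup_lt_iff (WithBot.bot_lt_coe _)]
    intro i _
    refine lt_of_le_of_lt (degree_C_mul_X_pow_le _ _) ?_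
    exact_mod_cast (by omega : N - i < N + 1)
  have hm : (eisP g N).Monic := monic_X_pow_add h1
  refine ⟨hm, ?_⟩
  apply natDegree_eq_of_degree_eq_some
  rw [eisP, degree_add_eq_left_of_degree_lt]
  · rw [degree_X_pow]
  · rw [degree_X_pow]; exact h1

lemma eisP_irred (g : k[X]) (N : ℕ) (hg : g.Monic) (hd : g.natDegree = N + 2) (h0 : g.coeff 0 ≠ 0) :
    Irreducible (eisP g N) := by
  obtain ⟨hm, hdeg⟩ := eisP_monic g N
  have hp : (Ideal.span {(X : k[X])}).IsPrime := by
    rw [Ideal.span_singleton_prime X_ne_zero]; exact prime_X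
  apply IsEisensteinAt.irreducible (𝓟 := Ideal.span {(X : k[X])}) _ hp hm.isPrimitive (by omega)
  constructor
  · rw [hm.leadingCoeff]
    exact fun h => hp.ne_top ((Ideal.eq_top_iff_one _).2 h)
  · intro m hm
    rw [eisP_coeff _ _ _ (by omega), Ideal.mem_span_singleton]
    exact ⟨C (-(g.coeff 0)⁻¹) * divX^[N - m + 2] g, by ring⟩
  · rw [eisP_coeff _ _ _ (by omega), Ideal.span_singleton_pow, Ideal.mem_span_singleton]
    intro h
    rw [X_pow_dvd_iff] at h
    have := h 1 (by omega)
    rw [mul_assoc, coeff_C_mul, coeff_X_mul, coeff_divX_iter] at this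
    rw [show 0 + (N - 0 + 2) = g.natDegree by omega, hg.coeff_natDegree] at this
    simp [h0] at this

lemma eisP_root {K : Type*} [Field K] [Algebra k K] (g : k[X]) (N : ℕ) (hd : g.natDegree = N + 2)
    (h0 : g.coeff 0 ≠ 0) (a b : K) (hb : b ≠ 0) (hab : b ≠ a)
    (h : aeval b g * a = aeval a g * b) :
    (eisP g N).eval₂ ((aeval a : k[X] →ₐ[k] K) : k[X] →+* K) b⁻¹ = 0 := by
  set u : K := algebraMap k K (g.coeff 0) with hu
  have hu0 : u ≠ 0 := by rw [hu]; simpa using h0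
  set D : ℕ → K := fun i => aeval a (divX^[i] g) with hD
  set c : ℕ → K := fun i => algebraMap k K (g.coeff i) with hc
  have hrec : ∀ i, D i = c i + a * D (i + 1) := by
    intro i
    have := congrArg (aeval a) (divX_mul_X_add (divX^[i] g))
    rw [map_add, map_mul, aeval_X, aeval_C, coeff_divX_iter, zero_add] at this
    simp only [hD, hc]
    rw [← this, Function.iterate_succ_apply']
    ring
  have hlast : D (N + 3) = 0 := by
    have : divX^[N + 3] g = 0 := by
      ext m
      rw [coeff_divX_iter, coeff_zero, coeff_eq_zero_of_natDegree_lt]; omega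
    simp only [hD, this, map_zero]
  have hgb : aeval b g = u + c 1 * b + ∑ i ∈ range (N + 1), c (i + 2) * b ^ (i + 2) := by
    rw [aeval_eq_sum_range, hd, Finset.sum_range_succ', Finset.sum_range_succ']
    simp only [Algebra.smul_def, zero_add, pow_one, pow_zero, mul_one, hc, hu, add_assoc]
    norm_num
    ring
  have hga : aeval a g = u + a * c 1 + a ^ 2 * D 2 := by
    have e0 : aeval a g = D 0 := rfl
    rw [e0, hrec 0, hrec 1]
    simp only [hc, hu]; ring
  have key : ∀ M, (b - a) * ∑ i ∈ range M, D (i + 2) * b ^ (i + 1) =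
      ∑ i ∈ range M, c (i + 2) * b ^ (i + 2) - a * D 2 * b + a * D (M + 2) * b ^ (M + 1) := by
    intro M
    induction M with
    | zero => simp
    | succ M ih =>
      rw [Finset.sum_range_succ, Finset.sum_range_succ, mul_add, ih, hrec (M + 2)]
      ring
  have k1 := key (N + 1)
  rw [show N + 1 + 2 = N + 3 from rfl, hlast] at k1
  have k2 : u = a * ∑ i ∈ range (N + 1), D (i + 2) * b ^ (i + 1) := by
    have : (b - a) * (u - a * ∑ i ∈ range (N + 1), D (i + 2) * b ^ (i + 1)) = 0 := by
      rw [hgb, hga] at h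
      linear_combination -a * k1 - h
    rcases mul_eq_zero.1 this with h | h
    · exact absurd (sub_eq_zero.1 h) hab
    · exact sub_eq_zero.1 h
  rw [eisP, eval₂_add, eval₂_finsetSum, eval₂_X_pow]
  have e : ∀ i ∈ range (N + 1), eval₂ ((aeval a : k[X] →ₐ[k] K) : k[X] →+* K) b⁻¹
      (C (C (-(g.coeff 0)⁻¹) * X * divX^[i + 2] g) * X ^ (N - i)) =
      -(u⁻¹ * a * (b⁻¹) ^ (N + 1)) * (D (i + 2) * b ^ (i + 1)) := by
    intro i hi
    rw [eval₂_mul, eval₂_C, eval₂_X_pow, RingHom.coe_coe, map_mul, map_mul, aeval_C, aeval_X]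
    have hi' := mem_range.1 hi
    have : (b⁻¹) ^ (N + 1) = (b⁻¹) ^ (N - i) * (b⁻¹) ^ (i + 1) := by
      rw [← pow_add]; congr 1; omega
    rw [this]
    have h3 : (b⁻¹) ^ (i + 1) * b ^ (i + 1) = 1 := by rw [← mul_pow, inv_mul_cancel₀ hb, one_pow]
    simp only [map_neg, map_inv₀, hD, hu]
    linear_combination ((algebraMap k K (g.coeff 0))⁻¹ * a * (b⁻¹) ^ (N - i)
      * aeval a (divX^[i + 2] g)) * h3
  rw [Finset.sum_congr rfl e, ← Finset.mul_sum]
  have h5 := mul_inv_cancel₀ hu0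
  linear_combination (-(b⁻¹) ^ (N + 1)) * h5 + (u⁻¹ * (b⁻¹) ^ (N + 1)) * k2

end
end S2S


set_option linter.all false
namespace S2S

open Finset Polynomial

section
variable {k : Type*} [Field k]

lemma ratfunc_ext {Ω : Type*} [Field Ω] [Algebra k Ω] (φ ψ : RatFunc k →ₐ[k] Ω)
    (h : φ RatFunc.X = ψ RatFunc.X) : φ = ψ := by
  apply IsLocalization.algHom_ext (nonZeroDivisors k[X])
  apply Polynomial.algHom_ext
  change φ (algebraMap k[X] (RatFunc k) X) = ψ (algebraMap k[X] (RatFunc k) X)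
  rw [RatFunc.algebraMap_X]
  exact h

lemma ratfunc_hom {Ω : Type*} [Field Ω] [Algebra k Ω] (T : Ω)
    (hT : Function.Injective (aeval T : k[X] →ₐ[k] Ω)) :
    ∃ φ : RatFunc k →ₐ[k] Ω, φ RatFunc.X = T := by
  refine ⟨IsFractionRing.liftAlgHom hT, ?_⟩
  rw [← RatFunc.algebraMap_X]
  have := IsFractionRing.lift_algebraMap (K := RatFunc k) (g := ((aeval T : k[X] →ₐ[k] Ω) : k[X] →+* Ω)) hT X
  simpa using this

end

section
variable {k K : Type*} [Field k] [Field K] [Algebra k K] [Algebra (RatFunc k) K]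
  [IsScalarTower k (RatFunc k) K] {n : ℕ} {f : k[X]} {s : Fin n → K}

lemma Setup.normal (h : Setup f s) : Normal (RatFunc k) K := by
  have := h.splitting
  exact Normal.of_isSplittingField (defpoly f)

lemma Setup.finite (h : Setup f s) : FiniteDimensional (RatFunc k) K := by
  have := h.splitting
  exact IsSplittingField.finiteDimensional K (defpoly f)

lemma t_not_const (a : k) : algebraMap (RatFunc k) K RatFunc.X ≠ algebraMap k K a := by
  rw [IsScalarTower.algebraMap_apply k (RatFunc k) K]
  intro h
  have h1 := (algebraMap (RatFunc k) K).injective h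
  rw [← RatFunc.algebraMap_X, IsScalarTower.algebraMap_apply k k[X] (RatFunc k)] at h1
  have h2 := RatFunc.algebraMap_injective k h1
  exact X_ne_C a h2

lemma Setup.root (h : Setup f s) (i : Fin n) :
    aeval (-s i ^ 2) f + algebraMap (RatFunc k) K RatFunc.X * (-s i ^ 2 - 1) = 0 := by
  rw [← fam_eval, h.hs, eval_prod]
  exact Finset.prod_eq_zero (mem_univ i) (by simp)

/-- the function field of the curve of one root, with `t` mapping to `-g(X)/X`. -/
lemma one_root [IsAlgClosed k] (h : Setup f s) (g1 : f.eval 1 ≠ 0) :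
    ∃ φ : RatFunc k →ₐ[k] FractionRing k[X], ∀ i, ∃ θ : FractionRing k[X] →ₐ[k] K,
      θ (algebraMap k[X] _ X) = -s i ^ 2 - 1 ∧ ∀ x, θ (φ x) = algebraMap (RatFunc k) K x := by
  set g : k[X] := f.comp (X + 1) with hg
  have hg0 : g.coeff 0 ≠ 0 := by
    rw [coeff_zero_eq_eval_zero, hg, eval_comp]; simpa using g1
  set Y : FractionRing k[X] := algebraMap k[X] _ X with hY
  have hY0 : Y ≠ 0 := by
    rw [hY]; simpa using X_ne_zero
  have hinj : Function.Injective (algebraMap k[X] (FractionRing k[X])) := IsFractionRing.injective _ _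
  obtain ⟨φ, hφ⟩ := ratfunc_hom (k := k) (-(algebraMap k[X] (FractionRing k[X]) g) / Y) (by
    apply aeval_inj
    intro a ha
    rw [div_eq_iff hY0, IsScalarTower.algebraMap_apply k k[X] (FractionRing k[X]), ← map_mul, ← map_neg] at ha
    have := congrArg (fun p : k[X] => p.coeff 0) (hinj ha)
    simp [hg0] at this)
  refine ⟨φ, fun i => ?_⟩
  have hroot := h.root i
  set b := -s i ^ 2 - 1 with hb
  have hgb : aeval b g = aeval (-s i ^ 2) f := by
    rw [hg, aeval_comp]; simp [hb]
  rw [← hgb] at hroot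
  have hbc : ∀ a : k, b ≠ algebraMap k K a := by
    intro a ha
    rw [ha, aeval_algebraMap_apply, coe_aeval_eq_eval] at hroot
    by_cases ha0 : a = 0
    · rw [ha0, map_zero, mul_zero, add_zero, ← coeff_zero_eq_eval_zero] at hroot
      simp [hg0] at hroot
    · apply t_not_const (K := K) (-(g.eval a) / a)
      have ha0' : algebraMap k K a ≠ 0 := by simpa using ha0
      rw [map_div₀, map_neg, eq_div_iff ha0']
      linear_combination hroot
  have hb0 : b ≠ 0 := by have := hbc 0; rwa [map_zero] at this
  have hbi := aeval_inj hbc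
  have hθ : ∀ p, (IsFractionRing.liftAlgHom hbi : FractionRing k[X] →ₐ[k] K) (algebraMap k[X] _ p) = aeval b p := by
    intro p
    have := IsFractionRing.lift_algebraMap (K := FractionRing k[X]) (g := ((aeval b : k[X] →ₐ[k] K) : k[X] →+* K)) hbi p
    simpa using this
  refine ⟨IsFractionRing.liftAlgHom hbi, ?_, ?_⟩
  · rw [hθ, aeval_X]
  · have : ((IsFractionRing.liftAlgHom hbi : FractionRing k[X] →ₐ[k] K).comp φ) =
      IsScalarTower.toAlgHom k (RatFunc k) K := by
      apply ratfunc_ext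
      rw [AlgHom.comp_apply, hφ, map_div₀, map_neg, hθ, hY, hθ, aeval_X, IsScalarTower.coe_toAlgHom', div_eq_iff hb0]
      linear_combination -hroot
    intro x
    exact congrArg (fun a : RatFunc k →ₐ[k] K => a x) this

lemma Setup.trans [IsAlgClosed k] (h : Setup f s) (g1 : f.eval 1 ≠ 0) (i j : Fin n) :
    ∃ g : K ≃ₐ[RatFunc k] K, g (s i ^ 2) = s j ^ 2 := by
  have := h.normal
  obtain ⟨φ, hθ⟩ := one_root h g1
  let _ : Algebra (RatFunc k) (FractionRing k[X]) := φ.toRingHom.toAlgebra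
  have key : ∀ i, minpoly (RatFunc k) (-s i ^ 2 - 1) =
      minpoly (RatFunc k) (algebraMap k[X] (FractionRing k[X]) X) := by
    intro i
    obtain ⟨θ, h1, h2⟩ := hθ i
    let θ' : FractionRing k[X] →ₐ[RatFunc k] K := { θ with commutes' := h2 }
    rw [← minpoly.algHom_eq θ' θ'.toRingHom.injective]
    congr 1
    exact h1.symm
  have hc : IsConjRoot (RatFunc k) (-s j ^ 2 - 1) (-s i ^ 2 - 1) := (key j).trans (key i).symm
  obtain ⟨g, hg⟩ := isConjRoot_iff_exists_algEquiv.1 hc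
  refine ⟨g, ?_⟩
  rw [map_sub, map_neg, map_one] at hg
  linear_combination -hg

lemma Setup.stab [IsAlgClosed k] (h : Setup f s) (hf : f.Monic) (hn : f.natDegree = n) (hn2 : 2 ≤ n)
    (g1 : f.eval 1 ≠ 0) (hinj : Function.Injective fun i => s i ^ 2)
    (i j l : Fin n) (hj : j ≠ i) (hl : l ≠ i) :
    ∃ g : K ≃ₐ[RatFunc k] K, g (s i ^ 2) = s i ^ 2 ∧ g (s j ^ 2) = s l ^ 2 := by
  have hnor := h.normal
  obtain ⟨φ, hθ⟩ := one_root h g1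
  obtain ⟨θ, h1, h2⟩ := hθ i
  set E := FractionRing k[X] with hE
  let _ : Algebra (RatFunc k) E := φ.toRingHom.toAlgebra
  let _ : Algebra E K := θ.toRingHom.toAlgebra
  have hT : IsScalarTower (RatFunc k) E K := IsScalarTower.of_algebraMap_eq fun x => (h2 x).symm
  have := Normal.tower_top_of_normal (RatFunc k) E K
  obtain ⟨N, rfl⟩ : ∃ N, n = N + 2 := ⟨n - 2, by omega⟩
  set g : k[X] := f.comp (X + C 1) with hg
  have hgd : g.natDegree = N + 2 := by
    rw [hg, natDegree_comp, natDegree_X_add_C, hn, mul_one]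
  have hgm : g.Monic := hf.comp_X_add_C 1
  have hg0 : g.coeff 0 ≠ 0 := by
    rw [coeff_zero_eq_eval_zero, hg, eval_comp]; simpa using g1
  have hirr := eisP_irred g N hgm hgd hg0
  have hmon := (eisP_monic g N).1
  rw [hmon.irreducible_iff_irreducible_map_fraction_map (K := E)] at hirr
  have hbr : ∀ j, aeval (-s j ^ 2 - 1) g + algebraMap (RatFunc k) K RatFunc.X * (-s j ^ 2 - 1) = 0 := by
    intro j
    rw [← h.root j, hg, aeval_comp]; simp
  have hb0 : ∀ j, -s j ^ 2 - 1 ≠ 0 := by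
    intro j hj
    have := hbr j
    rw [hj, ← map_zero (algebraMap k K), aeval_algebraMap_apply, coe_aeval_eq_eval, ← coeff_zero_eq_eval_zero, map_zero, mul_zero, add_zero] at this
    simp [hg0] at this
  have key : ∀ j, j ≠ i → minpoly E (-s j ^ 2 - 1)⁻¹ = (eisP g N).map (algebraMap k[X] E) := by
    intro j hj
    symm
    refine minpoly.eq_of_irreducible_of_monic hirr ?_ (hmon.map _)
    rw [aeval_def, eval₂_map]
    have hh : (algebraMap E K).comp (algebraMap k[X] E) =
        ((aeval (-s i ^ 2 - 1) : k[X] →ₐ[k] K) : k[X] →+* K) := by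
      have : (θ.comp (IsScalarTower.toAlgHom k k[X] E)) = aeval (-s i ^ 2 - 1) := by
        apply Polynomial.algHom_ext
        rw [aeval_X]; exact h1
      rw [← this]; rfl
    rw [hh]
    apply eisP_root g N hgd hg0 _ _ (hb0 j)
    · intro e
      apply hj
      apply hinj
      simp only
      linear_combination -e
    · linear_combination (-s i ^ 2 - 1) * hbr j - (-s j ^ 2 - 1) * hbr i
  have hc : IsConjRoot E (-s l ^ 2 - 1)⁻¹ (-s j ^ 2 - 1)⁻¹ := (key l hl).trans (key j hj).symm
  obtain ⟨γ, hγ⟩ := isConjRoot_iff_exists_algEquiv.1 hc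
  refine ⟨γ.restrictScalars (RatFunc k), ?_, ?_⟩
  · have := γ.commutes (algebraMap k[X] E X)
    have e : algebraMap E K (algebraMap k[X] E X) = -s i ^ 2 - 1 := h1
    rw [e, map_sub, map_neg, map_one] at this
    rw [AlgEquiv.restrictScalars_apply]
    linear_combination -this
  · rw [map_inv₀, inv_inj, map_sub, map_neg, map_one] at hγ
    rw [AlgEquiv.restrictScalars_apply]
    linear_combination -hγ

end
end S2S


set_option linter.all false
namespace S2S

open Finset Polynomial

/-- the genericity conditions -/
structure Good {k : Type*} [Field k] (f : k[X]) : Prop where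
  one : f.eval 1 ≠ 0
  node : ∃ x0 t0 : k, ∃ m : k[X], x0 ≠ 0 ∧ x0 ≠ 1 ∧ fam f t0 = (X - C x0) ^ 2 * m ∧ m.Separable ∧
    m.eval x0 ≠ 0 ∧ m.eval 0 ≠ 0
  zero : (fam f (f.eval 0)).Separable

section
variable {k K : Type*} [Field k] [Field K] [Algebra k K] [Algebra (RatFunc k) K]
  [IsScalarTower k (RatFunc k) K] {n : ℕ} {f : k[X]} {s : Fin n → K}

lemma place_galois [IsAlgClosed k] (h : Setup f s) (t0 : k) (σ : Fin n → PowerSeries k)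
    (hσ : fam f (PowerSeries.C t0 + PowerSeries.X ^ 2) = ∏ i, (X + C (σ i ^ 2)))
    (hinj : Function.Injective (fun i => σ i ^ 2)) :
    ∃ φ : K →ₐ[k] FractionRing (PowerSeries k), ∃ g : K ≃ₐ[RatFunc k] K,
    ∃ ι : FractionRing (PowerSeries k) →+* FractionRing (PowerSeries k),
    ∃ π : Equiv.Perm (Fin n), ∃ ε : Fin n → ℤˣ,
      (∀ y : PowerSeries k, ι (algebraMap _ _ y) = algebraMap _ _ (negA y)) ∧
      (∀ i, φ (s i) = ((ε i : ℤ) : FractionRing (PowerSeries k)) *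
        algebraMap (PowerSeries k) _ (σ (π i))) ∧
      ∀ x, ι (φ x) = φ (g x) := by
  set Ω := FractionRing (PowerSeries k) with hΩ
  have hai : Function.Injective (algebraMap (PowerSeries k) Ω) := IsFractionRing.injective _ _
  set j : PowerSeries k →ₐ[k] Ω := IsScalarTower.toAlgHom k (PowerSeries k) Ω with hj
  set T : PowerSeries k := PowerSeries.C t0 + PowerSeries.X ^ 2 with hT
  have hnT : negA T = T := by
    rw [hT, map_add, map_pow, negA_X, neg_sq]
    congr 1
    exact negA.commutes t0
  have hTi : Function.Injective (aeval (j T) : k[X] →ₐ[k] Ω) := by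
    apply aeval_inj
    intro a ha
    rw [IsScalarTower.algebraMap_apply k (PowerSeries k) Ω] at ha
    have := congrArg (PowerSeries.coeff 2) (hai ha)
    rw [hT, PowerSeries.algebraMap_apply, map_add, PowerSeries.coeff_C, PowerSeries.coeff_C] at this
    simp at this
  obtain ⟨φ, hφ, π, ε, hπ⟩ := h.embed (j T) hTi (fun i => j (σ i)) (by
    rw [← fam_map, hσ, Polynomial.map_prod]
    simp) (by
    intro a b hab
    apply hinj
    apply hai
    simp only [map_pow]
    exact hab)
  let ι : Ω →+* Ω := IsFractionRing.map (A := PowerSeries k) (B := PowerSeries k) (K := Ω) (L := Ω)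
    (j := (negA : PowerSeries k →ₐ[k] PowerSeries k).toRingHom) negA_inj
  have hι : ∀ y : PowerSeries k, ι (algebraMap _ _ y) = algebraMap _ _ (negA y) := by
    intro y
    exact IsLocalization.map_eq _ _
  have hιc : ∀ a, ι (algebraMap k Ω a) = algebraMap k Ω a := by
    intro a
    rw [IsScalarTower.algebraMap_apply k (PowerSeries k) Ω, hι, AlgHom.commutes]
  let ιA : Ω →ₐ[k] Ω := { ι with commutes' := hιc }
  have := h.normal
  have e : (ιA.comp φ).comp (IsScalarTower.toAlgHom k (RatFunc k) K) =
      φ.comp (IsScalarTower.toAlgHom k (RatFunc k) K) := by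
    apply ratfunc_ext
    change ι (φ (algebraMap (RatFunc k) K RatFunc.X)) = φ (algebraMap (RatFunc k) K RatFunc.X)
    rw [hφ]
    exact (hι T).trans (by rw [hnT]; rfl)
  obtain ⟨g, hg⟩ := embed_galois (F := RatFunc k) (φ : K →+* Ω) (ιA.comp φ : K →+* Ω) (by
    intro x
    exact congrArg (fun a : RatFunc k →ₐ[k] Ω => a x) e.symm)
  exact ⟨φ, g, ι, π, ε, hι, hπ, hg⟩

lemma Setup.nondeg [IsAlgClosed k] (h2 : (2 : k) ≠ 0) (h : Setup f s) (hf : f.Monic)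
    (hn : f.natDegree = n) (hn2 : 2 ≤ n) (hg : Good f) :
    (Function.Injective fun i => s i ^ 2) ∧ ∀ i, s i ≠ 0 := by
  obtain ⟨σ, a, hσ, hinj, hσ0, hneg⟩ := place_sign h2 hn2 hf hn hg.zero
  obtain ⟨φ, g, ι, π, ε, hι, hπ, hg⟩ := place_galois h _ σ hσ hinj
  have hai : Function.Injective (algebraMap (PowerSeries k) (FractionRing (PowerSeries k))) :=
    IsFractionRing.injective _ _
  constructor
  · intro i j hij
    have := congrArg φ hij
    simp only [map_pow] at this
    rw [hπ, hπ, mul_pow, mul_pow, sign_sq, sign_sq, one_mul, one_mul, ← map_pow, ← map_pow] at this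
    exact π.injective (hinj (hai this))
  · intro i hi
    have := hπ i
    rw [hi, map_zero] at this
    have h3 := congrArg (· ^ 2) this
    simp only [mul_pow, sign_sq, one_mul] at h3
    rw [← map_pow, zero_pow two_ne_zero, eq_comm, map_eq_zero_iff _ hai] at h3
    exact hσ0 _ (pow_eq_zero_iff two_ne_zero |>.1 h3)

lemma Setup.act (h : Setup f s) (hinj : Function.Injective fun i => s i ^ 2) (g : K ≃ₐ[RatFunc k] K) :
    ∃ π : Equiv.Perm (Fin n), ∃ ε : Fin n → ℤˣ, ∀ i, g (s i) = ((ε i : ℤ) : K) * s (π i) := by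
  apply arrange (fun i => g (s i)) s _ hinj
  rw [← h.hs]
  have := congrArg (Polynomial.map ((g.toAlgHom.restrictScalars k : K →ₐ[k] K) : K →+* K)) h.hs
  rw [fam_map] at this
  have e : (g.toAlgHom.restrictScalars k : K →ₐ[k] K) (algebraMap (RatFunc k) K RatFunc.X) =
    algebraMap (RatFunc k) K RatFunc.X := g.commutes _
  rw [e] at this
  rw [this, Polynomial.map_prod]
  simp

lemma exists_sign [IsAlgClosed k] (h2 : (2 : k) ≠ 0) (h : Setup f s) (hf : f.Monic)
    (hn : f.natDegree = n) (hn2 : 2 ≤ n) (hg : Good f) :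
    ∃ a, ∃ g : K ≃ₐ[RatFunc k] K, ∀ i, g (s i) = if i = a then - s i else s i := by
  obtain ⟨σ, a, hσ, hinj, hσ0, hneg⟩ := place_sign h2 hn2 hf hn hg.zero
  obtain ⟨φ, g, ι, π, ε, hι, hπ, hg⟩ := place_galois h _ σ hσ hinj
  refine ⟨π.symm a, g, fun i => ?_⟩
  apply φ.toRingHom.injective
  change φ _ = φ _
  rw [← hg, hπ, map_mul, map_intCast, hι, hneg]
  simp only [Equiv.eq_symm_apply]
  split_ifs
  · rw [map_neg, map_neg, hπ]; ring
  · rw [hπ]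

lemma exists_swap [IsAlgClosed k] (h2 : (2 : k) ≠ 0) (h : Setup f s) (hf : f.Monic)
    (hn : f.natDegree = n) (hn2 : 2 ≤ n) (hg : Good f) :
    ∃ a b, a ≠ b ∧ ∃ g : K ≃ₐ[RatFunc k] K, ∀ i, g (s i) ^ 2 = s (Equiv.swap a b i) ^ 2 := by
  obtain ⟨x0, t0, m, e1, e2, e3, e4, e5, e6⟩ := hg.node
  obtain ⟨σ, a, b, hab, hσ, hinj, hσ0, hneg⟩ := place_swap h2 hn2 hf hn e1 e2 e3 e4 e5 e6
  obtain ⟨φ, g, ι, π, ε, hι, hπ, hg⟩ := place_galois h _ σ hσ hinj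
  refine ⟨π.symm a, π.symm b, fun e => hab (π.symm.injective e), g, fun i => ?_⟩
  apply φ.toRingHom.injective
  change φ _ = φ _
  rw [map_pow, map_pow, ← hg, hπ, hπ, map_mul, map_intCast, mul_pow, mul_pow, sign_sq, sign_sq,
    one_mul, one_mul, ← map_pow, ← map_pow, ← map_pow, hι, hneg]
  congr 3
  have := Equiv.swap_apply_apply π (π.symm a) (π.symm b)
  rw [Equiv.apply_symm_apply, Equiv.apply_symm_apply] at this
  rw [this]
  simp

/-- the Galois group is the full group of signed permutations -/
theorem full_galois [IsAlgClosed k] (h2 : (2 : k) ≠ 0) (h : Setup f s) (hf : f.Monic)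
    (hn : f.natDegree = n) (hn2 : 2 ≤ n) (hg : Good f) (π : Equiv.Perm (Fin n)) (ε : Fin n → ℤˣ) :
    ∃ g : K ≃ₐ[RatFunc k] K, ∀ i, g (s i) = ((ε i : ℤ) : K) * s (π i) := by
  classical
  obtain ⟨hinj, h0⟩ := h.nondeg h2 hf hn hn2 hg
  have hsq : ∀ (g : K ≃ₐ[RatFunc k] K) {π : Equiv.Perm (Fin n)} {ε : Fin n → ℤˣ},
      (∀ i, g (s i) = ((ε i : ℤ) : K) * s (π i)) → ∀ i, g (s i) ^ 2 = s (π i) ^ 2 := by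
    intro g π ε hh i
    rw [hh, mul_pow, sign_sq, one_mul]
  let H : Subgroup (Equiv.Perm (Fin n)) :=
    { carrier := {π | ∃ g : K ≃ₐ[RatFunc k] K, ∀ i, g (s i) ^ 2 = s (π i) ^ 2}
      one_mem' := ⟨AlgEquiv.refl, fun i => rfl⟩
      mul_mem' := by
        rintro a b ⟨g, hg⟩ ⟨g', hg'⟩
        refine ⟨g * g', fun i => ?_⟩
        rw [AlgEquiv.mul_apply, ← map_pow, hg', map_pow, hg]; rfl
      inv_mem' := by
        rintro a ⟨g, hg⟩
        refine ⟨g⁻¹, fun i => ?_⟩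
        have := hg (a⁻¹ i)
        rw [show a (a⁻¹ i) = i from a.apply_symm_apply i, ← map_pow] at this
        rw [← map_pow, ← this]
        exact g.symm_apply_apply _ }
  have hH2 : ∀ (g : K ≃ₐ[RatFunc k] K), ∃ π ∈ H, ∀ i, g (s i ^ 2) = s (π i) ^ 2 := by
    intro g
    obtain ⟨π, ε, hh⟩ := h.act hinj g
    have := hsq g hh
    exact ⟨π, ⟨g, this⟩, fun i => by rw [map_pow, this]⟩
  have htr : ∀ i j, ∃ π ∈ H, π i = j := by
    intro i j
    obtain ⟨g, hg⟩ := h.trans hg.one i j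
    obtain ⟨π, hπ, hh⟩ := hH2 g
    exact ⟨π, hπ, hinj ((hh i).symm.trans hg)⟩
  have hst : ∀ i j l, j ≠ i → l ≠ i → ∃ π ∈ H, π i = i ∧ π j = l := by
    intro i j l hj hl
    obtain ⟨g, hg, hg'⟩ := h.stab hf hn hn2 hg.one hinj i j l hj hl
    obtain ⟨π, hπ, hh⟩ := hH2 g
    exact ⟨π, hπ, hinj ((hh i).symm.trans hg), hinj ((hh j).symm.trans hg')⟩
  obtain ⟨a, b, hab, hswap⟩ := exists_swap h2 h hf hn hn2 hg
  have hswapH : Equiv.swap a b ∈ H := hswap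
  have hHtop : H = ⊤ := by
    rw [eq_top_iff, ← Equiv.Perm.closure_isSwap, Subgroup.closure_le]
    rintro _ ⟨c, d, hcd, rfl⟩
    obtain ⟨ρ, hρ, hρa⟩ := htr a c
    obtain ⟨ρ', hρ', hc, hd⟩ := hst c (ρ b) d (by rw [← hρa]; exact fun e => hab (ρ.injective e).symm)
      hcd.symm
    have := Equiv.swap_apply_apply (ρ' * ρ) a b
    rw [Equiv.Perm.mul_apply, Equiv.Perm.mul_apply, hρa, hc, hd] at this
    rw [this]
    exact H.mul_mem (H.mul_mem (H.mul_mem hρ' hρ) hswapH) (H.inv_mem (H.mul_mem hρ' hρ))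
  -- sign changes
  obtain ⟨a0, g0, hg0⟩ := exists_sign h2 h hf hn hn2 hg
  have hsg : ∀ c, ∃ g : K ≃ₐ[RatFunc k] K, ∀ i, g (s i) = if i = c then - s i else s i := by
    intro c
    obtain ⟨g, hg⟩ : Equiv.swap a0 c ∈ H := by rw [hHtop]; trivial
    obtain ⟨π, ε, hh⟩ := h.act hinj g
    have hπ : ∀ i, π i = Equiv.swap a0 c i := fun i => hinj ((hsq g hh i).symm.trans (hg i))
    have hcases : ∀ i, ∃ e : ℤˣ, g (s i) = ((e : ℤ) : K) * s (Equiv.swap a0 c i) := fun i =>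
      ⟨ε i, by rw [hh, hπ]⟩
    refine ⟨g.symm.trans (g0.trans g), fun i => ?_⟩
    simp only [AlgEquiv.trans_apply]
    obtain ⟨e, he⟩ := hcases (Equiv.swap a0 c i)
    rw [Equiv.swap_apply_self] at he
    have he2 : g.symm (s i) = ((e : ℤ) : K) * s (Equiv.swap a0 c i) := by
      rw [AlgEquiv.symm_apply_eq, map_mul, map_intCast, he, ← mul_assoc, ← pow_two, sign_sq, one_mul]
    have hiff : Equiv.swap a0 c i = a0 ↔ i = c := by
      constructor
      · intro e
        have := congrArg (Equiv.swap a0 c) e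
        rwa [Equiv.swap_apply_self, Equiv.swap_apply_left] at this
      · rintro rfl; exact Equiv.swap_apply_right _ _
    rw [he2, map_mul, map_mul, map_intCast, map_intCast, hg0]
    simp only [hiff]
    split_ifs
    · rw [map_neg, he, mul_neg, ← mul_assoc, ← pow_two, sign_sq, one_mul]
    · rw [he, ← mul_assoc, ← pow_two, sign_sq, one_mul]
  have hall : ∀ δ : Fin n → ℤˣ, ∃ g : K ≃ₐ[RatFunc k] K, ∀ i, g (s i) = ((δ i : ℤ) : K) * s i := by
    intro δ
    have : ∀ S : Finset (Fin n), ∃ g : K ≃ₐ[RatFunc k] K, ∀ i, g (s i) =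
        ((if i ∈ S then δ i else 1 : ℤˣ) : ℤ) * s i := by
      intro S
      induction S using Finset.induction_on with
      | empty => exact ⟨AlgEquiv.refl, fun i => by simp⟩
      | insert c S hc ih =>
        obtain ⟨g, hg⟩ := ih
        rcases Int.units_eq_one_or (δ c) with h1 | h1
        · refine ⟨g, fun i => ?_⟩
          rw [hg]
          by_cases hi : i = c
          · subst hi; simp [hc, h1]
          · simp [hi]
        · obtain ⟨g', hg'⟩ := hsg c
          refine ⟨g'.trans g, fun i => ?_⟩
          rw [AlgEquiv.trans_apply, hg']
          by_cases hi : i = c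
          · subst hi; simp [hc, h1, hg]
          · simp [hi, hg]
    obtain ⟨g, hg⟩ := this univ
    exact ⟨g, fun i => by simpa using hg i⟩
  obtain ⟨g, hg⟩ : π ∈ H := by rw [hHtop]; trivial
  obtain ⟨π', ε', hh⟩ := h.act hinj g
  have hπ : ∀ i, π' i = π i := fun i => hinj ((hsq g hh i).symm.trans (hg i))
  obtain ⟨g', hg'⟩ := hall (fun i => ε i * ε' i)
  refine ⟨g'.trans g, fun i => ?_⟩
  rw [AlgEquiv.trans_apply, hg', map_mul, map_intCast, hh, hπ]
  push_cast
  rw [mul_assoc, ← mul_assoc ((ε' i : ℤ) : K), ← pow_two, sign_sq, one_mul]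

end
end S2S


set_option linter.all false
namespace S2S

open Finset Polynomial

section
variable {ι k : Type*} [Field k]

/-- degree bounds for coefficients of power series up to order `L` -/
def Bdd (L C b : ℕ) (y : PowerSeries (MvPolynomial ι k)) : Prop :=
  ∀ l < L, (PowerSeries.coeff l y).totalDegree ≤ C * l + b

lemma Bdd.mono {L C b b' : ℕ} {y : PowerSeries (MvPolynomial ι k)} (h : Bdd L C b y) (hb : b ≤ b') :
    Bdd L C b' y := fun l hl => (h l hl).trans (by omega)

lemma Bdd.add {L C b : ℕ} {y z : PowerSeries (MvPolynomial ι k)} (hy : Bdd L C b y)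
    (hz : Bdd L C b z) : Bdd L C b (y + z) := fun l hl => by
  rw [map_add]
  exact (MvPolynomial.totalDegree_add _ _).trans (max_le (hy l hl) (hz l hl))

lemma Bdd.neg {L C b : ℕ} {y : PowerSeries (MvPolynomial ι k)} (hy : Bdd L C b y) :
    Bdd L C b (-y) := fun l hl => by
  rw [map_neg, MvPolynomial.totalDegree_neg]; exact hy l hl

lemma Bdd.mul {L C b c : ℕ} {y z : PowerSeries (MvPolynomial ι k)} (hy : Bdd L C b y)
    (hz : Bdd L C c z) : Bdd L C (b + c) (y * z) := fun l hl => by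
  classical
  rw [PowerSeries.coeff_mul]
  apply MvPolynomial.totalDegree_finsetSum_le
  rintro ⟨i, j⟩ hij
  rw [HasAntidiagonal.mem_antidiagonal] at hij
  simp only at hij ⊢
  have h1 := hy i (by omega)
  have h2 := hz j (by omega)
  refine (MvPolynomial.totalDegree_mul _ _).trans ?_
  subst hij
  nlinarith

lemma Bdd.const {L C b : ℕ} {r : MvPolynomial ι k} (h : r.totalDegree ≤ b) :
    Bdd L C b (PowerSeries.C r) := fun l hl => by
  rw [PowerSeries.coeff_C]
  split_ifs
  · omega
  · simp

lemma Bdd.one {L C : ℕ} : Bdd L C 0 (1 : PowerSeries (MvPolynomial ι k)) := by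
  have := Bdd.const (L := L) (C := C) (b := 0) (r := (1 : MvPolynomial ι k)) (by simp)
  simpa using this

lemma Bdd.pow {L C b : ℕ} {y : PowerSeries (MvPolynomial ι k)} (hy : Bdd L C b y) (m : ℕ) :
    Bdd L C (m * b) (y ^ m) := by
  induction m with
  | zero => simpa using Bdd.one
  | succ m ih => rw [pow_succ]; exact (ih.mul hy).mono (by ring_nf; rfl)

lemma Bdd.sum {L C b : ℕ} {α : Type*} (S : Finset α) {y : α → PowerSeries (MvPolynomial ι k)}
    (hy : ∀ i ∈ S, Bdd L C b (y i)) : Bdd L C b (∑ i ∈ S, y i) := by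
  classical
  induction S using Finset.induction_on with
  | empty => intro l _; simp
  | insert a S ha ih =>
    rw [Finset.sum_insert ha]
    exact (hy a (mem_insert_self _ _)).add (ih fun i hi => hy i (mem_insert_of_mem hi))

lemma Bdd.tau {L C b c : ℕ} {y : PowerSeries (MvPolynomial ι k)} (hy : Bdd L C c y) (hc : c ≤ C + b) :
    Bdd (L + 1) C b (PowerSeries.X * y) := fun l hl => by
  cases l with
  | zero => simp
  | succ l =>
    rw [PowerSeries.coeff_succ_X_mul]
    refine (hy l (by omega)).trans ?_
    rw [mul_add]; omega

lemma taylor_deg {ι k : Type*} [Field k] (p : (MvPolynomial ι k)[X]) (N : ℕ) (hN : p.natDegree ≤ N)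
    (hp : ∀ i, (p.coeff i).totalDegree ≤ 1) (s : MvPolynomial ι k) (hs : s.totalDegree ≤ 1) (j : ℕ) :
    ((taylor s p).coeff j).totalDegree ≤ N + 1 := by
  rw [taylor_coeff, eval_eq_sum_range]
  apply MvPolynomial.totalDegree_finsetSum_le
  intro i hi
  rw [mem_range] at hi
  have h1 : i ≤ N := by
    have := natDegree_hasseDeriv_le p j
    omega
  refine (MvPolynomial.totalDegree_mul _ _).trans ?_
  have h2 : ((hasseDeriv j p).coeff i).totalDegree ≤ 1 := by
    rw [hasseDeriv_coeff]
    refine (MvPolynomial.totalDegree_mul _ _).trans ?_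
    have : (((i + j).choose j : ℕ) : MvPolynomial ι k).totalDegree = 0 := by
      rw [← map_natCast (MvPolynomial.C), MvPolynomial.totalDegree_C]
    rw [this, zero_add]; exact hp _
  have h3 := MvPolynomial.totalDegree_pow s i
  have : i * s.totalDegree ≤ i * 1 := Nat.mul_le_mul_left _ hs
  omega

/-- one coordinate of the Taylor flow -/
lemma flow_one (p : (MvPolynomial ι k)[X]) (N : ℕ) (hN : p.natDegree ≤ N)
    (hp : ∀ i, (p.coeff i).totalDegree ≤ 1) (s Δ : MvPolynomial ι k) (hs : s.totalDegree ≤ 1)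
    (B C : ℕ) (hΔ : Δ.totalDegree ≤ B) (hC : 2 * B + N + 5 ≤ C) :
    ∃ h : PowerSeries (MvPolynomial ι k), PowerSeries.constantCoeff h = 0 ∧ (∀ L, Bdd L C 1 h) ∧
      (p.map PowerSeries.C).eval (PowerSeries.C s + h) -
        PowerSeries.C ((p.derivative.eval s * Δ) ^ 2) * PowerSeries.X * ((PowerSeries.C s + h) ^ 2 + 1)
        = PowerSeries.C (p.eval s) := by
  set A := PowerSeries (MvPolynomial ι k) with hA
  set E1 := p.derivative.eval s with hE1
  set q : (MvPolynomial ι k)[X] := (taylor s p).divX.divX with hq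
  have hqd : ∀ j, (q.coeff j).totalDegree ≤ N + 1 := by
    intro j; rw [hq, coeff_divX, coeff_divX]; exact taylor_deg p N hN hp s hs _
  have hE1d : E1.totalDegree ≤ N + 1 := by
    rw [hE1, ← taylor_coeff_one]; exact taylor_deg p N hN hp s hs _
  have hqN : q.natDegree ≤ N := by
    rw [hq, natDegree_divX_eq_natDegree_tsub_one, natDegree_divX_eq_natDegree_tsub_one, natDegree_taylor]
    omega
  have htay : ∀ h : A, (p.map PowerSeries.C).eval (PowerSeries.C s + h) =
      PowerSeries.C (p.eval s) + PowerSeries.C E1 * h + h ^ 2 * (q.map PowerSeries.C).eval h := by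
    intro h
    have e1 : (p.map PowerSeries.C).eval (PowerSeries.C s + h) =
        ((taylor s p).map (PowerSeries.C : MvPolynomial ι k →+* A)).eval h := by
      rw [taylor_apply, Polynomial.map_comp, eval_comp]
      simp [add_comm]
    have e2 := divX_mul_X_add (taylor s p)
    have e3 := divX_mul_X_add (taylor s p).divX
    rw [← hq, coeff_divX, zero_add, taylor_coeff_one, ← hE1] at e3
    rw [← e3, taylor_coeff_zero] at e2
    rw [e1, ← e2]
    simp only [Polynomial.map_add, Polynomial.map_mul, Polynomial.map_X, Polynomial.map_C, eval_add,
      eval_mul, eval_X, eval_C]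
    ring
  set g : MvPolynomial ι k := E1 * Δ ^ 2 with hg
  let Ψ : A[X] := Polynomial.C (PowerSeries.C (2 * s * g)) * X + Polynomial.C (PowerSeries.X * PowerSeries.C (g ^ 2)) * X ^ 2 -
    Polynomial.C (PowerSeries.C (Δ ^ 2)) * X ^ 2 * (q.map PowerSeries.C).comp (Polynomial.C (PowerSeries.X * PowerSeries.C g) * X)
  obtain ⟨v, hv⟩ := fp_exists (fun v => Ψ.eval v) (fun v w => sub_dvd_eval_sub v w Ψ)
    (PowerSeries.C (s ^ 2 + 1))
  set h : A := PowerSeries.X * (PowerSeries.C g * v) with hh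
  have hv2 : v = (PowerSeries.C s + h) ^ 2 + 1 -
      PowerSeries.X * (PowerSeries.C (Δ ^ 2) * v ^ 2 * (q.map PowerSeries.C).eval h) := by
    have e : eval v Ψ = PowerSeries.C (2 * s * g) * v + PowerSeries.X * PowerSeries.C (g ^ 2) * v ^ 2 -
      PowerSeries.C (Δ ^ 2) * v ^ 2 * (q.map PowerSeries.C).eval h := by
      simp only [Ψ, eval_sub, eval_add, eval_mul, eval_C, eval_X, eval_pow, eval_comp, hh]
      rw [mul_assoc PowerSeries.X, mul_assoc PowerSeries.X]
    rw [e] at hv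
    conv_lhs => rw [hv]
    simp only [hh, map_mul, map_add, map_pow, map_one]
    rw [show (PowerSeries.C (2 : MvPolynomial ι k) : A) = 2 from map_ofNat _ 2]
    ring
  have hgd : g.totalDegree ≤ N + 1 + 2 * B := by
    refine (MvPolynomial.totalDegree_mul _ _).trans ?_
    have := MvPolynomial.totalDegree_pow Δ 2
    omega
  have hΔ2 : (Δ ^ 2).totalDegree ≤ 2 * B := by
    have := MvPolynomial.totalDegree_pow Δ 2
    omega
  have hstep : ∀ L, Bdd L C 2 v → Bdd (L + 1) C 0 h := by
    intro L hL
    exact ((Bdd.const hgd).mul hL).tau (by omega)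
  have hvB : ∀ L, Bdd L C 2 v := by
    intro L
    induction L with
    | zero => intro l hl; omega
    | succ L ih =>
      have h1 := hstep L ih
      have h1' : Bdd L C 0 h := fun l hl => h1 l (by omega)
      rw [hv2, sub_eq_add_neg]
      have hqh : Bdd L C (N + 1) ((q.map PowerSeries.C).eval h) := by
        rw [eval_eq_sum_range]
        apply Bdd.sum
        intro j _
        rw [coeff_map]
        exact ((Bdd.const (hqd j)).mul (h1'.pow j)).mono (by omega)
      refine (((((Bdd.const hs).add (h1.mono (by omega))).pow 2).add (Bdd.one.mono (by omega)))).add ?_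
      exact (Bdd.tau (((Bdd.const hΔ2).mul (ih.pow 2)).mul hqh) (by omega)).neg
  refine ⟨h, ?_, ?_, ?_⟩
  · rw [hh]; simp
  · intro L
    have := hstep L (hvB L)
    exact fun l hl => ((this.mono (b' := 1) (by omega)) l (by omega))
  · rw [htay]
    have e5 : (h : A) = PowerSeries.X * (PowerSeries.C g * v) := hh
    have e6 : (PowerSeries.C g : A) = PowerSeries.C E1 * PowerSeries.C (Δ ^ 2) := by
      rw [hg, map_mul]
    have e7 : (PowerSeries.C ((E1 * Δ) ^ 2) : A) = PowerSeries.C E1 * (PowerSeries.C E1 * PowerSeries.C (Δ ^ 2)) := by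
      rw [← map_mul, ← map_mul]; congr 1; ring
    rw [e7]
    rw [e6] at e5
    have e8 : (PowerSeries.C s + h) ^ 2 + 1 = v +
      PowerSeries.X * (PowerSeries.C (Δ ^ 2) * v ^ 2 * (q.map PowerSeries.C).eval h) := by
      linear_combination -hv2
    rw [e8]
    generalize (q.map PowerSeries.C).eval h = Qh at *
    rw [e5]
    ring

end

/-- the constant governing degrees of the Taylor coefficients -/
def CT (n : ℕ) : ℕ := 2 * (n * (2 * n + 1)) + 2 * n + 5

section
variable {k : Type*} [Field k] {n : ℕ}

/-- the ring of functions -/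
abbrev RR (n : ℕ) (k : Type*) [Field k] := MvPolynomial (Option (Fin n)) k

/-- the discriminant-like function `δ` -/
noncomputable def del (f : k[X]) : RR n k :=
  ∏ i : Fin n, (-(2 * MvPolynomial.X (some i)) *
    (fam f (MvPolynomial.X none : RR n k)).derivative.eval (-(MvPolynomial.X (some i)) ^ 2))

theorem taylor_exists (f : k[X]) (hn : f.natDegree = n) (hn1 : 1 ≤ n) :
    ∃ T : RR n k →ₐ[k] PowerSeries (RR n k),
      (∀ r l, (PowerSeries.coeff l (T r)).totalDegree ≤ CT n * l + r.totalDegree) ∧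
      (∀ r, PowerSeries.constantCoeff (T r) = r) ∧
      T (MvPolynomial.X none) = PowerSeries.C (MvPolynomial.X none) + PowerSeries.C (del f ^ 2) * PowerSeries.X ∧
      ∀ i, (fam f (T (MvPolynomial.X none))).eval (- (T (MvPolynomial.X (some i))) ^ 2) =
        PowerSeries.C ((fam f (MvPolynomial.X none : RR n k)).eval (-(MvPolynomial.X (some i)) ^ 2)) := by
  classical
  set t : RR n k := MvPolynomial.X none with ht
  set S : Fin n → RR n k := fun i => MvPolynomial.X (some i) with hS
  set p : (RR n k)[X] := (fam f t).comp (-X ^ 2) with hp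
  have hp2 : p = (f.comp (-X ^ 2)).map (algebraMap k (RR n k)) +
      C t * ((-X ^ 2 - 1 : k[X]).map (algebraMap k (RR n k))) := by
    rw [hp, fam, add_comp, Polynomial.map_comp, mul_comp]
    simp
  have hpN : p.natDegree ≤ 2 * n := by
    rw [hp2]
    refine (natDegree_add_le _ _).trans (max_le ?_ ?_)
    · refine natDegree_map_le.trans (natDegree_comp_le.trans ?_)
      rw [hn]
      have : (-X ^ 2 : k[X]).natDegree ≤ 2 := by compute_degree
      nlinarith
    · refine (natDegree_C_mul_le _ _).trans (natDegree_map_le.trans ?_)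
      have : (-X ^ 2 - 1 : k[X]).natDegree ≤ 2 := by compute_degree
      omega
  have hpd : ∀ i, (p.coeff i).totalDegree ≤ 1 := by
    intro i
    rw [hp2, coeff_add, coeff_C_mul, coeff_map, coeff_map]
    refine (MvPolynomial.totalDegree_add _ _).trans (max_le ?_ ?_)
    · rw [MvPolynomial.algebraMap_eq, MvPolynomial.totalDegree_C]; omega
    · refine (MvPolynomial.totalDegree_mul _ _).trans ?_
      rw [MvPolynomial.algebraMap_eq, MvPolynomial.totalDegree_C, ht, MvPolynomial.totalDegree_X]
  have hSd : ∀ i, (S i).totalDegree ≤ 1 := fun i => by rw [hS]; simp [MvPolynomial.totalDegree_X]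
  have hE1 : ∀ i, p.derivative.eval (S i) = -(2 * S i) * (fam f t).derivative.eval (-(S i) ^ 2) := by
    intro i
    rw [hp, derivative_comp]
    simp
    left; left; norm_num
  have hE1d : ∀ i, (p.derivative.eval (S i)).totalDegree ≤ 2 * n + 1 := by
    intro i
    rw [← taylor_coeff_one]; exact taylor_deg p _ hpN hpd _ (hSd i) _
  have hprodd : ∀ U : Finset (Fin n), (∏ j ∈ U, p.derivative.eval (S j)).totalDegree ≤ n * (2 * n + 1) := by
    intro U
    refine (MvPolynomial.totalDegree_finset_prod _ _).trans ?_
    refine (Finset.sum_le_card_nsmul _ _ (2 * n + 1) fun i _ => hE1d i).trans ?_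
    rw [smul_eq_mul]
    refine Nat.mul_le_mul_right _ ?_
    simpa using Finset.card_le_univ U
  have hdel : del f = ∏ j, p.derivative.eval (S j) := by
    rw [del]; exact Finset.prod_congr rfl fun i _ => (hE1 i).symm
  have hdel' : ∀ i, p.derivative.eval (S i) * ∏ j ∈ univ.erase i, p.derivative.eval (S j) = del f := by
    intro i; rw [hdel]; exact Finset.mul_prod_erase _ _ (mem_univ i)
  have hflow := fun i => flow_one p (2 * n) hpN hpd (S i) (∏ j ∈ univ.erase i, p.derivative.eval (S j))
    (hSd i) (n * (2 * n + 1)) (CT n) (hprodd _) (by unfold CT; omega)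
  choose h hh0 hhB hhE using hflow
  let v : Option (Fin n) → PowerSeries (RR n k) := fun o => o.elim
    (PowerSeries.C t + PowerSeries.C (del f ^ 2) * PowerSeries.X) (fun i => PowerSeries.C (S i) + h i)
  have hvB : ∀ L o, Bdd L (CT n) 1 (v o) := by
    intro L o
    cases o with
    | none =>
      apply Bdd.add
      · apply Bdd.const; rw [ht, MvPolynomial.totalDegree_X]
      · rw [mul_comm]
        have hd2 : (del f ^ 2 : RR n k).totalDegree ≤ CT n + 1 := by
          have h1 := MvPolynomial.totalDegree_pow (del f : RR n k) 2
          have h2 := hprodd univ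
          rw [← hdel] at h2
          unfold CT; omega
        have := (Bdd.const (L := L) (C := CT n) hd2).tau (b := 1) (by omega)
        exact fun l hl => this l (by omega)
    | some i => exact (Bdd.const (hSd i)).add (hhB i L)
  have hv0 : ∀ o, PowerSeries.constantCoeff (v o) = MvPolynomial.X o := by
    intro o
    cases o with
    | none => simp [v, ht]
    | some i => simp [v, hh0, hS]
  refine ⟨MvPolynomial.aeval v, ?_, ?_, ?_, ?_⟩
  · intro r l
    have key : Bdd (l + 1) (CT n) r.totalDegree (MvPolynomial.aeval v r) := by
      conv in (MvPolynomial.aeval v r) => rw [r.as_sum, map_sum]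
      apply Bdd.sum
      intro d hd
      rw [MvPolynomial.aeval_monomial]
      have h1 : Bdd (l + 1) (CT n) 0 (algebraMap k (PowerSeries (RR n k)) (r.coeff d)) := by
        have e : algebraMap k (PowerSeries (RR n k)) (r.coeff d) = PowerSeries.C (MvPolynomial.C (r.coeff d)) := by
          rw [PowerSeries.algebraMap_apply, MvPolynomial.algebraMap_eq]
        rw [e]; exact Bdd.const (by rw [MvPolynomial.totalDegree_C])
      have h2 : ∀ U : Finset (Option (Fin n)), Bdd (l + 1) (CT n) (∑ i ∈ U, d i) (∏ i ∈ U, v i ^ d i) := by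
        intro U
        induction U using Finset.induction_on with
        | empty => simpa using Bdd.one
        | insert a U ha ih =>
          rw [Finset.sum_insert ha, Finset.prod_insert ha]
          exact (((hvB _ a).pow (d a)).mono (by omega)).mul ih
      refine (h1.mul (h2 d.support)).mono ?_
      rw [zero_add]
      exact MvPolynomial.le_totalDegree hd
    exact key l (by omega)
  · intro r
    have : ((PowerSeries.constantCoeff : PowerSeries (RR n k) →+* RR n k).comp
        (MvPolynomial.aeval v : RR n k →ₐ[k] PowerSeries (RR n k)).toRingHom) = RingHom.id _ := by
      apply MvPolynomial.ringHom_ext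
      · intro a
        have e : algebraMap k (PowerSeries (RR n k)) a = PowerSeries.C (MvPolynomial.C a) := by
          rw [PowerSeries.algebraMap_apply, MvPolynomial.algebraMap_eq]
        simp [e]
      · intro o
        simp [hv0]
    exact congrArg (fun a : RR n k →+* RR n k => a r) this
  · rw [MvPolynomial.aeval_X]; rfl
  · intro i
    have e0 := hhE i
    rw [hdel' i] at e0
    rw [MvPolynomial.aeval_X, MvPolynomial.aeval_X]
    change (fam f (PowerSeries.C t + PowerSeries.C (del f ^ 2) * PowerSeries.X)).eval
      (-(PowerSeries.C (S i) + h i) ^ 2) = PowerSeries.C ((fam f t).eval (-(S i) ^ 2))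
    have e1 : p.eval (S i) = (fam f t).eval (-(S i) ^ 2) := by
      rw [hp, eval_comp]; simp
    rw [← e1, ← e0]
    let jA : RR n k →ₐ[k] PowerSeries (RR n k) := { (PowerSeries.C : RR n k →+* PowerSeries (RR n k)) with
      commutes' := fun a => (PowerSeries.algebraMap_apply).symm }
    have e2 : p.map (PowerSeries.C : RR n k →+* PowerSeries (RR n k)) =
        (fam f (PowerSeries.C t : PowerSeries (RR n k))).comp (-X ^ 2) := by
      have := fam_map f t jA
      rw [hp, Polynomial.map_comp]
      change (fam f t).map (PowerSeries.C : RR n k →+* PowerSeries (RR n k)) = _ at this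
      rw [this]
      simp
      rfl
    rw [e2, eval_comp]
    simp only [fam_eval, eval_neg, eval_pow, eval_X]
    ring

end
end S2S


set_option linter.all false
namespace S2S

open Finset Polynomial

/-- properties of the Taylor map -/
structure IsTaylor {k : Type*} [Field k] {n : ℕ} (f : k[X]) (T : RR n k →ₐ[k] PowerSeries (RR n k)) : Prop where
  deg : ∀ r l, (PowerSeries.coeff l (T r)).totalDegree ≤ CT n * l + r.totalDegree
  const : ∀ r, PowerSeries.constantCoeff (T r) = r
  t : T (MvPolynomial.X none) = PowerSeries.C (MvPolynomial.X none) + PowerSeries.C (del f ^ 2) * PowerSeries.X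
  root : ∀ i, (fam f (T (MvPolynomial.X none))).eval (- (T (MvPolynomial.X (some i))) ^ 2) =
        PowerSeries.C ((fam f (MvPolynomial.X none : RR n k)).eval (-(MvPolynomial.X (some i)) ^ 2))

/-- an unramified point -/
structure UP {k : Type*} [Field k] {n : ℕ} (f : k[X]) (P : Option (Fin n) → k) : Prop where
  prod : fam f (P none) = ∏ i : Fin n, (X + C (P (some i) ^ 2))
  inj : Function.Injective fun i => P (some i) ^ 2
  ne : ∀ i, P (some i) ≠ 0

section
variable {k : Type*} [Field k] {n : ℕ}

/-- Taylor expansion at a point -/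
noncomputable def phi (T : RR n k →ₐ[k] PowerSeries (RR n k)) (P : Option (Fin n) → k) :
    RR n k →ₐ[k] PowerSeries k :=
  { (PowerSeries.map (MvPolynomial.eval P)).comp (T : RR n k →+* PowerSeries (RR n k)) with
    commutes' := fun a => by
      change PowerSeries.map (MvPolynomial.eval P) (T (algebraMap k _ a)) = _
      rw [T.commutes, PowerSeries.algebraMap_apply, PowerSeries.algebraMap_apply, PowerSeries.map_C]
      simp [MvPolynomial.algebraMap_eq] }

lemma phi_apply (T : RR n k →ₐ[k] PowerSeries (RR n k)) (P : Option (Fin n) → k) (r : RR n k) :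
    phi T P r = PowerSeries.map (MvPolynomial.eval P) (T r) := rfl

variable {f : k[X]} {T : RR n k →ₐ[k] PowerSeries (RR n k)} {P : Option (Fin n) → k}

lemma phi_coeff (r : RR n k) (l : ℕ) :
    PowerSeries.coeff l (phi T P r) = MvPolynomial.eval P (PowerSeries.coeff l (T r)) := by
  rw [phi_apply, PowerSeries.coeff_map]

lemma phi_const (hT : IsTaylor f T) (r : RR n k) :
    PowerSeries.constantCoeff (phi T P r) = MvPolynomial.eval P r := by
  have := phi_coeff (T := T) (P := P) r 0
  rw [PowerSeries.coeff_zero_eq_constantCoeff_apply, PowerSeries.coeff_zero_eq_constantCoeff_apply,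
    hT.const] at this
  exact this

lemma phi_t (hT : IsTaylor f T) : phi T P (MvPolynomial.X none) =
    PowerSeries.C (P none) + PowerSeries.C (MvPolynomial.eval P (del f) ^ 2) * PowerSeries.X := by
  rw [phi_apply, hT.t, map_add, map_mul, PowerSeries.map_C, PowerSeries.map_C, PowerSeries.map_X]
  simp

lemma eval_del : MvPolynomial.eval P (del f) = ∏ i : Fin n, (-(2 * P (some i)) *
    (fam f (P none)).derivative.eval (-(P (some i)) ^ 2)) := by
  rw [del, map_prod]
  refine Finset.prod_congr rfl fun i _ => ?_
  have := fam_deriv_eval_map (MvPolynomial.aeval P : RR n k →ₐ[k] k) f (MvPolynomial.X none)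
    (-(MvPolynomial.X (some i)) ^ 2)
  rw [map_mul]
  congr 1
  · simp [map_ofNat]
  · rw [← MvPolynomial.coe_aeval_eq_eval]
    refine this.trans ?_
    simp

lemma UP.deriv_ne (h : UP f P) (i : Fin n) : (fam f (P none)).derivative.eval (-(P (some i)) ^ 2) ≠ 0 := by
  apply sep_deriv
  · rw [h.prod]
    have : (∏ i : Fin n, (X + C (P (some i) ^ 2))) = ∏ i : Fin n, (X - C (-P (some i) ^ 2)) := by
      refine Finset.prod_congr rfl fun i _ => ?_
      rw [C_neg, sub_neg_eq_add]
    rw [this, separable_prod_X_sub_C_iff]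
    intro i j hij
    exact h.inj (neg_injective hij)
  · rw [h.prod, eval_prod]
    exact Finset.prod_eq_zero (mem_univ i) (by simp)

lemma UP.del_ne (h2 : (2 : k) ≠ 0) (h : UP f P) : MvPolynomial.eval P (del f) ≠ 0 := by
  rw [eval_del, Finset.prod_ne_zero_iff]
  intro i _
  exact mul_ne_zero (neg_ne_zero.2 (mul_ne_zero h2 (h.ne i))) (h.deriv_ne i)

lemma UP.prod_series (hT : IsTaylor f T) (hf : f.Monic) (hn : f.natDegree = n) (hn2 : 2 ≤ n) (h : UP f P) :
    fam f (phi T P (MvPolynomial.X none)) = ∏ i : Fin n, (X + C (phi T P (MvPolynomial.X (some i)) ^ 2)) ∧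
    Function.Injective fun i => phi T P (MvPolynomial.X (some i)) ^ 2 := by
  have hinj : Function.Injective fun i => phi T P (MvPolynomial.X (some i)) ^ 2 := by
    intro i j hij
    apply h.inj
    have := congrArg PowerSeries.constantCoeff hij
    simp only [map_pow] at this
    rw [phi_const hT, phi_const hT, MvPolynomial.eval_X, MvPolynomial.eval_X] at this
    exact this
  refine ⟨?_, hinj⟩
  obtain ⟨hm, hd⟩ := fam_monic f (phi T P (MvPolynomial.X none)) hf hn hn2
  rw [prod_of_roots _ hm hd (fun i => - phi T P (MvPolynomial.X (some i)) ^ 2) _ _]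
  · refine Finset.prod_congr rfl fun i _ => ?_
    rw [C_neg, sub_neg_eq_add]
  · intro i
    rw [fam_eval]
    have e := congrArg (PowerSeries.map (MvPolynomial.eval P)) (hT.root i)
    rw [PowerSeries.map_C] at e
    have e1 : MvPolynomial.eval P ((fam f (MvPolynomial.X none : RR n k)).eval
        (-(MvPolynomial.X (some i)) ^ 2)) = 0 := by
      have := fam_eval_map (MvPolynomial.aeval P : RR n k →ₐ[k] k) f (MvPolynomial.X none)
        (-(MvPolynomial.X (some i)) ^ 2)
      rw [← MvPolynomial.coe_aeval_eq_eval]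
      refine this.trans ?_
      simp only [map_neg, map_pow, MvPolynomial.aeval_X]
      rw [h.prod, eval_prod]
      exact Finset.prod_eq_zero (mem_univ i) (by simp)
    rw [e1, map_zero, fam_eval] at e
    rw [← e, map_add, map_mul, map_sub, map_one, map_neg, map_pow, ← phi_apply, ← phi_apply]
    congr 1
    rw [← map_pow, ← map_neg, aeval_algHom_apply, phi_apply, ← map_pow, ← map_neg, aeval_algHom_apply]
  · intro i j hij
    exact hinj (neg_injective hij)

end

section
variable {k K : Type*} [Field k] [Field K] [Algebra k K] [Algebra (RatFunc k) K]
  [IsScalarTower k (RatFunc k) K] {n : ℕ} {f : k[X]} {s : Fin n → K}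

/-- evaluation in the function field -/
noncomputable def ev (s : Fin n → K) : RR n k →ₐ[k] K :=
  MvPolynomial.aeval fun o => o.elim (algebraMap (RatFunc k) K RatFunc.X) s

lemma ev_t : ev (k := k) s (MvPolynomial.X none) = algebraMap (RatFunc k) K RatFunc.X := by simp [ev]
lemma ev_s (i : Fin n) : ev (k := k) s (MvPolynomial.X (some i)) = s i := by simp [ev]

lemma hat [IsAlgClosed k] (h2 : (2 : k) ≠ 0) (h : Setup f s) (hf : f.Monic)
    (hn : f.natDegree = n) (hn2 : 2 ≤ n) (hg : Good f) {T : RR n k →ₐ[k] PowerSeries (RR n k)}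
    (hT : IsTaylor f T) {P : Option (Fin n) → k} (hP : UP f P) :
    ∃ φ : K →ₐ[k] FractionRing (PowerSeries k), ∀ r, φ (ev s r) = algebraMap (PowerSeries k) _ (phi T P r) := by
  set Ω := FractionRing (PowerSeries k) with hΩ
  have hai : Function.Injective (algebraMap (PowerSeries k) Ω) := IsFractionRing.injective _ _
  set j : PowerSeries k →ₐ[k] Ω := IsScalarTower.toAlgHom k (PowerSeries k) Ω with hj
  obtain ⟨hpr, hin⟩ := hP.prod_series hT hf hn hn2
  have hTi : Function.Injective (aeval (j (phi T P (MvPolynomial.X none))) : k[X] →ₐ[k] Ω) := by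
    apply aeval_inj
    intro a ha
    rw [IsScalarTower.algebraMap_apply k (PowerSeries k) Ω] at ha
    have := congrArg (PowerSeries.coeff 1) (hai ha)
    rw [phi_t hT, PowerSeries.algebraMap_apply, map_add, PowerSeries.coeff_C, PowerSeries.coeff_C,
      PowerSeries.coeff_C_mul] at this
    simp at this
    exact hP.del_ne h2 this
  obtain ⟨φ, hφ, π, ε, hπ⟩ := h.embed (j (phi T P (MvPolynomial.X none))) hTi
    (fun i => j (phi T P (MvPolynomial.X (some i)))) (by
    rw [← fam_map, hpr, Polynomial.map_prod]
    simp) (by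
    intro a b hab
    apply hin
    apply hai
    simp only [map_pow]
    exact hab)
  obtain ⟨g, hg⟩ := full_galois h2 h hf hn hn2 hg π.symm (fun i => ε (π.symm i))
  refine ⟨φ.comp (g.toAlgHom.restrictScalars k), fun r => ?_⟩
  have : (φ.comp (g.toAlgHom.restrictScalars k)).comp (ev s) = j.comp (phi T P) := by
    apply MvPolynomial.algHom_ext
    intro o
    cases o with
    | none =>
      simp only [AlgHom.comp_apply, ev_t]
      rw [← hφ]
      congr 1
      exact g.commutes _
    | some i =>
      simp only [AlgHom.comp_apply, ev_s]
      have : (g.toAlgHom.restrictScalars k) (s i) = g (s i) := rfl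
      rw [this, hg, map_mul, map_intCast, hπ, ← mul_assoc, Equiv.apply_symm_apply, ← pow_two, sign_sq, one_mul]
  exact congrArg (fun a : RR n k →ₐ[k] Ω => a r) this

lemma Setup.galois [IsAlgClosed k] (h2 : (2 : k) ≠ 0) (h : Setup f s) (hf : f.Monic)
    (hn : f.natDegree = n) (hn2 : 2 ≤ n) (hg : Good f) : IsGalois (RatFunc k) K := by
  obtain ⟨hinj, h0⟩ := h.nondeg h2 hf hn hn2 hg
  have h2K : (2 : K) ≠ 0 := by
    rw [← map_ofNat (algebraMap k K) 2]; exact (_root_.map_ne_zero _).2 h2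
  have := h.splitting
  apply IsGalois.of_separable_splitting_field (p := defpoly f)
  rw [← separable_map (algebraMap (RatFunc k) K)]
  have e : (defpoly f).map (algebraMap (RatFunc k) K) = (∏ i, (X + C (s i ^ 2))).comp (-X ^ 2) := by
    have := defpoly_map (IsScalarTower.toAlgHom k (RatFunc k) K) f
    rw [IsScalarTower.coe_toAlgHom, IsScalarTower.coe_toAlgHom', h.hs] at this
    exact this
  rw [e, comp_splits]
  apply separable_prod
  · intro i j hij
    have hne : s i ^ 2 - s j ^ 2 ≠ 0 := sub_ne_zero.2 fun e => hij (hinj e)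
    refine ⟨C (s i ^ 2 - s j ^ 2)⁻¹, - C (s i ^ 2 - s j ^ 2)⁻¹, ?_⟩
    have : C (s i ^ 2 - s j ^ 2)⁻¹ * C (s i ^ 2 - s j ^ 2) = 1 := by
      rw [← C_mul, inv_mul_cancel₀ hne, C_1]
    simp only [C_sub, C_pow] at this ⊢
    linear_combination this
  · intro i
    refine ⟨C (s i ^ 2)⁻¹, -(C (s i ^ 2)⁻¹ * C (2 : K)⁻¹ * X), ?_⟩
    have e1 : C (s i ^ 2)⁻¹ * C (s i ^ 2) = 1 := by
      rw [← C_mul, inv_mul_cancel₀ (pow_ne_zero 2 (h0 i)), C_1]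
    have e2 : C (2 : K)⁻¹ * 2 = 1 := by
      rw [← map_ofNat C 2, ← C_mul, inv_mul_cancel₀ h2K, C_1]
    simp only [derivative_mul, derivative_sub, derivative_add, derivative_C, derivative_X, C_pow] at e1 e2 ⊢
    linear_combination e1 + X ^ 2 * C (s i ^ 2)⁻¹ * e2

lemma Setup.card [IsAlgClosed k] (h2 : (2 : k) ≠ 0) (h : Setup f s) (hf : f.Monic)
    (hn : f.natDegree = n) (hn2 : 2 ≤ n) (hg : Good f) :
    Nat.card (K ≃ₐ[RatFunc k] K) = 2 ^ n * n.factorial := by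
  obtain ⟨hinj, h0⟩ := h.nondeg h2 hf hn hn2 hg
  have h2K : (2 : K) ≠ 0 := by
    rw [← map_ofNat (algebraMap k K) 2]; exact (_root_.map_ne_zero _).2 h2
  choose π ε hπ using h.act hinj
  have hb : Function.Bijective (fun g => (π g, ε g)) := by
    constructor
    · intro g g' hgg
      simp only [Prod.mk.injEq] at hgg
      have : g.toAlgHom = g'.toAlgHom := by
        apply AlgHom.ext_of_adjoin_eq_top h.gen
        rintro _ ⟨i, rfl⟩
        change g (s i) = g' (s i)
        rw [hπ, hπ, hgg.1, hgg.2]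
      ext x
      exact congrArg (fun a : K →ₐ[RatFunc k] K => a x) this
    · rintro ⟨p, e⟩
      obtain ⟨g, hg⟩ := full_galois h2 h hf hn hn2 hg p e
      refine ⟨g, ?_⟩
      have := arrange_unique h2K s hinj h0 (π := π g) (π' := p) (ε := ε g) (ε' := e) (fun i => by
        rw [← hπ, hg])
      simp [this.1, this.2]
  rw [Nat.card_congr (Equiv.ofBijective _ hb), Nat.card_prod, Nat.card_eq_fintype_card,
    Nat.card_eq_fintype_card, Fintype.card_perm, Fintype.card_fun, Fintype.card_fin,
    Fintype.card_units_int, mul_comm]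

end
end S2S


set_option linter.all false
namespace S2S

open Finset Polynomial

section
variable {k : Type*} [Field k] {n : ℕ}

/-- substitution by a signed permutation -/
noncomputable def sub (π : Equiv.Perm (Fin n)) (ε : Fin n → ℤˣ) : RR n k →ₐ[k] RR n k :=
  MvPolynomial.aeval fun o => o.elim (MvPolynomial.X none)
    (fun i => MvPolynomial.C ((ε i : ℤ) : k) * MvPolynomial.X (some (π i)))

lemma sub_t (π : Equiv.Perm (Fin n)) (ε : Fin n → ℤˣ) :
    sub (k := k) π ε (MvPolynomial.X none) = MvPolynomial.X none := by simp [sub]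
lemma sub_s (π : Equiv.Perm (Fin n)) (ε : Fin n → ℤˣ) (i : Fin n) :
    sub (k := k) π ε (MvPolynomial.X (some i)) =
      MvPolynomial.C ((ε i : ℤ) : k) * MvPolynomial.X (some (π i)) := by simp [sub]

lemma sub_deg (π : Equiv.Perm (Fin n)) (ε : Fin n → ℤˣ) (r : RR n k) :
    (sub π ε r).totalDegree ≤ r.totalDegree := by
  rw [sub, MvPolynomial.aeval_def, MvPolynomial.eval₂_eq]
  apply (MvPolynomial.totalDegree_finset_sum _ _).trans
  apply Finset.sup_le
  intro d hd
  rw [MvPolynomial.algebraMap_eq]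
  apply (MvPolynomial.totalDegree_mul _ _).trans
  rw [MvPolynomial.totalDegree_C, zero_add]
  apply (MvPolynomial.totalDegree_finset_prod _ _).trans
  refine le_trans ?_ (MvPolynomial.le_totalDegree hd)
  rw [Finsupp.sum]
  apply Finset.sum_le_sum
  intro o _
  apply (MvPolynomial.totalDegree_pow _ _).trans
  have : (o.elim (MvPolynomial.X none) (fun i => MvPolynomial.C ((ε i : ℤ) : k) *
      MvPolynomial.X (some (π i))) : RR n k).totalDegree ≤ 1 := by
    cases o with
    | none => simp
    | some i =>
      simp only [Option.elim_some]
      apply (MvPolynomial.totalDegree_mul _ _).trans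
      rw [MvPolynomial.totalDegree_C, MvPolynomial.totalDegree_X]
  calc _ ≤ d o * 1 := Nat.mul_le_mul_left _ this
    _ = _ := mul_one _

end

section
variable {k K : Type*} [Field k] [Field K] [Algebra k K] [Algebra (RatFunc k) K]
  [IsScalarTower k (RatFunc k) K] {n : ℕ} {f : k[X]} {s : Fin n → K}

lemma ev_sub (g : K ≃ₐ[RatFunc k] K) (π : Equiv.Perm (Fin n)) (ε : Fin n → ℤˣ)
    (h : ∀ i, g (s i) = ((ε i : ℤ) : K) * s (π i)) (r : RR n k) : ev s (sub π ε r) = g (ev s r) := by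
  have : (ev s).comp (sub π ε) = (g.toAlgHom.restrictScalars k).comp (ev s) := by
    apply MvPolynomial.algHom_ext
    intro o
    cases o with
    | none =>
      simp only [AlgHom.comp_apply, sub_t, ev_t]
      exact (g.commutes _).symm
    | some i =>
      simp only [AlgHom.comp_apply, sub_s, ev_s, map_mul]
      rw [← MvPolynomial.algebraMap_eq, AlgHom.commutes, map_intCast]
      exact (h i).symm
  exact congrArg (fun a : RR n k →ₐ[k] K => a r) this

lemma u_integral {A : Type*} [CommRing A] [Algebra A (RatFunc k)] [Algebra A K]
    [IsScalarTower A (RatFunc k) K] (h : Setup f s) (hf : f.Monic)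
    (hn : f.natDegree = n) (hn2 : 2 ≤ n) (u : RatFunc k)
    (hu : u ∈ (algebraMap A (RatFunc k)).range) (hut : u * RatFunc.X ∈ (algebraMap A (RatFunc k)).range)
    (hc : ∀ c : k, algebraMap k (RatFunc k) c ∈ (algebraMap A (RatFunc k)).range) (i : Fin n) :
    IsIntegral A (algebraMap (RatFunc k) K u * s i) := by
  set R := (algebraMap A (RatFunc k)).range with hR
  obtain ⟨hm, hd⟩ := fam_monic f (RatFunc.X : RatFunc k) hf hn hn2
  set p := fam f (RatFunc.X : RatFunc k) with hp
  have hroot : (p.map (algebraMap (RatFunc k) K)).eval (- s i ^ 2) = 0 := by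
    have e := fam_map f (RatFunc.X : RatFunc k) (IsScalarTower.toAlgHom k (RatFunc k) K)
    rw [IsScalarTower.coe_toAlgHom, IsScalarTower.coe_toAlgHom', h.hs] at e
    rw [e, eval_prod]
    exact Finset.prod_eq_zero (mem_univ i) (by simp)
  have hx : IsIntegral A (algebraMap (RatFunc k) K u * (- s i ^ 2)) := by
    have hl : scaleRoots p u ∈ Polynomial.lifts (algebraMap A (RatFunc k)) := by
      rw [Polynomial.lifts_iff_coeff_lifts]
      intro j
      change _ ∈ R
      rw [coeff_scaleRoots, hd]
      rcases lt_or_ge j n with hj | hj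
      · obtain ⟨e, he⟩ : ∃ e, n - j = e + 1 := ⟨n - j - 1, by omega⟩
        rw [he, hp, fam, coeff_add, coeff_map, coeff_C_mul, add_mul]
        apply R.add_mem
        · exact R.mul_mem (hc _) (R.pow_mem hu _)
        · have : (RatFunc.X * ((X : (RatFunc k)[X]) - 1).coeff j) * u ^ (e + 1) =
            (((X : (RatFunc k)[X]) - 1).coeff j) * (u * RatFunc.X) * u ^ e := by ring
          rw [this]
          refine R.mul_mem (R.mul_mem ?_ hut) (R.pow_mem hu _)
          rw [coeff_sub, coeff_X, coeff_one]
          apply R.sub_mem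
          · split_ifs
            exacts [R.one_mem, R.zero_mem]
          · split_ifs
            exacts [R.one_mem, R.zero_mem]
      · rw [Nat.sub_eq_zero_of_le hj, pow_zero, mul_one]
        rcases hj.eq_or_lt with hj | hj
        · rw [← hj]
          have : p.coeff n = 1 := by rw [← hd]; exact hm
          rw [this]; exact R.one_mem
        · rw [coeff_eq_zero_of_natDegree_lt (by omega)]; exact R.zero_mem
    obtain ⟨Q, hQ, hQd, hQm⟩ := lifts_and_natDegree_eq_and_monic hl ((monic_scaleRoots_iff _).2 hm)
    refine ⟨Q, hQm, ?_⟩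
    rw [IsScalarTower.algebraMap_eq A (RatFunc k) K, ← eval₂_map, hQ]
    apply scaleRoots_eval₂_eq_zero
    rw [eval₂_eq_eval_map]; exact hroot
  have huK : IsIntegral A (algebraMap (RatFunc k) K u) := by
    obtain ⟨a, ha⟩ := hu
    rw [← ha, ← IsScalarTower.algebraMap_apply]; exact isIntegral_algebraMap
  apply IsIntegral.of_pow (n := 2) two_pos
  have : (algebraMap (RatFunc k) K u * s i) ^ 2 = - ((algebraMap (RatFunc k) K u * (- s i ^ 2)) *
    algebraMap (RatFunc k) K u) := by ring
  rw [this]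
  exact (hx.mul huK).neg

lemma u_range {A : Type*} [CommRing A] [IsDomain A] [IsIntegrallyClosed A] [Algebra A (RatFunc k)]
    [IsFractionRing A (RatFunc k)] [Algebra A K]
    [IsScalarTower A (RatFunc k) K] (h : Setup f s) (hf : f.Monic)
    (hn : f.natDegree = n) (hn2 : 2 ≤ n) (u : RatFunc k)
    (hu : u ∈ (algebraMap A (RatFunc k)).range) (hut : u * RatFunc.X ∈ (algebraMap A (RatFunc k)).range)
    (hc : ∀ c : k, algebraMap k (RatFunc k) c ∈ (algebraMap A (RatFunc k)).range)
    (r : RR n k) (D : ℕ) (hD : r.totalDegree ≤ D) (y : RatFunc k)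
    (hy : algebraMap (RatFunc k) K y = ev s r) :
    u ^ D * y ∈ (algebraMap A (RatFunc k)).range := by
  have hr : ∀ z ∈ (algebraMap A (RatFunc k)).range, IsIntegral A (algebraMap (RatFunc k) K z) := by
    rintro _ ⟨a, rfl⟩
    rw [← IsScalarTower.algebraMap_apply]; exact isIntegral_algebraMap
  have key : IsIntegral A (algebraMap (RatFunc k) K (u ^ D * y)) := by
    rw [map_mul, hy, ev, MvPolynomial.aeval_def, MvPolynomial.eval₂_eq, Finset.mul_sum]
    apply IsIntegral.sum
    intro d hd
    have hdD : ∑ o ∈ d.support, d o ≤ D := (MvPolynomial.le_totalDegree hd).trans hD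
    obtain ⟨e, he⟩ := Nat.exists_eq_add_of_le hdD
    have : algebraMap (RatFunc k) K (u ^ D) * (algebraMap k K (MvPolynomial.coeff d r) *
        ∏ o ∈ d.support, (o.elim (algebraMap (RatFunc k) K RatFunc.X) s) ^ d o) =
        algebraMap (RatFunc k) K (algebraMap k (RatFunc k) (MvPolynomial.coeff d r)) *
        algebraMap (RatFunc k) K u ^ e *
        ∏ o ∈ d.support, (algebraMap (RatFunc k) K u * o.elim (algebraMap (RatFunc k) K RatFunc.X) s) ^ d o := by
      rw [he, ← IsScalarTower.algebraMap_apply]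
      simp only [mul_pow, Finset.prod_mul_distrib, Finset.prod_pow_eq_pow_sum, map_pow, map_mul, pow_add]
      ring
    rw [this]
    apply IsIntegral.mul
    · exact (hr _ (hc _)).mul ((hr _ hu).pow _)
    · apply IsIntegral.prod
      intro o _
      apply IsIntegral.pow
      cases o with
      | none => simp only [Option.elim_none]; rw [← map_mul]; exact hr _ hut
      | some i => exact u_integral h hf hn hn2 u hu hut hc i
  rw [isIntegral_algebraMap_iff (algebraMap (RatFunc k) K).injective] at key
  exact IsIntegrallyClosed.isIntegral_iff.1 key

lemma norm_poly [IsAlgClosed k] (h2 : (2 : k) ≠ 0) (h : Setup f s) (hf : f.Monic)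
    (hn : f.natDegree = n) (hn2 : 2 ≤ n) (hg : Good f) (r : RR n k) (N : ℕ) (hN : r.totalDegree ≤ N)
    (hr : ev s r ≠ 0) [Fintype (K ≃ₐ[RatFunc k] K)] :
    ∃ P0 : k[X], P0 ≠ 0 ∧ P0.natDegree ≤ 2 ^ n * n.factorial * N ∧
      algebraMap (RatFunc k) K (algebraMap k[X] (RatFunc k) P0) = ∏ g : K ≃ₐ[RatFunc k] K, g (ev s r) := by
  classical
  have hgal := h.galois h2 hf hn hn2 hg
  have hfin := h.finite
  obtain ⟨hinj, h0⟩ := h.nondeg h2 hf hn hn2 hg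
  choose π ε hπ using h.act hinj
  set R0 : RR n k := ∏ g : K ≃ₐ[RatFunc k] K, sub (π g) (ε g) r with hR0
  have hev : ev s R0 = ∏ g : K ≃ₐ[RatFunc k] K, g (ev s r) := by
    rw [hR0, map_prod]
    exact Finset.prod_congr rfl fun g _ => ev_sub g _ _ (hπ g) r
  have hcard := h.card h2 hf hn hn2 hg
  rw [Nat.card_eq_fintype_card] at hcard
  have hdeg : R0.totalDegree ≤ 2 ^ n * n.factorial * N := by
    apply (MvPolynomial.totalDegree_finset_prod _ _).trans
    calc _ ≤ ∑ g : K ≃ₐ[RatFunc k] K, N := Finset.sum_le_sum fun g _ => (sub_deg _ _ _).trans hN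
      _ = _ := by rw [Finset.sum_const, Finset.card_univ, hcard, smul_eq_mul]
  set y := Algebra.norm (RatFunc k) (ev s r) with hy
  have hyK : algebraMap (RatFunc k) K y = ∏ g : K ≃ₐ[RatFunc k] K, g (ev s r) := by
    rw [hy, Algebra.norm_eq_prod_automorphisms]
    convert rfl
  have hy0 : y ≠ 0 := by rw [hy]; exact Algebra.norm_ne_zero_iff.2 hr
  obtain ⟨P0, hP0⟩ : y ∈ (algebraMap k[X] (RatFunc k)).range := by
    letI : Algebra k[X] K := ((algebraMap (RatFunc k) K).comp (algebraMap k[X] (RatFunc k))).toAlgebra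
    haveI : IsScalarTower k[X] (RatFunc k) K := IsScalarTower.of_algebraMap_eq fun _ => rfl
    have := u_range (A := k[X]) h hf hn hn2 1 (Subring.one_mem _) (by
      rw [one_mul]; exact ⟨X, RatFunc.algebraMap_X⟩) (fun c => ⟨C c, by
        rw [RatFunc.algebraMap_C]; rfl⟩) R0 _ hdeg y (hyK.trans hev.symm)
    simpa using this
  have hP00 : P0 ≠ 0 := by rintro rfl; rw [map_zero] at hP0; exact hy0 hP0.symm
  refine ⟨P0, hP00, ?_, by rw [hP0, hyK]⟩
  set V := (RatFunc.inftyValuation k).valuationSubring with hV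
  letI : Algebra V K := ((algebraMap (RatFunc k) K).comp (algebraMap V (RatFunc k))).toAlgebra
  haveI : IsScalarTower V (RatFunc k) K := IsScalarTower.of_algebraMap_eq fun _ => rfl
  have hmem : ∀ z : RatFunc k, z ∈ (algebraMap V (RatFunc k)).range ↔ RatFunc.inftyValuation k z ≤ 1 := by
    intro z
    constructor
    · rintro ⟨a, rfl⟩; exact a.2
    · intro hz; exact ⟨⟨z, hz⟩, rfl⟩
  have := u_range (A := V) h hf hn hn2 (RatFunc.X)⁻¹ (by
      rw [hmem, ← one_div, RatFunc.inftyValuation.X_inv]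
      rw [← WithZero.exp_zero, WithZero.exp_le_exp]; norm_num) (by rw [inv_mul_cancel₀ RatFunc.X_ne_zero]; exact Subring.one_mem _) (fun c => by
      rw [hmem]
      by_cases hc : c = 0
      · subst hc; rw [map_zero, map_zero]; exact zero_le
      · have := RatFunc.inftyValuation.C k hc
        exact this.le) R0 _ hdeg y (hyK.trans hev.symm)
  rw [hmem, ← hP0] at this
  rw [map_mul, map_pow, map_inv₀, RatFunc.inftyValuation.X, RatFunc.inftyValuation_apply,
    RatFunc.inftyValuation.polynomial k hP00, ← WithZero.exp_neg, ← WithZero.exp_nsmul, ← WithZero.exp_add,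
    ← WithZero.exp_zero, WithZero.exp_le_exp] at this
  simp only [nsmul_eq_mul] at this
  push_cast at this
  zify
  linarith

lemma ram_mult (t0 c : k) (hc : c ≠ 0) (P0 : k[X]) (hP : P0 ≠ 0) (e : ℕ)
    (h : (PowerSeries.X : PowerSeries k) ^ e ∣ aeval (PowerSeries.C t0 + PowerSeries.C c * PowerSeries.X) P0) :
    e ≤ P0.rootMultiplicity t0 := by
  obtain ⟨Q, hQ, hQ0⟩ := P0.exists_eq_pow_rootMultiplicity_mul_and_not_dvd hP t0
  set m := P0.rootMultiplicity t0
  set y : PowerSeries k := PowerSeries.C t0 + PowerSeries.C c * PowerSeries.X with hy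
  have hyc : PowerSeries.constantCoeff y = t0 := by simp [hy]
  have hQc : PowerSeries.constantCoeff (aeval y Q) ≠ 0 := by
    have : PowerSeries.constantCoeff (aeval y Q) = Q.eval t0 := by
      rw [aeval_def, hom_eval₂, hyc]
      have : (PowerSeries.constantCoeff (R := k)).comp (algebraMap k (PowerSeries k)) = RingHom.id k := by
        ext a; simp [PowerSeries.algebraMap_apply]
      rw [this]; rfl
    rw [this]
    rwa [dvd_iff_isRoot] at hQ0
  have hu : IsUnit (aeval y Q) := by
    rw [PowerSeries.isUnit_iff_constantCoeff]; exact isUnit_iff_ne_zero.2 hQc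
  have huc : IsUnit (PowerSeries.C c : PowerSeries k) := (isUnit_iff_ne_zero.2 hc).map _
  rw [hQ, map_mul, map_pow, map_sub, aeval_X, aeval_C, PowerSeries.algebraMap_apply] at h
  have e1 : y - PowerSeries.C ((algebraMap k k) t0) = PowerSeries.C c * PowerSeries.X := by
    simp [hy]
  rw [e1, hu.dvd_mul_right, mul_pow, (huc.pow _).dvd_mul_left] at h
  exact (pow_dvd_pow_iff PowerSeries.X_ne_zero PowerSeries.X_prime.not_unit).1 h

lemma fiber_mult [IsAlgClosed k] (h2 : (2 : k) ≠ 0) (h : Setup f s) (hf : f.Monic)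
    (hn : f.natDegree = n) (hn2 : 2 ≤ n) (hg : Good f) {T : RR n k →ₐ[k] PowerSeries (RR n k)}
    (hT : IsTaylor f T) (r : RR n k) [Fintype (K ≃ₐ[RatFunc k] K)] (P0 : k[X]) (hP0 : P0 ≠ 0)
    (hP : algebraMap (RatFunc k) K (algebraMap k[X] (RatFunc k) P0) = ∏ g : K ≃ₐ[RatFunc k] K, g (ev s r))
    (t0 : k) (M : ℕ) (S : Finset (Option (Fin n) → k)) (hS : ∀ P ∈ S, UP f P)
    (hSt : ∀ P ∈ S, P none = t0)
    (hSM : ∀ P ∈ S, (PowerSeries.X : PowerSeries k) ^ M ∣ phi T P r) :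
    S.card * M ≤ P0.rootMultiplicity t0 := by
  classical
  have hgal := h.galois h2 hf hn hn2 hg
  have hfin := h.finite
  obtain ⟨hinj, h0⟩ := h.nondeg h2 hf hn hn2 hg
  choose π ε hπ using h.act hinj
  rcases S.eq_empty_or_nonempty with rfl | ⟨P, hPS⟩
  · simp
  have hai : Function.Injective (algebraMap (PowerSeries k) (FractionRing (PowerSeries k))) :=
    IsFractionRing.injective _ _
  obtain ⟨φ, hφ⟩ := hat h2 h hf hn hn2 hg hT (hS P hPS)
  have hG : ∀ P' : S, ∃ g : K ≃ₐ[RatFunc k] K, ∀ r, algebraMap _ (FractionRing (PowerSeries k)) (phi T P'.1 r) = φ (g (ev s r)) := by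
    rintro ⟨P', hP'⟩
    obtain ⟨φ', hφ'⟩ := hat h2 h hf hn hn2 hg hT (hS P' hP')
    have hδ : MvPolynomial.eval P' (del f) ^ 2 = MvPolynomial.eval P (del f) ^ 2 := by
      obtain ⟨p, e, hpe⟩ := arrange (fun i => P' (some i)) (fun i => P (some i)) (by
        rw [← (hS P' hP').prod, ← (hS P hPS).prod, hSt P hPS, hSt P' hP']) (hS P hPS).inj
      have hsq : ∀ i, P' (some i) ^ 2 = P (some (p i)) ^ 2 := by
        intro i
        have := hpe i
        rw [this, mul_pow, sign_sq, one_mul]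
      rw [eval_del, eval_del, ← Finset.prod_pow, ← Finset.prod_pow, ← Equiv.prod_comp p
        (fun i => (-(2 * P (some i)) * eval (-P (some i) ^ 2) (derivative (fam f (P none)))) ^ 2)]
      refine Finset.prod_congr rfl fun i _ => ?_
      rw [mul_pow, mul_pow, neg_sq, neg_sq, mul_pow, mul_pow, hsq, hSt P hPS, hSt P' hP']
    have htt : φ' (algebraMap (RatFunc k) K RatFunc.X) = φ (algebraMap (RatFunc k) K RatFunc.X) := by
      rw [← ev_t (s := s), hφ, hφ', phi_t hT, phi_t hT, hδ, hSt P hPS, hSt P' hP']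
    have hag : (φ'.comp (IsScalarTower.toAlgHom k (RatFunc k) K)) = φ.comp (IsScalarTower.toAlgHom k (RatFunc k) K) := ratfunc_ext _ _ htt
    obtain ⟨g, hg⟩ := embed_galois (F := RatFunc k) (φ : K →+* FractionRing (PowerSeries k)) (φ' : K →+* _)
      (fun x => (congrArg (fun a : RatFunc k →ₐ[k] FractionRing (PowerSeries k) => a x) hag).symm)
    exact ⟨g, fun r => by rw [← hφ']; exact hg _⟩
  choose γ hγ using hG
  have hγi : Function.Injective γ := by
    intro A B hAB
    apply Subtype.ext
    funext o
    cases o with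
    | none => rw [hSt _ A.2, hSt _ B.2]
    | some i =>
      have := hai ((hγ A (MvPolynomial.X (some i))).trans (by rw [hAB, ← hγ B]))
      have := congrArg PowerSeries.constantCoeff this
      rw [phi_const hT, phi_const hT] at this
      simpa using this
  set a : (K ≃ₐ[RatFunc k] K) → PowerSeries k := fun g => phi T P (sub (π g) (ε g) r) with ha
  have haφ : ∀ g, algebraMap _ (FractionRing (PowerSeries k)) (a g) = φ (g (ev s r)) := by
    intro g
    rw [← ev_sub g _ _ (hπ g), hφ]
  have hprod : ∏ g, a g = aeval (PowerSeries.C t0 + PowerSeries.C (MvPolynomial.eval P (del f) ^ 2) * PowerSeries.X) P0 := by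
    apply hai
    rw [map_prod]
    simp only [haφ]
    rw [← map_prod, ← hP]
    have e1 : (φ.comp (IsScalarTower.toAlgHom k (RatFunc k) K)).comp (IsScalarTower.toAlgHom k k[X] (RatFunc k)) =
        (IsScalarTower.toAlgHom k (PowerSeries k) (FractionRing (PowerSeries k))).comp
          (aeval (PowerSeries.C t0 + PowerSeries.C (MvPolynomial.eval P (del f) ^ 2) * PowerSeries.X)) := by
      apply Polynomial.algHom_ext
      change φ (algebraMap (RatFunc k) K (algebraMap k[X] (RatFunc k) X)) = algebraMap _ _
        (aeval (PowerSeries.C t0 + PowerSeries.C (MvPolynomial.eval P (del f) ^ 2) * PowerSeries.X) (X : k[X]))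
      rw [RatFunc.algebraMap_X, ← ev_t (s := s), hφ, phi_t hT, hSt P hPS, aeval_X]
    exact congrArg (fun a : k[X] →ₐ[k] FractionRing (PowerSeries k) => a P0) e1
  apply ram_mult t0 _ (pow_ne_zero 2 ((hS P hPS).del_ne h2)) P0 hP0
  rw [← hprod]
  calc (PowerSeries.X : PowerSeries k) ^ (S.card * M) = ∏ A : S, PowerSeries.X ^ M := by
        rw [Finset.prod_const, Finset.card_univ, Fintype.card_coe, ← pow_mul, mul_comm]
    _ ∣ ∏ A : S, a (γ A) := Finset.prod_dvd_prod_of_dvd _ _ fun A _ => by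
        have : a (γ A) = phi T A.1 r := hai (by rw [haφ, hγ])
        rw [this]; exact hSM _ A.2
    _ = ∏ g ∈ (univ : Finset S).image γ, a g := by rw [Finset.prod_image (fun _ _ _ _ e => hγi e)]
    _ ∣ ∏ g, a g := Finset.prod_dvd_prod_of_subset _ _ _ (Finset.subset_univ _)

theorem zero_bound [IsAlgClosed k] (h2 : (2 : k) ≠ 0) (h : Setup f s) (hf : f.Monic)
    (hn : f.natDegree = n) (hn2 : 2 ≤ n) (hg : Good f) {T : RR n k →ₐ[k] PowerSeries (RR n k)}
    (hT : IsTaylor f T) (r : RR n k) (N : ℕ) (hN : r.totalDegree ≤ N) (hr : ev s r ≠ 0)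
    (M : ℕ) (S : Finset (Option (Fin n) → k)) (hS : ∀ P ∈ S, UP f P)
    (hSM : ∀ P ∈ S, (PowerSeries.X : PowerSeries k) ^ M ∣ phi T P r) :
    S.card * M ≤ 2 ^ n * n.factorial * N := by
  classical
  have hfin := h.finite
  letI : Fintype (K ≃ₐ[RatFunc k] K) := Fintype.ofFinite _
  obtain ⟨P0, hP0, hd, hP⟩ := norm_poly h2 h hf hn hn2 hg r N hN hr
  refine le_trans ?_ hd
  have h1 : S.card = ∑ t0 ∈ S.image (fun P => P none), (S.filter fun P => P none = t0).card :=
    Finset.card_eq_sum_card_image _ _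
  rw [h1, Finset.sum_mul]
  calc _ ≤ ∑ t0 ∈ S.image (fun P => P none), P0.rootMultiplicity t0 := by
        refine Finset.sum_le_sum fun t0 _ => ?_
        apply fiber_mult h2 h hf hn hn2 hg hT r P0 hP0 hP t0 M
        · intro P hP; exact hS P (Finset.mem_filter.1 hP).1
        · intro P hP; exact (Finset.mem_filter.1 hP).2
        · intro P hP; exact hSM P (Finset.mem_filter.1 hP).1
    _ = ∑ t0 ∈ S.image (fun P => P none), P0.roots.count t0 := by simp only [count_roots]
    _ ≤ ∑ t0 ∈ S.image (fun P => P none) ∪ P0.roots.toFinset, P0.roots.count t0 :=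
        Finset.sum_le_sum_of_subset Finset.subset_union_left
    _ = P0.roots.card := Multiset.sum_count_eq_card fun a ha => Finset.mem_union_right _ (Multiset.mem_toFinset.2 ha)
    _ ≤ _ := card_roots' _

end
end S2S


set_option linter.all false
namespace S2S

open Finset Polynomial

section
variable {k K : Type*} [Field k] [Field K] [Algebra k K] [Algebra (RatFunc k) K]
  [IsScalarTower k (RatFunc k) K] {n : ℕ} {f : k[X]} {s : Fin n → K}

lemma pow_reduce {L K : Type*} [Field L] [Field K] [Algebra L K] (p : L[X]) (hp : p.Monic) (N : ℕ)
    (hN : p.natDegree = N) (hN0 : 0 < N) (x : K) (hx : aeval x p = 0) (m : ℕ) :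
    ∃ c : Fin N → L, x ^ m = ∑ j : Fin N, c j • x ^ (j : ℕ) := by
  have h1 : aeval x (X ^ m %ₘ p) = x ^ m := by
    have := congrArg (aeval x) (modByMonic_add_div (X ^ m) p)
    rw [map_add, map_mul, hx, zero_mul, add_zero] at this
    simpa using this
  have hd : (X ^ m %ₘ p).natDegree < N := by
    rw [← hN]
    apply natDegree_modByMonic_lt _ hp
    rintro rfl
    simp at hN; omega
  rw [aeval_eq_sum_range' hd, Finset.sum_range] at h1
  exact ⟨_, h1.symm⟩

lemma mono_span (h : Setup f s) (hf : f.Monic) (hn : f.natDegree = n) (hn2 : 2 ≤ n) :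
    Submodule.span (RatFunc k) (Set.range fun e : Fin n → Fin (2 * n) => ∏ i, s i ^ (e i : ℕ)) = ⊤ := by
  classical
  set W := Submodule.span (RatFunc k) (Set.range fun e : Fin n → Fin (2 * n) => ∏ i, s i ^ (e i : ℕ)) with hW
  obtain ⟨hm, hd⟩ := fam_monic f (RatFunc.X : RatFunc k) hf hn hn2
  have hroot : ∀ i, (((fam f (RatFunc.X : RatFunc k))).map (algebraMap (RatFunc k) K)).eval (- s i ^ 2) = 0 := by
    intro i
    have e := fam_map f (RatFunc.X : RatFunc k) (IsScalarTower.toAlgHom k (RatFunc k) K)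
    rw [IsScalarTower.coe_toAlgHom, IsScalarTower.coe_toAlgHom', h.hs] at e
    rw [e, eval_prod]
    exact Finset.prod_eq_zero (mem_univ i) (by simp)
  have hred : ∀ i m, ∃ c : Fin (2 * n) → RatFunc k, s i ^ m = ∑ j : Fin (2 * n), c j • s i ^ (j : ℕ) := by
    intro i m
    set p := fam f (RatFunc.X : RatFunc k)
    have hpd : (p.comp (-X ^ 2)).natDegree = 2 * n := by
      rw [natDegree_comp, hd, natDegree_neg, natDegree_X_pow, mul_comm]
    have hlc : (p.comp (-X ^ 2)).leadingCoeff ≠ 0 := by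
      rw [leadingCoeff_ne_zero]; intro h0; rw [h0] at hpd; simp at hpd; omega
    refine pow_reduce (C (p.comp (-X ^ 2)).leadingCoeff⁻¹ * p.comp (-X ^ 2)) (by
      rw [Monic, leadingCoeff_mul, leadingCoeff_C, inv_mul_cancel₀ hlc]) (2 * n) (by
      rw [natDegree_C_mul (inv_ne_zero hlc), hpd]) (by omega) (s i) (by
      rw [map_mul, aeval_comp]
      have : aeval (aeval (s i) (-X ^ 2 : (RatFunc k)[X])) p = 0 := by
        rw [aeval_def, eval₂_eq_eval_map]
        simpa using hroot i
      rw [this, mul_zero]) m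
  have hmul : ∀ i, ∀ w ∈ W, s i * w ∈ W := by
    intro i w hw
    induction hw using Submodule.span_induction with
    | mem w hw =>
      obtain ⟨e, rfl⟩ := hw
      obtain ⟨c, hc⟩ := hred i (e i + 1)
      have : s i * ∏ j, s j ^ (e j : ℕ) = ∑ l : Fin (2 * n), c l • ∏ j, s j ^ ((Function.update e i l) j : ℕ) := by
        have e1 : ∀ l : Fin (2 * n), ∏ j, s j ^ ((Function.update e i l) j : ℕ) =
            s i ^ (l : ℕ) * ∏ j ∈ univ.erase i, s j ^ (e j : ℕ) := by
          intro l
          rw [← Finset.mul_prod_erase univ _ (mem_univ i), Function.update_self]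
          congr 1
          refine Finset.prod_congr rfl fun j hj => ?_
          rw [Function.update_of_ne (Finset.ne_of_mem_erase hj)]
        simp only [e1]
        rw [← Finset.mul_prod_erase univ _ (mem_univ i), ← mul_assoc, ← pow_succ', hc, Finset.sum_mul]
        refine Finset.sum_congr rfl fun l _ => ?_
        rw [smul_mul_assoc]
      change s i * ∏ j, s j ^ (e j : ℕ) ∈ W
      rw [this]
      exact W.sum_mem fun l _ => W.smul_mem _ (Submodule.subset_span ⟨_, rfl⟩)
    | zero => rw [mul_zero]; exact W.zero_mem
    | add x y _ _ hx hy => rw [mul_add]; exact W.add_mem hx hy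
    | smul a x _ hx => rw [mul_smul_comm]; exact W.smul_mem _ hx
  have h1 : (1 : K) ∈ W := Submodule.subset_span ⟨fun _ => ⟨0, by omega⟩, by simp⟩
  rw [eq_top_iff]
  intro x _
  have hx : x ∈ Algebra.adjoin (RatFunc k) (Set.range s) := by rw [h.gen]; trivial
  have key : ∀ w ∈ W, x * w ∈ W := by
    induction hx using Algebra.adjoin_induction with
    | mem x hx => obtain ⟨i, rfl⟩ := hx; exact hmul i
    | algebraMap r => intro w hw; rw [← Algebra.smul_def]; exact W.smul_mem _ hw
    | add x y _ _ hx hy => intro w hw; rw [add_mul]; exact W.add_mem (hx trivial w hw) (hy trivial w hw)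
    | mul x y _ _ hx hy => intro w hw; rw [mul_assoc]; exact hx trivial _ (hy trivial w hw)
  simpa using key 1 h1

/-- the monomial with exponent vector `e` -/
noncomputable def mono (k : Type*) [Field k] {n : ℕ} (e : Fin n → ℕ) : RR n k := ∏ i, MvPolynomial.X (some i) ^ e i

lemma mono_deg (e : Fin n → ℕ) (N : ℕ) (he : ∀ i, e i ≤ N) : (mono k e).totalDegree ≤ n * N := by
  apply (MvPolynomial.totalDegree_finset_prod _ _).trans
  calc _ ≤ ∑ i : Fin n, N := Finset.sum_le_sum fun i _ => by
        rw [MvPolynomial.totalDegree_X_pow]; exact he i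
    _ = _ := by simp

lemma basis_exists [IsAlgClosed k] (h2 : (2 : k) ≠ 0) (h : Setup f s) (hf : f.Monic)
    (hn : f.natDegree = n) (hn2 : 2 ≤ n) (hg : Good f) :
    ∃ w : Fin (2 ^ n * n.factorial) → Fin n → ℕ, (∀ j i, w j i ≤ 2 * n) ∧
      LinearIndependent (RatFunc k) fun j => ev s (mono k (w j)) := by
  have hfin := h.finite
  have hgal := h.galois h2 hf hn hn2 hg
  obtain ⟨κ, a, hai, hspan, hli⟩ := exists_linearIndependent' (RatFunc k)
    (fun e : Fin n → Fin (2 * n) => ∏ i, s i ^ (e i : ℕ))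
  have hb := mono_span h hf hn hn2
  let b := Module.Basis.mk hli (by rw [hspan, hb])
  have : Fintype κ := Fintype.ofInjective a hai
  have hc : Fintype.card κ = 2 ^ n * n.factorial := by
    rw [← Module.finrank_eq_card_basis b, ← IsGalois.card_aut_eq_finrank, h.card h2 hf hn hn2 hg]
  let eqv := Fintype.equivFinOfCardEq hc
  refine ⟨fun j i => a (eqv.symm j) i, fun j i => (a _ i).2.le, ?_⟩
  have := hli.comp eqv.symm eqv.symm.injective
  have e : (fun j => ev s (mono k (fun i => (a (eqv.symm j) i : ℕ)))) =
      (((fun e : Fin n → Fin (2 * n) => ∏ i, s i ^ (e i : ℕ)) ∘ a) ∘ eqv.symm) := by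
    funext j
    simp [mono, ev_s]
  rw [e]
  exact this

lemma tmono_indep [IsAlgClosed k] {d : ℕ} (w : Fin d → Fin n → ℕ)
    (hw : LinearIndependent (RatFunc k) fun j => ev s (mono k (w j))) (D : ℕ) (c : Fin D × Fin d → k)
    (hc : ev s (∑ m, c m • (MvPolynomial.X none ^ (m.1 : ℕ) * mono k (w m.2))) = 0) : c = 0 := by
  rw [Fintype.linearIndependent_iff] at hw
  have := hw (fun j => algebraMap k[X] (RatFunc k) (∑ a : Fin D, C (c (a, j)) * X ^ (a : ℕ))) (by
    rw [← hc, map_sum, Fintype.sum_prod_type_right]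
    refine Finset.sum_congr rfl fun j _ => ?_
    rw [map_sum, Finset.sum_smul]
    refine Finset.sum_congr rfl fun a _ => ?_
    rw [map_smul, map_mul, map_pow, map_mul (ev s), map_pow (ev s), ev_t, RatFunc.algebraMap_X, RatFunc.algebraMap_C,
      Algebra.smul_def, Algebra.smul_def, map_mul, map_pow, IsScalarTower.algebraMap_apply k (RatFunc k) K]
    rw [RatFunc.algebraMap_eq_C, mul_assoc])
  funext ⟨a, j⟩
  have h1 := this j
  rw [map_eq_zero_iff _ (IsFractionRing.injective k[X] (RatFunc k))] at h1
  have := congrArg (fun p => p.coeff a) h1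
  simp only [finset_sum_coeff, coeff_C_mul, coeff_X_pow, coeff_zero] at this
  rw [Finset.sum_eq_single a] at this
  · simpa using this
  · intro b _ hb
    have : (a : ℕ) ≠ b := fun e => hb (Fin.ext e.symm)
    simp [this]
  · simp

end
end S2S


set_option linter.all false
namespace S2S

open Finset Polynomial

section
variable {k : Type*} [Field k]

lemma coeff_mul_pow (p e : ℕ) [Fact p.Prime] [CharP k p] (a y : PowerSeries k) (l : ℕ) (hl : l < p ^ e) :
    PowerSeries.coeff l (a * y ^ (p ^ e)) = PowerSeries.coeff l a * PowerSeries.constantCoeff y ^ (p ^ e) := by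
  haveI : CharP (PowerSeries k) p := charP_of_injective_algebraMap
    (algebraMap k (PowerSeries k)).injective p
  have hy : y = PowerSeries.X * PowerSeries.mk (fun p => PowerSeries.coeff (p + 1) y) +
    PowerSeries.C (PowerSeries.constantCoeff y) := PowerSeries.eq_X_mul_shift_add_const y
  set z := PowerSeries.mk (fun p => PowerSeries.coeff (p + 1) y)
  set b := PowerSeries.constantCoeff y
  rw [hy, add_pow_char_pow, mul_pow, mul_add, map_add, ← map_pow, PowerSeries.coeff_mul_C]
  have : a * (PowerSeries.X ^ p ^ e * z ^ p ^ e) = PowerSeries.X ^ p ^ e * (a * z ^ p ^ e) := by ring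
  rw [this, PowerSeries.coeff_X_pow_mul', if_neg (by omega), zero_add]

lemma series_min {ι : Type*} (y : ι → PowerSeries k) (m0 : ι) (h0 : y m0 ≠ 0) :
    ∃ v : ℕ, ∃ η : ι → PowerSeries k, (∀ m, y m = PowerSeries.X ^ v * η m) ∧
      ∃ m, PowerSeries.constantCoeff (η m) ≠ 0 := by
  classical
  have hex : ∃ N, ¬ ∀ m, (PowerSeries.X : PowerSeries k) ^ N ∣ y m := by
    by_contra hcon
    push Not at hcon
    apply h0
    ext l
    have := hcon (l + 1) m0
    rw [PowerSeries.X_pow_dvd_iff] at this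
    simpa using this l (by omega)
  obtain ⟨v, hv⟩ : ∃ v, Nat.find hex = v + 1 := by
    apply Nat.exists_eq_succ_of_ne_zero
    intro h
    have := Nat.find_spec hex
    rw [h] at this
    simp at this
  have h1 : ∀ m, (PowerSeries.X : PowerSeries k) ^ v ∣ y m := by
    have := Nat.find_min hex (m := v) (by omega)
    push Not at this
    exact this
  choose η hη using h1
  refine ⟨v, η, hη, ?_⟩
  by_contra hcon
  push Not at hcon
  have := Nat.find_spec hex
  rw [hv] at this
  apply this
  intro m
  rw [hη m, pow_succ]
  exact mul_dvd_mul_left _ (PowerSeries.X_dvd_iff.2 (hcon m))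

/-- the basic test functions -/
noncomputable def tm (k : Type*) [Field k] {n d D : ℕ} (w : Fin d → Fin n → ℕ) (m : Fin D × Fin d) : RR n k :=
  MvPolynomial.X none ^ (m.1 : ℕ) * mono k (w m.2)

lemma tm_deg {n d D : ℕ} (w : Fin d → Fin n → ℕ) (hw : ∀ j i, w j i ≤ 2 * n) (m : Fin D × Fin d) :
    (tm k w m).totalDegree ≤ D + n * (2 * n) := by
  apply (MvPolynomial.totalDegree_mul _ _).trans
  rw [MvPolynomial.totalDegree_X_pow]
  exact Nat.add_le_add m.1.2.le (mono_deg _ _ (hw _))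

lemma tm_sub {n d D : ℕ} (w : Fin d → Fin n → ℕ) (m : Fin D × Fin d) (q : ℕ) (P : Option (Fin n) → k)
    (π : Equiv.Perm (Fin n)) (ε : Fin n → ℤˣ) (h0 : P none ^ q = P none)
    (hP : ∀ i, P (some i) ^ q = ((ε i : ℤ) : k) * P (some (π i))) :
    MvPolynomial.eval P (sub π ε (tm k w m)) = MvPolynomial.eval P (tm k w m) ^ q := by
  simp only [tm, mono, map_mul, map_pow, map_prod, sub_t, sub_s, MvPolynomial.eval_X, MvPolynomial.eval_C,
    mul_pow, ← Finset.prod_pow]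
  congr 1
  · rw [← pow_mul, mul_comm, pow_mul, h0]
  · refine Finset.prod_congr rfl fun i _ => ?_
    rw [← mul_pow, ← hP, ← pow_mul, ← pow_mul, mul_comm]

end

section
variable {k K : Type*} [Field k] [Field K] [Algebra k K] [Algebra (RatFunc k) K]
  [IsScalarTower k (RatFunc k) K] {n : ℕ} {f : k[X]} {s : Fin n → K}

lemma phi_zero [IsAlgClosed k] (h2 : (2 : k) ≠ 0) (h : Setup f s) (hf : f.Monic)
    (hn : f.natDegree = n) (hn2 : 2 ≤ n) (hg : Good f) {T : RR n k →ₐ[k] PowerSeries (RR n k)}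
    (hT : IsTaylor f T) {P : Option (Fin n) → k} (hP : UP f P) (r : RR n k) :
    ev s r = 0 ↔ phi T P r = 0 := by
  obtain ⟨φ, hφ⟩ := hat h2 h hf hn hn2 hg hT hP
  have hai : Function.Injective (algebraMap (PowerSeries k) (FractionRing (PowerSeries k))) :=
    IsFractionRing.injective _ _
  rw [← map_eq_zero_iff _ hai, ← hφ, map_eq_zero_iff φ φ.toRingHom.injective]

lemma psi_ne [IsAlgClosed k] (h2 : (2 : k) ≠ 0) (h : Setup f s) (hf : f.Monic)
    (hn : f.natDegree = n) (hn2 : 2 ≤ n) (hg : Good f) {T : RR n k →ₐ[k] PowerSeries (RR n k)}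
    (hT : IsTaylor f T) {Q : Option (Fin n) → k} (hQ : UP f Q)
    (p e : ℕ) [Fact p.Prime] [CharP k p] (d : ℕ) (hd : 2 ^ n * n.factorial = d)
    (w : Fin (d) → Fin n → ℕ) (hw : ∀ j i, w j i ≤ 2 * n)
    (hwi : LinearIndependent (RatFunc k) fun j => ev s (mono k (w j)))
    (D : ℕ) (hD : d * (D + n * (2 * n)) < p ^ e)
    (g : Fin D × Fin (d) → RR n k) (m0) (hm0 : ev s (g m0) ≠ 0) :
    ev s (∑ m, tm k w m * g m ^ (p ^ e)) ≠ 0 := by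
  intro hz
  rw [phi_zero h2 h hf hn hn2 hg hT hQ] at hz
  rw [Ne, phi_zero h2 h hf hn hn2 hg hT hQ] at hm0
  obtain ⟨v, η, hη, m1, hm1⟩ := series_min (fun m => phi T Q (g m)) m0 hm0
  have hz2 : ∑ m, phi T Q (tm k w m) * η m ^ (p ^ e) = 0 := by
    have : (PowerSeries.X : PowerSeries k) ^ (v * p ^ e) * ∑ m, phi T Q (tm k w m) * η m ^ (p ^ e) = 0 := by
      rw [← hz, map_sum, Finset.mul_sum]
      refine Finset.sum_congr rfl fun m _ => ?_
      rw [map_mul, map_pow]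
      have := hη m
      rw [this, mul_pow, ← pow_mul]
      ring
    exact (mul_eq_zero.1 this).resolve_left (pow_ne_zero _ PowerSeries.X_ne_zero)
  set r : RR n k := ∑ m, (PowerSeries.constantCoeff (η m) ^ (p ^ e)) • tm k w m with hr
  have hr0 : ev s r ≠ 0 := by
    intro h0
    have := tmono_indep w hwi D (fun m => PowerSeries.constantCoeff (η m) ^ (p ^ e)) h0
    have := congrFun this m1
    exact hm1 (pow_eq_zero_iff (pow_pos (Fact.out : p.Prime).pos e).ne' |>.1 this)
  have hrd : (PowerSeries.X : PowerSeries k) ^ (p ^ e) ∣ phi T Q r := by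
    rw [PowerSeries.X_pow_dvd_iff]
    intro l hl
    have := congrArg (PowerSeries.coeff l) hz2
    rw [map_sum, map_zero] at this
    simp only [coeff_mul_pow p e _ _ l hl] at this
    rw [hr, map_sum, map_sum, ← this]
    refine Finset.sum_congr rfl fun m _ => ?_
    rw [map_smul, PowerSeries.coeff_smul]
    exact mul_comm _ _
  have hdeg : r.totalDegree ≤ D + n * (2 * n) := by
    apply MvPolynomial.totalDegree_finsetSum_le
    intro m _
    exact (MvPolynomial.totalDegree_smul_le _ _).trans (tm_deg w hw m)
  have := zero_bound h2 h hf hn hn2 hg hT r _ hdeg hr0 (p ^ e) {Q} (by simpa using hQ) (by simpa using hrd)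
  rw [hd] at this
  simp only [Finset.card_singleton, one_mul] at this
  omega

theorem stepanov_core [IsAlgClosed k] (h2 : (2 : k) ≠ 0) (h : Setup f s) (hf : f.Monic)
    (hn : f.natDegree = n) (hn2 : 2 ≤ n) (hg : Good f) {T : RR n k →ₐ[k] PowerSeries (RR n k)}
    (hT : IsTaylor f T) {Q : Option (Fin n) → k} (hQ : UP f Q)
    (p e : ℕ) [Fact p.Prime] [CharP k p] (d : ℕ) (hd : 2 ^ n * n.factorial = d)
    (D I M : ℕ) (hD : d * (D + n * (2 * n)) < p ^ e) (hM : M ≤ p ^ e)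
    (hker : M * (d * (CT n * M + (D + n * (2 * n)) + (I + n * (2 * n))) + 1) <
      (D * (d)) * (I * (d)))
    (π : Equiv.Perm (Fin n)) (ε : Fin n → ℤˣ) (S : Finset (Option (Fin n) → k))
    (hS : ∀ P ∈ S, UP f P ∧ P none ^ (p ^ e) = P none ∧
      ∀ i, P (some i) ^ (p ^ e) = ((ε i : ℤ) : k) * P (some (π i))) :
    S.card * M ≤ d * ((D + n * (2 * n)) + p ^ e * (I + n * (2 * n))) := by
  classical
  have hbasis := basis_exists h2 h hf hn hn2 hg
  rw [hd] at hbasis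
  obtain ⟨w, hw, hwi⟩ := hbasis
  generalize hC1 : n * (2 * n) = C1 at *
  set N := CT n * M + (D + C1) + (I + C1) with hN
  let Y : ℕ → ((Fin D × Fin d) × (Fin I × Fin d) → k) →ₗ[k] RR n k := fun l =>
    Fintype.linearCombination k (fun mi : (Fin D × Fin d) × (Fin I × Fin d) =>
      PowerSeries.coeff l (T (tm k w mi.1)) * sub π ε (tm k w mi.2))
  let Λ : ((Fin D × Fin d) × (Fin I × Fin d) → k) →ₗ[k] (Fin M × Fin (d * N + 1) → k) :=
    LinearMap.pi fun lj => (PowerSeries.coeff (R := k) lj.2).comp ((phi T Q).toLinearMap.comp (Y lj.1))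
  have hkerne : LinearMap.ker Λ ≠ ⊥ := by
    apply LinearMap.ker_ne_bot_of_finrank_lt
    simp only [Module.finrank_fintype_fun_eq_card, Fintype.card_prod, Fintype.card_fin]
    exact hker
  obtain ⟨c, hcΛ, hc0⟩ := (Submodule.ne_bot_iff _).1 hkerne
  have hYdeg : ∀ l < M, (Y l c).totalDegree ≤ N := by
    intro l hl
    rw [Fintype.linearCombination_apply]
    apply MvPolynomial.totalDegree_finsetSum_le
    intro mi _
    apply (MvPolynomial.totalDegree_smul_le _ _).trans
    apply (MvPolynomial.totalDegree_mul _ _).trans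
    have h1 := hT.deg (tm k w mi.1) l
    have h2 := (sub_deg π ε (tm k w mi.2)).trans (tm_deg w hw mi.2)
    rw [hC1] at h2
    have h3 := tm_deg (k := k) w hw mi.1
    rw [hC1] at h3
    have h4 : CT n * l ≤ CT n * M := Nat.mul_le_mul_left _ hl.le
    omega
  have hYev : ∀ l < M, ev s (Y l c) = 0 := by
    intro l hl
    by_contra hne
    have := zero_bound h2 h hf hn hn2 hg hT (Y l c) N (hYdeg l hl) hne (d * N + 1) {Q} (by simpa using hQ) (by
      simp only [Finset.mem_singleton, forall_eq]
      rw [PowerSeries.X_pow_dvd_iff]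
      intro j hj
      exact congrFun (LinearMap.mem_ker.1 hcΛ) (⟨l, hl⟩, ⟨j, hj⟩))
    rw [hd] at this
    simp only [Finset.card_singleton, one_mul] at this
    omega
  set Ψ : RR n k := ∑ mi : (Fin D × Fin d) × (Fin I × Fin d), c mi • (tm k w mi.1 * tm k w mi.2 ^ (p ^ e)) with hΨ
  have hΨdeg : Ψ.totalDegree ≤ (D + C1) + p ^ e * (I + C1) := by
    apply MvPolynomial.totalDegree_finsetSum_le
    intro mi _
    apply (MvPolynomial.totalDegree_smul_le _ _).trans
    apply (MvPolynomial.totalDegree_mul _ _).trans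
    apply Nat.add_le_add (hC1 ▸ tm_deg w hw _)
    apply (MvPolynomial.totalDegree_pow _ _).trans
    exact Nat.mul_le_mul_left _ (hC1 ▸ tm_deg w hw _)
  have hΨ0 : ev s Ψ ≠ 0 := by
    have hroot : ∀ a : k, ∃ b : k, b ^ (p ^ e) = a := fun a =>
      IsAlgClosed.exists_pow_nat_eq a (pow_pos (Fact.out : p.Prime).pos e)
    choose ρ hρ using hroot
    have e1 : Ψ = ∑ m, tm k w m * (∑ i : Fin I × Fin d, ρ (c (m, i)) • tm k w i) ^ (p ^ e) := by
      rw [hΨ, Fintype.sum_prod_type]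
      refine Finset.sum_congr rfl fun m _ => ?_
      haveI : CharP (RR n k) p := charP_of_injective_algebraMap (MvPolynomial.C_injective _ _) p
      rw [sum_pow_char_pow, Finset.mul_sum]
      refine Finset.sum_congr rfl fun i _ => ?_
      rw [_root_.smul_pow, hρ, mul_smul_comm]
    rw [e1]
    obtain ⟨⟨m0, i0⟩, hmi⟩ := Function.ne_iff.1 hc0
    refine psi_ne h2 h hf hn hn2 hg hT hQ p e d hd w hw hwi D (hC1 ▸ hD) _ m0 ?_
    intro h0
    have := tmono_indep w hwi I (fun i => ρ (c (m0, i))) h0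
    have := congrFun this i0
    simp only [Pi.zero_apply] at this
    have h3 := hρ (c (m0, i0))
    rw [this, zero_pow (pow_pos (Fact.out : p.Prime).pos e).ne'] at h3
    exact hmi h3.symm
  rw [← hd]
  apply zero_bound h2 h hf hn hn2 hg hT Ψ _ hΨdeg hΨ0 M S (fun P hP => (hS P hP).1)
  intro P hP
  obtain ⟨hUP, ht, hs⟩ := hS P hP
  rw [PowerSeries.X_pow_dvd_iff]
  intro l hl
  have h0 := (phi_zero h2 h hf hn hn2 hg hT hUP _).1 (hYev l hl)
  have h1 := congrArg PowerSeries.constantCoeff h0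
  rw [phi_const hT, map_zero, Fintype.linearCombination_apply, map_sum] at h1
  rw [hΨ, map_sum, map_sum, ← h1]
  refine Finset.sum_congr rfl fun mi _ => ?_
  rw [map_smul, map_mul, map_pow, PowerSeries.coeff_smul, coeff_mul_pow p e _ _ l (by omega), phi_coeff,
    phi_const hT, MvPolynomial.smul_eval, map_mul, tm_sub w mi.2 (p ^ e) P π ε ht hs, smul_eq_mul]

end
end S2S


set_option linter.all false
namespace S2S

open Finset Polynomial

lemma exists_sqrt_roots {Ω : Type*} [Field Ω] [IsAlgClosed Ω] {n : ℕ} (p : Polynomial Ω) (hp : p.Monic) (hn : p.natDegree = n) :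
    ∃ s : Fin n → Ω, p = ∏ i, (X + C (s i ^ 2)) := by
  have hs := (IsAlgClosed.splits p).eq_prod_roots_of_monic hp
  have hc : p.roots.card = n := by rw [← hn]; exact (IsAlgClosed.splits p).natDegree_eq_card_roots.symm
  have hl : p.roots.toList.length = n := by rw [Multiset.length_toList, hc]
  have hsq : ∀ a : Ω, ∃ b : Ω, b ^ 2 = a := fun a => IsAlgClosed.exists_pow_nat_eq a two_pos
  choose ρ hρ using hsq
  refine ⟨fun i => ρ (- p.roots.toList.get (Fin.cast hl.symm i)), ?_⟩
  simp only [hρ]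
  have h1 : p.roots = Multiset.map (fun i : Fin n => p.roots.toList.get (Fin.cast hl.symm i)) univ.val := by
    conv_lhs => rw [← Multiset.coe_toList p.roots]
    subst hl
    simp only [Fin.cast_eq_self, Fin.univ_val_map, List.get_eq_getElem, List.ofFn_getElem]
  conv_lhs => rw [hs, h1, Multiset.map_map]
  rw [← Finset.prod_eq_multiset_prod]
  refine Finset.prod_congr rfl fun i _ => ?_
  simp [sub_eq_add_neg]

lemma setup_exists {k : Type*} [Field k] {n : ℕ} (f : k[X]) (hf : f.Monic) (hn : f.natDegree = n) (hn2 : 2 ≤ n) :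
    ∃ s : Fin n → AlgebraicClosure (RatFunc k), ∃ s' : Fin n → IntermediateField.adjoin (RatFunc k) (Set.range s),
      Setup f s' := by
  obtain ⟨hm, hd⟩ := fam_monic f (algebraMap (RatFunc k) (AlgebraicClosure (RatFunc k)) RatFunc.X) hf hn hn2
  obtain ⟨s, hs⟩ := exists_sqrt_roots _ hm hd
  refine ⟨s, fun i => ⟨s i, IntermediateField.subset_adjoin _ _ ⟨i, rfl⟩⟩, ?_, ?_⟩
  · apply Polynomial.map_injective (algebraMap (IntermediateField.adjoin (RatFunc k) (Set.range s)) (AlgebraicClosure (RatFunc k)))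
      Subtype.val_injective
    haveI : IsScalarTower k (IntermediateField.adjoin (RatFunc k) (Set.range s)) (AlgebraicClosure (RatFunc k)) :=
      IsScalarTower.of_algebraMap_eq fun _ => rfl
    have e := fam_map f (algebraMap (RatFunc k) (IntermediateField.adjoin (RatFunc k) (Set.range s)) RatFunc.X)
      (IsScalarTower.toAlgHom k (IntermediateField.adjoin (RatFunc k) (Set.range s)) (AlgebraicClosure (RatFunc k)))
    refine e.trans ?_
    rw [Polynomial.map_prod]
    refine hs.trans ?_
    refine Finset.prod_congr rfl fun i _ => ?_
    rw [Polynomial.map_add, map_X, map_C]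
    rfl
  · have halg : Algebra.IsAlgebraic (RatFunc k) (IntermediateField.adjoin (RatFunc k) (Set.range s)) := inferInstance
    apply Algebra.adjoin_eq_top_of_intermediateField
    · intro x _; exact Algebra.IsAlgebraic.isAlgebraic x
    · apply IntermediateField.lift_injective
      rw [IntermediateField.lift_adjoin, IntermediateField.lift_top, ← Set.range_comp]
      rfl


lemma arith_core (d C1 C2 q : ℕ) (hd : 1 ≤ d) :
    ∀ M : ℕ, M * M ≤ q → q ≤ M * M + 2 * M →
    (2 * (1 + d * C2) + (d + 2 * d * C1 + 1)) + (2 * (1 + d * C2) + 1) * (d * (C1 + 2)) + 1 ≤ M →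
    ∃ D I : ℕ, d * (D + C1) < q ∧ M ≤ q ∧
      M * (d * (C2 * M + (D + C1) + (I + C1)) + 1) < (D * d) * (I * d) ∧
      d * ((D + C1) + q * (I + C1)) ≤ M * (q + 3 * (1 + 2 * (1 + d * C2) + d + d * C1) * M) := by
  intro M hM1 hM2 hM
  obtain ⟨C3, hC3⟩ : ∃ C3, C3 = 2 * (1 + d * C2) := ⟨_, rfl⟩
  rw [← hC3] at hM ⊢
  have hMpos : 1 ≤ M := by omega
  obtain ⟨a, ha⟩ : ∃ a, a = q / d := ⟨_, rfl⟩
  have ha1 : d * a ≤ q := by rw [ha]; exact Nat.mul_div_le q d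
  have ha2 : q < d * a + d := by
    have := Nat.lt_mul_div_succ q (show 0 < d by omega)
    rw [← ha] at this; linarith
  have hbig : d * (C1 + 2) < q := by
    have h1 : d * (C1 + 2) ≤ (C3 + 1) * (d * (C1 + 2)) := Nat.le_mul_of_pos_left _ (by omega)
    have h2 : M ≤ M * M := Nat.le_mul_of_pos_left _ (by omega)
    omega
  have haC : C1 + 1 < a := by
    by_contra hcon
    have : d * a ≤ d * (C1 + 1) := Nat.mul_le_mul_left _ (by omega)
    nlinarith
  obtain ⟨D, hD⟩ : ∃ D, a = D + C1 + 1 := ⟨a - C1 - 1, by omega⟩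
  obtain ⟨b, hb⟩ : ∃ b, b = (M + C3) / d := ⟨_, rfl⟩
  have hb1 : d * b ≤ M + C3 := by rw [hb]; exact Nat.mul_div_le _ d
  have hb2 : M + C3 < d * b + d := by
    have := Nat.lt_mul_div_succ (M + C3) (show 0 < d by omega)
    rw [← hb] at this; linarith
  refine ⟨D, b + 1, ?_, ?_, ?_, ?_⟩
  · rw [hD] at ha1
    nlinarith
  · nlinarith
  · have e1 : d * D + d * (C1 + 2) > q := by rw [hD] at ha2; nlinarith
    have e2 : d * (b + 1) ≥ M + C3 + 1 := by nlinarith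
    have e3 : d * (b + 1) ≤ M + C3 + d := by nlinarith
    have e4 : (D * d) * ((b + 1) * d) ≥ (D * d) * (M + C3 + 1) := Nat.mul_le_mul_left _ (by linarith)
    refine lt_of_lt_of_le ?_ e4
    have e5 : M * (d * (b + 1)) ≤ M * (M + C3 + d) := Nat.mul_le_mul_left _ e3
    have e6 : (C3 + 1) * (d * D + d * (C1 + 2)) ≥ (C3 + 1) * (q + 1) := Nat.mul_le_mul_left _ e1
    have e7 : (C3 + (d + 2 * d * C1 + 1)) * M + (C3 + 1) * (d * (C1 + 2)) ≤ M * M := by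
      have : ((C3 + (d + 2 * d * C1 + 1)) + (C3 + 1) * (d * (C1 + 2)) + 1) * M ≤ M * M := Nat.mul_le_mul_right _ hM
      have : (C3 + 1) * (d * (C1 + 2)) * 1 ≤ (C3 + 1) * (d * (C1 + 2)) * M := Nat.mul_le_mul_left _ hMpos
      linarith
    have e8 : (1 + d * C2) * (M * M) ≤ (1 + d * C2) * q := Nat.mul_le_mul_left _ hM1
    have e9 : C3 * q = 2 * ((1 + d * C2) * q) := by rw [hC3]; ring
    have e10 : 0 ≤ (1 + d * C2) * q := Nat.zero_le _
    linarith
  · have e1 : d * (D + C1) ≤ q := by rw [hD] at ha1; nlinarith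
    have e2 : d * (b + 1 + C1) ≤ M + C3 + d + d * C1 := by nlinarith
    have e3 : q * (d * (b + 1 + C1)) ≤ q * (M + C3 + d + d * C1) := Nat.mul_le_mul_left _ e2
    have e4 : q ≤ 3 * (M * M) := by nlinarith
    have e5 : (1 + C3 + d + d * C1) * q ≤ (1 + C3 + d + d * C1) * (3 * (M * M)) := Nat.mul_le_mul_left _ e4
    linarith

theorem point_bound (n : ℕ) (hn2 : 2 ≤ n) : ∃ C0 : ℕ, ∀ (k : Type) [Field k] [IsAlgClosed k] (h2 : (2 : k) ≠ 0)
    (f : k[X]) (hf : f.Monic) (hn : f.natDegree = n) (hg : Good f) (p e : ℕ) [Fact p.Prime] [CharP k p]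
    (he : 0 < e) (π : Equiv.Perm (Fin n)) (ε : Fin n → ℤˣ) (S : Finset (Option (Fin n) → k))
    (hS : ∀ P ∈ S, UP f P ∧ P none ^ (p ^ e) = P none ∧
      ∀ i, P (some i) ^ (p ^ e) = ((ε i : ℤ) : k) * P (some (π i))),
    S.card ≤ p ^ e + C0 * Nat.sqrt (p ^ e) := by
  obtain ⟨d, hd⟩ : ∃ d, 2 ^ n * n.factorial = d := ⟨_, rfl⟩
  obtain ⟨C1, hC1⟩ : ∃ d, n * (2 * n) = d := ⟨_, rfl⟩
  obtain ⟨M0, hM0⟩ : ∃ M0, M0 = (2 * (1 + d * CT n) + (d + 2 * d * C1 + 1)) + (2 * (1 + d * CT n) + 1) * (d * (C1 + 2)) + 1 := ⟨_, rfl⟩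
  have hd1 : 1 ≤ d := by rw [← hd]; exact Nat.mul_pos (by positivity) (Nat.factorial_pos n)
  refine ⟨3 * (1 + 2 * (1 + d * CT n) + d + d * C1) + d * (M0 + 2), ?_⟩
  intro k _ _ h2 f hf hn hg p e _ _ he π ε S hS
  obtain ⟨s0, s, hset⟩ := setup_exists f hf hn hn2
  obtain ⟨T, hT1, hT2, hT3, hT4⟩ := taylor_exists (n := n) f hn (by omega)
  have hT : IsTaylor f T := ⟨hT1, hT2, hT3, hT4⟩
  have hp := (Fact.out : p.Prime)
  obtain ⟨q, hq⟩ : ∃ q, p ^ e = q := ⟨_, rfl⟩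
  have hq1 : 1 < q := by rw [← hq]; exact Nat.one_lt_pow he.ne' hp.one_lt
  have hM1 := Nat.sqrt_le q
  have hM2 := Nat.sqrt_le_add q
  have hMp : 1 ≤ Nat.sqrt q := Nat.sqrt_pos.2 (by omega)
  rcases S.eq_empty_or_nonempty with rfl | ⟨Q, hQ⟩
  · simp
  by_cases hlarge : M0 ≤ Nat.sqrt q
  · rw [hM0] at hlarge
    obtain ⟨D, I, h1, h3, h4, h5⟩ := arith_core d C1 (CT n) q hd1 (Nat.sqrt q) hM1 (by linarith) hlarge
    have := stepanov_core h2 hset hf hn hn2 hg hT (hS Q hQ).1 p e d hd D I (Nat.sqrt q) (by rwa [hC1, hq])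
      (by rwa [hq]) (by rwa [hC1]) π ε S hS
    rw [hC1, hq] at this
    have h6 := this.trans h5
    rw [mul_comm] at h6
    have h7 := Nat.le_of_mul_le_mul_left h6 hMp
    rw [hq]
    refine h7.trans ?_
    nlinarith [Nat.zero_le (d * (M0 + 2) * Nat.sqrt q)]
  · have hr : ev s (MvPolynomial.X none ^ q - MvPolynomial.X none : RR n k) ≠ 0 := by
      rw [map_sub, map_pow, ev_t, ← map_pow, ← map_sub, ← RatFunc.algebraMap_X, ← map_pow, ← map_sub]
      rw [Ne, map_eq_zero_iff _ (algebraMap (RatFunc k) _).injective,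
        map_eq_zero_iff _ (IsFractionRing.injective k[X] (RatFunc k))]
      exact FiniteField.X_pow_card_sub_X_ne_zero k hq1
    have hdeg : (MvPolynomial.X none ^ q - MvPolynomial.X none : RR n k).totalDegree ≤ q := by
      apply (MvPolynomial.totalDegree_sub _ _).trans
      rw [MvPolynomial.totalDegree_X_pow, MvPolynomial.totalDegree_X]
      exact max_le le_rfl hq1.le
    have := zero_bound h2 hset hf hn hn2 hg hT _ q hdeg hr 1 S (fun P hP => (hS P hP).1) (by
      intro P hP
      rw [pow_one, PowerSeries.X_dvd_iff, phi_const hT, map_sub, map_pow, MvPolynomial.eval_X, ← hq,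
        (hS P hP).2.1, sub_self])
    rw [hd, mul_one] at this
    rw [hq]
    have h8 : q ≤ (M0 + 2) * Nat.sqrt q := by
      have : Nat.sqrt q * Nat.sqrt q ≤ M0 * Nat.sqrt q := Nat.mul_le_mul_right _ (by omega)
      linarith
    have h9 : d * q ≤ d * ((M0 + 2) * Nat.sqrt q) := Nat.mul_le_mul_left _ h8
    refine this.trans (h9.trans ?_)
    nlinarith [Nat.zero_le (3 * (1 + 2 * (1 + d * CT n) + d + d * C1) * Nat.sqrt q)]

end S2S


set_option linter.all false
namespace S2S

open Finset Polynomial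

/-- divided difference `(p(Y) - p(x))/(Y-x)` in `k[x][Y]` -/
noncomputable def dd {k : Type*} [Field k] (p : k[X]) : k[X][X] :=
  (p.map C - C p) /ₘ (X - C X)

lemma dd_mul {k : Type*} [Field k] (p : k[X]) : (X - C X) * dd p = p.map C - C p := by
  unfold dd
  rw [mul_divByMonic_eq_iff_isRoot]
  simp [IsRoot.def, eval_map, eval₂_C_X]

lemma dd_natDegree {k : Type*} [Field k] (p : k[X]) (N : ℕ) (h : p.natDegree ≤ N) :
    (p.map C - C p).natDegree ≤ N := by
  refine (natDegree_sub_le _ _).trans ?_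
  simp [h]

lemma dd_natDegree' {k : Type*} [Field k] (p : k[X]) (N : ℕ) (h : p.natDegree ≤ N) :
    (dd p).natDegree ≤ N := by
  unfold dd
  rw [natDegree_divByMonic _ (monic_X_sub_C _)]
  have := dd_natDegree p N h
  omega

lemma dd_coeff {k : Type*} [Field k] (p : k[X]) (N : ℕ) (h : p.natDegree ≤ N) (j : ℕ) :
    ((dd p).coeff j).natDegree ≤ N := by
  unfold dd
  rw [coeff_divByMonic_X_sub_C]
  refine natDegree_sum_le_of_forall_le _ _ fun i hi => ?_
  rw [Finset.mem_Icc] at hi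
  have h1 : (p.map C - C p).coeff i = C (p.coeff i) := by
    rw [coeff_sub, coeff_map, coeff_C, if_neg (by omega), sub_zero]
  rw [h1]
  refine (natDegree_mul_le).trans ?_
  have := dd_natDegree p N h
  simp
  omega

lemma resultant_natDegree {k : Type*} [Field k] (f g : k[X][X]) (a b N : ℕ)
    (hf : ∀ j, (f.coeff j).natDegree ≤ N) (hg : ∀ j, (g.coeff j).natDegree ≤ N) :
    (resultant f g a b).natDegree ≤ (a + b) * N := by
  unfold resultant
  rw [Matrix.det_apply]
  refine natDegree_sum_le_of_forall_le _ _ fun σ _ => ?_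
  have h1 : (Equiv.Perm.sign σ • ∏ i, f.sylvester g a b (σ i) i).natDegree
      ≤ (∏ i, f.sylvester g a b (σ i) i).natDegree := by
    rcases Int.units_eq_one_or (Equiv.Perm.sign σ) with h | h <;> rw [h] <;> simp
  refine h1.trans ((natDegree_prod_le _ _).trans ?_)
  refine (Finset.sum_le_card_nsmul _ _ N fun i _ => ?_).trans (by simp)
  unfold sylvester
  simp only [Matrix.of_apply]
  induction i using Fin.addCases with
  | left i => simp only [Fin.addCases_left]; split_ifs <;> simp [hg]
  | right i => simp only [Fin.addCases_right]; split_ifs <;> simp [hf]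

noncomputable def dx {k : Type*} [Field k] (p : k[X][X]) : k[X][X] :=
  Bivariate.swap (R := k) (derivative (Bivariate.swap (R := k) p))

lemma dx_mul {k : Type*} [Field k] (p q : k[X][X]) : dx (p * q) = dx p * q + p * dx q := by
  have hs : ∀ r : k[X][X], Bivariate.swap (R := k) (Bivariate.swap (R := k) r) = r := fun r =>
    Bivariate.swap_swap_apply r
  simp [dx, derivative_mul, hs]

lemma dx_sub {k : Type*} [Field k] (p : k[X]) : dx (p.map C - C p) = - C (derivative p) := by
  unfold dx
  rw [map_sub, Bivariate.swap_C, Bivariate.swap_map_C, derivative_sub, derivative_C, derivative_map, zero_sub, map_neg, Bivariate.swap_map_C]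

lemma no_common {k Λ : Type*} [Field k] [IsAlgClosed k] [Field Λ] [Algebra k[X] Λ] 
    (hinj : Function.Injective (algebraMap k[X] Λ))
    (U V : k[X]) (h : derivative V = (X - 1) * derivative U) (hU' : derivative U ≠ 0) (y : Λ)
    (hA : aeval y (dd U) = 0) (hB : aeval y (dd V) = 0) : False := by
  letI : Algebra k Λ := ((algebraMap k[X] Λ).comp C).toAlgebra
  haveI : IsScalarTower k k[X] Λ := IsScalarTower.of_algebraMap_eq fun _ => rfl
  haveI : Module.IsTorsionFree k[X] Λ := by
    haveI : FaithfulSMul k[X] Λ := (faithfulSMul_iff_algebraMap_injective _ _).mpr hinj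
    infer_instance
  have hev : ∀ p : k[X], aeval y (p.map C) = aeval y p := by
    intro p
    rw [show (C : k →+* k[X]) = algebraMap k k[X] from rfl, aeval_map_algebraMap]
  have hA' : aeval y (U.map C - C U) = 0 := by rw [← dd_mul, map_mul, hA, mul_zero]
  have hB' : aeval y (V.map C - C V) = 0 := by rw [← dd_mul, map_mul, hB, mul_zero]
  -- y is not in k
  have hyc : ∀ c : k, y ≠ algebraMap k Λ c := by
    rintro c rfl
    rw [map_sub, hev, aeval_algebraMap_apply, aeval_C, sub_eq_zero] at hA'
    rw [IsScalarTower.algebraMap_apply k k[X] Λ] at hA'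
    have := hinj hA'
    rw [← this] at hU'
    simp at hU'
  have hyr : ∀ p : k[X], p ≠ 0 → aeval y p ≠ 0 := by
    intro p hp h0
    have hi : IsIntegral k y := (isAlgebraic_iff_isIntegral).mp ⟨p, hp, h0⟩
    obtain ⟨c, hc⟩ := minpoly.mem_range_of_degree_eq_one k y
      (IsAlgClosed.degree_eq_one_of_irreducible k (minpoly.irreducible hi))
    exact hyc c hc.symm
  -- y ≠ x
  have hyx : y ≠ algebraMap k[X] Λ X := by
    rintro rfl
    have h1 := congrArg derivative (dd_mul U)
    rw [derivative_mul] at h1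
    have h2 := congrArg (aeval (algebraMap k[X] Λ X)) h1
    simp only [map_add, map_mul, hA, mul_zero, map_sub, aeval_X, aeval_C, sub_self, zero_mul, add_zero, derivative_sub, derivative_C, derivative_map, hev, sub_zero] at h2
    exact hyr _ hU' h2.symm
  have hyint : IsIntegral k[X] y := by
    have hU0 : U.natDegree ≠ 0 := by
      intro h0; apply hU'; rw [natDegree_eq_zero] at h0; obtain ⟨c, rfl⟩ := h0; simp
    have hlc : U.leadingCoeff ≠ 0 := by
      intro h0; rw [leadingCoeff_eq_zero] at h0; apply hU'; simp [h0]
    refine ⟨C (C U.leadingCoeff⁻¹) * (U.map C - C U), ?_, ?_⟩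
    · have hlt : (C U : k[X][X]).degree < (U.map C).degree := by
        rw [degree_map]
        refine lt_of_le_of_lt degree_C_le ?_
        rw [← natDegree_pos_iff_degree_pos]; omega
      unfold Monic
      rw [leadingCoeff_mul, leadingCoeff_C, leadingCoeff_sub_of_degree_lt hlt, leadingCoeff_map, ← C_mul, inv_mul_cancel₀ hlc, C_1]
    · rw [← aeval_def, map_mul, hA', mul_zero]
  obtain ⟨G, hG⟩ := minpoly.isIntegrallyClosed_dvd hyint hA'
  obtain ⟨H, hH⟩ := minpoly.isIntegrallyClosed_dvd hyint hB'
  obtain ⟨Q, hQ⟩ : ∃ Q, Q = minpoly k[X] y := ⟨_, rfl⟩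
  have hQy : aeval y Q = 0 := by rw [hQ]; exact minpoly.aeval _ _
  rw [← hQ] at hG hH
  have e1 := congrArg (aeval y) (congrArg derivative hG)
  have e2 := congrArg (aeval y) (congrArg derivative hH)
  have e3 := congrArg (aeval y) (congrArg dx hG)
  have e4 := congrArg (aeval y) (congrArg dx hH)
  rw [derivative_mul] at e1 e2
  rw [dx_sub, dx_mul] at e3 e4
  simp only [map_add, map_mul, map_neg, hQy, zero_mul, add_zero, derivative_sub, derivative_C, derivative_map, hev, sub_zero, aeval_C, h, map_sub, map_one, aeval_X] at e1 e2 e3 e4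
  have key : aeval y (derivative U) * algebraMap k[X] Λ (derivative U) * (y - algebraMap k[X] Λ X) = 0 := by
    linear_combination (-(algebraMap k[X] Λ X - 1) * algebraMap k[X] Λ (derivative U)) * e1 + (aeval y Q.derivative * aeval y G) * e4 - (aeval y Q.derivative * aeval y H) * e3 + (algebraMap k[X] Λ (derivative U)) * e2
  rcases mul_eq_zero.mp key with h1 | h1
  · rcases mul_eq_zero.mp h1 with h2 | h2
    · exact hyr _ hU' h2
    · exact hU' (hinj (by rw [h2, map_zero]))
  · exact hyx (sub_eq_zero.mp h1)

lemma common_bound {k : Type*} [Field k] [IsAlgClosed k] (U V : k[X]) (N : ℕ) (hU : U.natDegree ≤ N)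
    (hV : V.natDegree ≤ N) (h : derivative V = (X - 1) * derivative U) (hU' : derivative U ≠ 0) :
    ∃ R : k[X], R ≠ 0 ∧ R.natDegree ≤ (N + N + 1) * N ∧ ∀ x0 x1, x0 ≠ x1 → U.eval x0 = U.eval x1 →
      V.eval x0 = V.eval x1 → R.eval x0 = 0 := by
  have hz : ∀ (p : k[X]) (x0 x1 : k), x0 ≠ x1 → p.eval x0 = p.eval x1 → ((dd p).map (evalRingHom x0)).eval x1 = 0 := by
    intro p x0 x1 hne he
    have h1 := congrArg (fun r : k[X][X] => (r.map (evalRingHom x0)).eval x1) (dd_mul p)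
    simp only [Polynomial.map_mul, Polynomial.map_sub, map_X, map_C, eval_mul, eval_sub, eval_X, eval_C, Polynomial.map_map] at h1
    have h2 : (evalRingHom x0).comp (C : k →+* k[X]) = RingHom.id k := by ext; simp
    rw [h2, Polynomial.map_id] at h1
    simp only [coe_evalRingHom, eval_X, he, sub_self, mul_eq_zero] at h1
    rcases h1 with h1 | h1
    · exact absurd (sub_eq_zero.mp h1).symm hne
    · exact h1
  have hdd : dd U ≠ 0 := by
    intro h0
    have h1 := dd_mul U
    rw [h0, mul_zero] at h1
    have h2 := congrArg derivative h1
    simp only [derivative_zero, derivative_sub, derivative_map, derivative_C, sub_zero] at h2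
    exact hU' ((Polynomial.map_eq_zero_iff C_injective).mp h2.symm)
  by_cases hA0 : (dd U).natDegree = 0
  · refine ⟨(dd U).coeff 0, ?_, ?_, ?_⟩
    · intro h0
      apply hdd
      rw [eq_C_of_natDegree_eq_zero hA0, h0, C_0]
    · refine (dd_coeff U N hU 0).trans ?_
      nlinarith
    · intro x0 x1 hne he _
      have := hz U x0 x1 hne he
      rw [eq_C_of_natDegree_eq_zero hA0] at this
      simpa using this
  · refine ⟨resultant (dd U) (dd V), ?_, ?_, ?_⟩
    · intro h0
      have hinj : Function.Injective (algebraMap k[X] (AlgebraicClosure (RatFunc k))) := by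
        rw [IsScalarTower.algebraMap_eq k[X] (RatFunc k) (AlgebraicClosure (RatFunc k))]
        exact (algebraMap (RatFunc k) _).injective.comp (RatFunc.algebraMap_injective k)
      have h1 := resultant_map_map (dd U) (dd V) (dd U).natDegree (dd V).natDegree (algebraMap k[X] (AlgebraicClosure (RatFunc k)))
      rw [h0, map_zero] at h1
      have h2 : resultant ((dd U).map (algebraMap k[X] (AlgebraicClosure (RatFunc k)))) ((dd V).map (algebraMap k[X] (AlgebraicClosure (RatFunc k)))) = 0 := by
        rw [natDegree_map_eq_of_injective hinj, natDegree_map_eq_of_injective hinj]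
        exact h1
      rw [resultant_eq_zero_iff] at h2
      apply h2.2
      rw [isCoprime_iff_aeval_ne_zero_of_isAlgClosed _ (AlgebraicClosure (RatFunc k))]
      intro y
      by_contra hcon
      rw [not_or, not_not, not_not] at hcon
      obtain ⟨c1, c2⟩ := hcon
      rw [coe_aeval_eq_eval, eval_map_algebraMap] at c1 c2
      exact no_common hinj U V h hU' y c1 c2
    · refine (resultant_natDegree _ _ _ _ N (dd_coeff U N hU) (dd_coeff V N hV)).trans ?_
      have a1 := dd_natDegree' U N hU
      have a2 := dd_natDegree' V N hV
      exact Nat.mul_le_mul_right _ (by omega)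
    · intro x0 x1 hne he1 he2
      obtain ⟨p, q, _, _, hpq⟩ := exists_mul_add_mul_eq_C_resultant (dd U) (dd V) le_rfl le_rfl (Or.inl hA0)
      have h1 := congrArg (fun r : k[X][X] => (r.map (evalRingHom x0)).eval x1) hpq
      simp only [Polynomial.map_mul, Polynomial.map_add, map_C, eval_mul, eval_add, eval_C, hz U x0 x1 hne he1, hz V x0 x1 hne he2, zero_mul, zero_add] at h1
      exact h1.symm

end S2S


set_option linter.all false
namespace S2S

open Finset Polynomial

lemma not_sep_root {k : Type*} [Field k] [IsAlgClosed k] (p : k[X]) (h : ¬ p.Separable) :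
    ∃ x, p.eval x = 0 ∧ (derivative p).eval x = 0 := by
  by_contra hcon
  push Not at hcon
  apply h
  unfold Separable
  rw [isCoprime_iff_aeval_ne_zero_of_isAlgClosed _ k]
  intro x
  rw [coe_aeval_eq_eval]
  by_cases hx : p.eval x = 0
  · exact Or.inr (hcon x hx)
  · exact Or.inl hx

lemma good_exists {k : Type*} [Field k] [IsAlgClosed k] (h2 : (2 : k) ≠ 0) {n : ℕ} (hn : 3 ≤ n) (f : k[X])
    (hf : f.natDegree = n) :
    ∃ Bα : Finset k, Bα.card ≤ 2 ∧ ∀ α ∉ Bα, ∃ Bβ : Finset k, Bβ.card ≤ (n + n + 1) * n + 2 * n + 2 ∧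
      ∀ β ∉ Bβ, Good (f + C α * X ^ 2 + C β) := by
  classical
  refine ⟨{- (derivative (derivative f)).coeff 0 / 2, - (X * derivative f - f + C (f.eval 0)).coeff 2}, Finset.card_le_two, ?_⟩
  intro α hα
  rw [Finset.mem_insert, Finset.mem_singleton, not_or] at hα
  obtain ⟨U, hU⟩ : ∃ U, U = derivative f + C (2 * α) * X := ⟨_, rfl⟩
  obtain ⟨V, hV⟩ : ∃ V, V = derivative f * (X - 1) - f + C α * (X ^ 2 - 2 * X) := ⟨_, rfl⟩
  obtain ⟨E, hE⟩ : ∃ E, E = (X * derivative f - f + C (f.eval 0)) + C α * X ^ 2 := ⟨_, rfl⟩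
  have hU' : derivative U = derivative (derivative f) + C (2 * α) := by
    rw [hU]; simp
  have hU0 : derivative U ≠ 0 := by
    intro h0
    rw [hU'] at h0
    apply hα.1
    have := congrArg (fun r : k[X] => r.coeff 0) h0
    simp only [coeff_add, coeff_C_zero, coeff_zero] at this
    field_simp
    linear_combination this
  have hE0 : E ≠ 0 := by
    intro h0
    rw [hE] at h0
    apply hα.2
    have := congrArg (fun r : k[X] => r.coeff 2) h0
    simp only [coeff_add _ (C α * X ^ 2), coeff_C_mul, coeff_X_pow, coeff_zero, if_true, mul_one] at this
    linear_combination this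
  have hVU : derivative V = (X - 1) * derivative U := by
    rw [hU', hV]
    simp only [derivative_add, derivative_sub, derivative_mul, derivative_X, derivative_one, derivative_C, derivative_pow, derivative_ofNat, C_mul]
    simp
    rw [show (C 2 : k[X]) = 2 from rfl]
    ring
  have hdU : U.natDegree ≤ n := by
    rw [hU]
    refine (natDegree_add_le _ _).trans (max_le ?_ ?_)
    · exact (natDegree_derivative_le f).trans (by omega)
    · exact (natDegree_C_mul_le _ _).trans (by rw [natDegree_X]; omega)
  have hd1 : (derivative f * (X - 1)).natDegree ≤ n := by
    refine natDegree_mul_le.trans ?_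
    have h1 := natDegree_derivative_le f
    have h3 : (X - 1 : k[X]).natDegree = 1 := natDegree_X_sub_C 1
    rw [h3]; omega
  have hd2 : (X * derivative f).natDegree ≤ n := by
    refine natDegree_mul_le.trans ?_
    have h1 := natDegree_derivative_le f
    rw [natDegree_X]; omega
  have hdV : V.natDegree ≤ n := by
    rw [hV]
    refine (natDegree_add_le _ _).trans (max_le ((natDegree_sub_le _ _).trans (max_le hd1 hf.le)) ?_)
    refine (natDegree_C_mul_le _ _).trans ((natDegree_sub_le _ _).trans (max_le (by rw [natDegree_X_pow]; omega) ?_))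
    exact (natDegree_C_mul_le (2 : k) X).trans (by rw [natDegree_X]; omega)
  have hdE : E.natDegree ≤ n := by
    rw [hE]
    refine (natDegree_add_le _ _).trans (max_le ((natDegree_add_le _ _).trans (max_le ((natDegree_sub_le _ _).trans (max_le hd2 hf.le)) (by rw [natDegree_C]; omega))) ?_)
    exact (natDegree_C_mul_le _ _).trans (by rw [natDegree_X_pow]; omega)
  obtain ⟨R, hR0, hRd, hR⟩ := common_bound U V n hdU hdV hVU hU0
  have hX1 : (X - 1 : k[X]) ≠ 0 := X_sub_C_ne_zero 1
  have hV0 : derivative V ≠ 0 := by rw [hVU]; exact mul_ne_zero hX1 hU0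
  obtain ⟨P, hP⟩ : ∃ P : k[X], P = R * derivative V * E * X * (X - 1) := ⟨_, rfl⟩
  have hP0 : P ≠ 0 := by
    rw [hP]; exact mul_ne_zero (mul_ne_zero (mul_ne_zero (mul_ne_zero hR0 hV0) hE0) X_ne_zero) hX1
  refine ⟨P.roots.toFinset.image (fun x => V.eval x), ?_, ?_⟩
  · refine Finset.card_image_le.trans ((Multiset.toFinset_card_le _).trans ((card_roots' P).trans ?_))
    have hdV' : (derivative V).natDegree ≤ n := (natDegree_derivative_le V).trans (by omega)
    have h3 : (X - 1 : k[X]).natDegree = 1 := natDegree_X_sub_C 1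
    rw [hP]
    have a1 := natDegree_mul_le (p := R * derivative V * E * X) (q := (X - 1 : k[X]))
    have a2 := natDegree_mul_le (p := R * derivative V * E) (q := (X : k[X]))
    have a3 := natDegree_mul_le (p := R * derivative V) (q := E)
    have a4 := natDegree_mul_le (p := R) (q := derivative V)
    rw [natDegree_X] at a2
    omega
  intro β hβ
  have hx : ∀ x, V.eval x = β → R.eval x ≠ 0 ∧ (derivative V).eval x ≠ 0 ∧ E.eval x ≠ 0 ∧ x ≠ 0 ∧ x ≠ 1 := by
    intro x hxV
    have h1 : P.eval x ≠ 0 := by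
      intro h0
      apply hβ
      rw [Finset.mem_image]
      exact ⟨x, by rw [Multiset.mem_toFinset, mem_roots hP0]; exact h0, hxV⟩
    rw [hP] at h1
    simp only [eval_mul, eval_sub, eval_X, eval_one, mul_ne_zero_iff, sub_ne_zero] at h1
    exact ⟨h1.1.1.1.1, h1.1.1.1.2, h1.1.1.2, h1.1.2, h1.2⟩
  obtain ⟨g, hg⟩ : ∃ g, g = f + C α * X ^ 2 + C β := ⟨_, rfl⟩
  rw [← hg]
  have hg' : derivative g = U := by
    rw [hg, hU]; simp [C_mul]; rw [show (C 2 : k[X]) = 2 from rfl]; ring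
  have hfam : ∀ t : k, fam g t = g + C t * (X - 1) := by
    intro t; unfold fam; simp
  -- double points of the family
  have hdbl : ∀ t x : k, (fam g t).eval x = 0 → (derivative (fam g t)).eval x = 0 → U.eval x = - t ∧ V.eval x = β := by
    intro t x e1 e2
    rw [hfam] at e1 e2
    have e3 : U.eval x + t = 0 := by
      have : derivative (g + C t * (X - 1)) = U + C t := by rw [derivative_add, hg']; simp
      rw [this] at e2; simpa using e2
    refine ⟨by linear_combination e3, ?_⟩
    have e4 : (derivative f).eval x + 2 * α * x + t = 0 := by rw [hU] at e3; simpa using e3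
    have e5 : f.eval x + α * x ^ 2 + β + t * (x - 1) = 0 := by rw [hg] at e1; simpa using e1
    rw [hV]
    simp
    linear_combination (x - 1) * e4 - e5
  have hE2 : ∀ t x : k, U.eval x = - t → V.eval x = β → (fam g t).eval 0 = E.eval x := by
    intro t x e1 e2
    rw [hfam, hg, hE]
    rw [hU] at e1; rw [hV] at e2
    simp at e1 e2 ⊢
    linear_combination - e1 - e2
  refine ⟨?_, ?_, ?_⟩
  · intro h0
    refine (hx 1 ?_).2.2.2.2 rfl
    rw [hg] at h0; rw [hV]
    simp at h0 ⊢
    linear_combination - h0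
  · have hVd : (V - C β).degree ≠ 0 := by
      intro h0
      apply hV0
      have : derivative (V - C β) = 0 := by
        rw [eq_C_of_degree_eq_zero h0]; simp
      simpa using this
    obtain ⟨x0, hx0⟩ := IsAlgClosed.exists_root _ hVd
    have hVx : V.eval x0 = β := by simpa [IsRoot.def, sub_eq_zero] using hx0
    obtain ⟨r1, r2, r3, r4, r5⟩ := hx x0 hVx
    obtain ⟨t0, ht0⟩ : ∃ t0, t0 = - U.eval x0 := ⟨_, rfl⟩
    have c1 : (fam g t0).eval x0 = 0 := by
      rw [hfam, ht0, hg]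
      rw [hU]; rw [hV] at hVx
      simp at hVx ⊢
      linear_combination - hVx
    have c2 : derivative (fam g t0) = U + C t0 := by rw [hfam, derivative_add, hg']; simp
    obtain ⟨m1, hm1⟩ := dvd_iff_isRoot.mpr (show (fam g t0).IsRoot x0 from c1)
    have c3 : m1.eval x0 = 0 := by
      have := congrArg (fun r => (derivative r).eval x0) hm1
      simp only [c2, derivative_mul] at this
      simp [ht0] at this
      exact this.symm
    obtain ⟨m, hm⟩ := dvd_iff_isRoot.mpr (show m1.IsRoot x0 from c3)
    have hfm : fam g t0 = (X - C x0) ^ 2 * m := by rw [hm1, hm]; ring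
    have c4 : m.eval x0 ≠ 0 := by
      intro h0
      have := congrArg (fun r => (derivative (derivative r)).eval x0) hfm
      simp only [c2] at this
      simp [h0, derivative_mul] at this
      apply r2
      rw [hVU]; simp [this, derivative_pow]
    refine ⟨x0, t0, m, r4, r5, hfm, ?_, c4, ?_⟩
    · by_contra hs
      obtain ⟨x1, d1, d2⟩ := not_sep_root m hs
      have hne : x0 ≠ x1 := by rintro rfl; exact c4 d1
      obtain ⟨d3, d4⟩ := hdbl t0 x1 (by rw [hfm]; simp [d1]) (by rw [hfm]; simp [d1, d2, derivative_mul])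
      exact r1 (hR x0 x1 hne (by rw [d3, ht0]; ring) (by rw [hVx, d4]))
    · intro h0
      apply r3
      rw [← hE2 t0 x0 (by rw [ht0]; ring) hVx, hfm]
      simp [h0]
  · by_contra hs
    obtain ⟨x1, d1, d2⟩ := not_sep_root _ hs
    obtain ⟨d3, d4⟩ := hdbl _ x1 d1 d2
    apply (hx x1 d4).2.2.1
    rw [← hE2 _ x1 d3 d4, hfam]
    simp

end S2S


set_option linter.all false
namespace S2S

open Finset Polynomial

/-- the unramified parameters -/
def Unram {F : Type} [Field F] (g : F[X]) (t : F) : Prop :=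
  ((g + C t * (X - 1)).map (algebraMap F (AlgebraicClosure F))).Separable ∧ (g + C t * (X - 1)).eval 0 ≠ 0

lemma map_fam {F : Type} [Field F] (g : F[X]) (t : F) :
    (g + C t * (X - 1)).map (algebraMap F (AlgebraicClosure F)) =
      fam (g.map (algebraMap F (AlgebraicClosure F))) (algebraMap F (AlgebraicClosure F) t) := by
  unfold fam
  simp

open Classical in
lemma ram_count {F : Type} [Field F] [Fintype F] (g : F[X]) (n : ℕ) (hn : g.natDegree = n) (hn1 : 1 ≤ n)
    (h1 : (g.map (algebraMap F (AlgebraicClosure F))).eval 1 ≠ 0) :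
    (univ.filter fun t : F => ¬ Unram g t).card ≤ n + 1 := by
  obtain ⟨p, hp⟩ : ∃ p, p = g.map (algebraMap F (AlgebraicClosure F)) := ⟨_, rfl⟩
  have hpd : p.natDegree = n := by rw [hp, natDegree_map, hn]
  rw [← hp] at h1
  obtain ⟨W, hW⟩ : ∃ W, W = derivative p * (X - 1) - p := ⟨_, rfl⟩
  have hW0 : W ≠ 0 := by
    intro h0
    have := congrArg (eval 1) h0
    rw [hW] at this
    simp at this
    exact h1 this
  have hWd : W.natDegree ≤ n := by
    rw [hW]
    refine (natDegree_sub_le _ _).trans (max_le ?_ hpd.le)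
    refine natDegree_mul_le.trans ?_
    have h1 := natDegree_derivative_le p
    have h3 : (X - 1 : Polynomial (AlgebraicClosure F)).natDegree = 1 := natDegree_X_sub_C 1
    rw [h3]; omega
  have hsub : (univ.filter fun t : F => ¬ Unram g t).image (algebraMap F (AlgebraicClosure F)) ⊆
      insert (algebraMap F (AlgebraicClosure F) (g.eval 0)) (W.roots.toFinset.image fun x => - (derivative p).eval x) := by
    intro y hy
    rw [Finset.mem_image] at hy
    obtain ⟨t, ht, rfl⟩ := hy
    rw [Finset.mem_filter] at ht
    have ht2 := ht.2
    unfold Unram at ht2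
    rw [not_and_or, not_not] at ht2
    rw [Finset.mem_insert]
    rcases ht2 with ht2 | ht2
    · right
      obtain ⟨x, hx1, hx2⟩ := not_sep_root _ ht2
      simp only [Polynomial.map_add, Polynomial.map_mul, Polynomial.map_sub, map_C, map_X, Polynomial.map_one, ← hp,
        derivative_add, derivative_mul, derivative_C, derivative_sub, derivative_X, derivative_one, eval_add, eval_mul, eval_C, eval_sub, eval_X, eval_one, zero_mul, zero_add, sub_zero, mul_one, eval_zero] at hx1 hx2
      rw [Finset.mem_image]
      refine ⟨x, ?_, by linear_combination - hx2⟩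
      rw [Multiset.mem_toFinset, mem_roots hW0, IsRoot.def, hW]
      simp
      linear_combination (x - 1) * hx2 - hx1
    · left
      congr 1
      simp at ht2
      linear_combination - ht2
  rw [← Finset.card_image_of_injective _ (algebraMap F (AlgebraicClosure F)).injective]
  refine (Finset.card_le_card hsub).trans ((Finset.card_insert_le _ _).trans ?_)
  have := Finset.card_image_le (s := W.roots.toFinset) (f := fun x => - (derivative p).eval x)
  have h4 := (Multiset.toFinset_card_le W.roots).trans ((card_roots' W).trans hWd)
  omega

set_option maxHeartbeats 2000000 in
open Classical in
lemma line_count (n : ℕ) (hn2 : 2 ≤ n) : ∃ C0 : ℕ, ∀ (F : Type) [Field F] [Fintype F], (2 : F) ≠ 0 →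
    ∀ g : F[X], g.Monic → g.natDegree = n → Good (g.map (algebraMap F (AlgebraicClosure F))) →
    (univ.filter fun t : F => Unram g t ∧ SoS (g + C t * (X - 1))).card * (n.factorial * 2 ^ n) ≤
      (Fintype.card F + C0 * Nat.sqrt (Fintype.card F)) *
        (univ.filter fun σ : Equiv.Perm (Fin n) × (Fin n → ℤˣ) => Pos σ.1 σ.2).card ∧
    (univ.filter fun t : F => Unram g t ∧ ¬ SoS (g + C t * (X - 1))).card * (n.factorial * 2 ^ n) ≤
      (Fintype.card F + C0 * Nat.sqrt (Fintype.card F)) *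
        (univ.filter fun σ : Equiv.Perm (Fin n) × (Fin n → ℤˣ) => ¬ Pos σ.1 σ.2).card := by
  obtain ⟨C0, hC0⟩ := point_bound n hn2
  refine ⟨C0, ?_⟩
  intro F _ _ h2 g hg hgn hgood
  obtain ⟨p, hp⟩ := CharP.exists F
  obtain ⟨e, hpp, hcard⟩ := FiniteField.card F p
  haveI : Fact p.Prime := ⟨hpp⟩
  haveI : CharP (AlgebraicClosure F) p := charP_of_injective_algebraMap (algebraMap F (AlgebraicClosure F)).injective p
  have h2k : (2 : AlgebraicClosure F) ≠ 0 := by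
    intro h0
    apply h2
    apply (algebraMap F (AlgebraicClosure F)).injective
    rw [map_ofNat, h0, map_zero]
  have hmon : ∀ t : F, ((g + C t * (X - 1)).map (algebraMap F (AlgebraicClosure F))).Monic ∧
      ((g + C t * (X - 1)).map (algebraMap F (AlgebraicClosure F))).natDegree = n := by
    intro t
    rw [map_fam]
    exact fam_monic _ _ (hg.map _) (by rw [natDegree_map, hgn]) hn2
  have hs := fun t : F => exists_sqrt_roots _ (hmon t).1 (hmon t).2
  choose s hs using hs
  have hinj : ∀ t, Unram g t → Function.Injective fun i => s t i ^ 2 := by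
    intro t ht
    have h1 := ht.1
    rw [hs] at h1
    have h3 : (∏ i, (X - C (-(s t i ^ 2)))).Separable := by simpa [sub_eq_add_neg] using h1
    have h4 := h3.injective_of_prod_X_sub_C
    intro i j hij
    apply h4
    simpa using hij
  have hne : ∀ t, Unram g t → ∀ i, s t i ≠ 0 := by
    intro t ht i h0
    apply ht.2
    apply (algebraMap F (AlgebraicClosure F)).injective
    have := congrArg (eval 0) (hs t)
    rw [eval_prod, Finset.prod_eq_zero (Finset.mem_univ i) (by simp [h0])] at this
    rw [map_zero, ← this, eval_map_algebraMap, ← coe_aeval_eq_eval]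
    have h5 := aeval_algebraMap_apply (AlgebraicClosure F) (0 : F) (g + C t * (X - 1))
    rw [map_zero] at h5
    rw [h5]
  -- points
  obtain ⟨pt, hpt⟩ : ∃ pt : F → (Equiv.Perm (Fin n) × (Fin n → ℤˣ)) → Option (Fin n) → AlgebraicClosure F,
      pt = fun t γ o => o.elim (algebraMap F (AlgebraicClosure F) t) (fun i => ((γ.2 i : ℤ) : AlgebraicClosure F) * s t (γ.1 i)) := ⟨_, rfl⟩
  have hpt0 : ∀ t γ, pt t γ none = algebraMap F (AlgebraicClosure F) t := by intro t γ; rw [hpt]; rfl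
  have hpt1 : ∀ t γ i, pt t γ (some i) = ((γ.2 i : ℤ) : AlgebraicClosure F) * s t (γ.1 i) := by intro t γ i; rw [hpt]; rfl
  have hpr : ∀ t γ, (g + C t * (X - 1)).map (algebraMap F (AlgebraicClosure F)) = ∏ i, (X + C (pt t γ (some i) ^ 2)) := by
    intro t γ
    simp only [hpt1]
    rw [prod_perm_sign, hs]
  have hUP : ∀ t, Unram g t → ∀ γ, UP (g.map (algebraMap F (AlgebraicClosure F))) (pt t γ) := by
    intro t ht γ
    refine ⟨?_, ?_, ?_⟩
    · rw [hpt0, ← map_fam, hpr t γ]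
    · intro i j hij
      simp only [hpt1, mul_pow, sign_sq, one_mul] at hij
      exact γ.1.injective (hinj t ht hij)
    · intro i
      rw [hpt1]
      refine mul_ne_zero ?_ (hne t ht _)
      intro h0
      have := sign_sq (Ω := AlgebraicClosure F) (γ.2 i)
      rw [h0] at this
      simp at this
  have hFr : ∀ t γ, ∃ σ : Equiv.Perm (Fin n) × (Fin n → ℤˣ), Unram g t →
      ∀ i, pt t γ (some i) ^ Fintype.card F = ((σ.2 i : ℤ) : AlgebraicClosure F) * pt t γ (some (σ.1 i)) := by
    intro t γ
    by_cases ht : Unram g t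
    · have h3 : ∏ i, (X + C ((pt t γ (some i) ^ Fintype.card F) ^ 2)) = ∏ i, (X + C (pt t γ (some i) ^ 2)) := by
        have h4 := congrArg (Polynomial.map (iterateFrobenius (AlgebraicClosure F) p e)) (hpr t γ)
        rw [Polynomial.map_map] at h4
        have h5 : (iterateFrobenius (AlgebraicClosure F) p e).comp (algebraMap F (AlgebraicClosure F)) = algebraMap F (AlgebraicClosure F) := by
          ext a
          rw [RingHom.comp_apply, iterateFrobenius_def, ← map_pow, ← hcard, FiniteField.pow_card]
        rw [h5, hpr t γ, Polynomial.map_prod] at h4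
        rw [h4]
        refine Finset.prod_congr rfl fun i _ => ?_
        rw [Polynomial.map_add, map_X, map_C, iterateFrobenius_def, hcard]
        congr 2
        rw [← pow_mul, ← pow_mul, mul_comm]
      obtain ⟨π, ε, h⟩ := arrange _ _ h3 (hUP t ht γ).inj
      exact ⟨(π, ε), fun _ => h⟩
    · exact ⟨(1, 1), fun h => absurd h ht⟩
  choose Fr hFr using hFr
  have hSoS : ∀ t, Unram g t → ∀ γ, (SoS (g + C t * (X - 1)) ↔ Pos (Fr t γ).1 (Fr t γ).2) := by
    intro t ht γ
    exact sos_iff h2k _ (fun i => pt t γ (some i)) (hpr t γ) (hUP t ht γ).inj (hUP t ht γ).ne _ _ (hFr t γ ht)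
  have hfib : ∀ (Ω : Finset (F × (Equiv.Perm (Fin n) × (Fin n → ℤˣ)))), (∀ x ∈ Ω, Unram g x.1) →
      ∀ σ, (Ω.filter fun x => Fr x.1 x.2 = σ).card ≤ Fintype.card F + C0 * Nat.sqrt (Fintype.card F) := by
    intro Ω hΩ σ
    have h3 : Set.InjOn (fun x : F × (Equiv.Perm (Fin n) × (Fin n → ℤˣ)) => pt x.1 x.2) ((Ω.filter fun x => Fr x.1 x.2 = σ) : Finset _) := by
      rintro ⟨t, γ⟩ hx ⟨t', γ'⟩ hy hxy
      simp only at hxy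
      have hx' : (t, γ) ∈ Ω := (Finset.mem_filter.mp hx).1
      have e1 : t = t' := by
        have := congrFun hxy none
        rw [hpt0, hpt0] at this
        exact (algebraMap F (AlgebraicClosure F)).injective this
      subst e1
      have hut : Unram g t := hΩ (t, γ) hx'
      have e2 := arrange_unique h2k (s t) (hinj t hut) (hne t hut) (π := γ.1) (π' := γ'.1) (ε := γ.2) (ε' := γ'.2) (by
        intro i
        have := congrFun hxy (some i)
        rwa [hpt1, hpt1] at this)
      exact Prod.ext rfl (Prod.ext e2.1 e2.2)
    rw [← Finset.card_image_of_injOn h3, hcard]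
    refine hC0 (AlgebraicClosure F) h2k _ (hg.map _) (by rw [natDegree_map, hgn]) hgood p e e.pos σ.1 σ.2 _ ?_
    intro P hP
    rw [Finset.mem_image] at hP
    obtain ⟨⟨t, γ⟩, hx, rfl⟩ := hP
    rw [Finset.mem_filter] at hx
    have hut : Unram g t := hΩ (t, γ) hx.1
    refine ⟨hUP t hut γ, ?_, ?_⟩
    · simp only [hpt0]
      rw [← map_pow, ← hcard, FiniteField.pow_card]
    · intro i
      have := hFr t γ hut i
      rw [← hcard]
      simp only
      rw [this, ← hx.2]
  have hG : (univ : Finset (Equiv.Perm (Fin n) × (Fin n → ℤˣ))).card = n.factorial * 2 ^ n := by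
    rw [Finset.card_univ, Fintype.card_prod, Fintype.card_perm, Fintype.card_fun]
    simp
  constructor
  · rw [← hG, ← Finset.card_product]
    refine Finset.card_le_mul_card_image_of_maps_to (f := fun x => Fr x.1 x.2) ?_ _ ?_
    · rintro ⟨t, γ⟩ hx
      rw [Finset.mem_product, Finset.mem_filter] at hx
      rw [Finset.mem_filter]
      exact ⟨Finset.mem_univ _, (hSoS t hx.1.2.1 γ).mp hx.1.2.2⟩
    · intro σ _
      refine hfib _ ?_ σ
      intro x hx
      rw [Finset.mem_product, Finset.mem_filter] at hx
      exact hx.1.2.1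
  · rw [← hG, ← Finset.card_product]
    refine Finset.card_le_mul_card_image_of_maps_to (f := fun x => Fr x.1 x.2) ?_ _ ?_
    · rintro ⟨t, γ⟩ hx
      rw [Finset.mem_product, Finset.mem_filter] at hx
      rw [Finset.mem_filter]
      exact ⟨Finset.mem_univ _, fun h => hx.1.2.2 ((hSoS t hx.1.2.1 γ).mpr h)⟩
    · intro σ _
      refine hfib _ ?_ σ
      intro x hx
      rw [Finset.mem_product, Finset.mem_filter] at hx
      exact hx.1.2.1

end S2S


set_option linter.all false
namespace S2S

open Finset Polynomial

/-- the limiting density -/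
noncomputable def kap (n : ℕ) : ℝ := (Nat.choose (2 * n) n : ℝ) / 4 ^ n

open Classical in
lemma pos_card (n : ℕ) : ((univ.filter fun σ : Equiv.Perm (Fin n) × (Fin n → ℤˣ) => Pos σ.1 σ.2).card : ℝ) =
    kap n * (n.factorial * 2 ^ n) := by
  have h := pos_ratio n
  have h1 : posCount (Fin n) = (univ.filter fun σ : Equiv.Perm (Fin n) × (Fin n → ℤˣ) => Pos σ.1 σ.2).card := by
    unfold posCount
    rw [Nat.card_eq_fintype_card, Fintype.card_subtype]
  rw [← h1]
  unfold kap
  rw [← h]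
  have : (0 : ℝ) < 2 ^ n * n.factorial := by positivity
  field_simp

open Classical in
lemma npos_card (n : ℕ) : ((univ.filter fun σ : Equiv.Perm (Fin n) × (Fin n → ℤˣ) => ¬ Pos σ.1 σ.2).card : ℝ) =
    (1 - kap n) * (n.factorial * 2 ^ n) := by
  have h := Finset.card_filter_add_card_filter_not (s := (univ : Finset (Equiv.Perm (Fin n) × (Fin n → ℤˣ)))) (fun σ => Pos σ.1 σ.2)
  have hG : (univ : Finset (Equiv.Perm (Fin n) × (Fin n → ℤˣ))).card = n.factorial * 2 ^ n := by
    rw [Finset.card_univ, Fintype.card_prod, Fintype.card_perm, Fintype.card_fun]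
    simp
  rw [hG] at h
  have h' : ((univ.filter fun σ : Equiv.Perm (Fin n) × (Fin n → ℤˣ) => Pos σ.1 σ.2).card : ℝ) +
    ((univ.filter fun σ : Equiv.Perm (Fin n) × (Fin n → ℤˣ) => ¬ Pos σ.1 σ.2).card : ℝ) = n.factorial * 2 ^ n := by
    exact_mod_cast h
  rw [pos_card] at h'
  linarith

lemma kap_nonneg (n : ℕ) : 0 ≤ kap n := by unfold kap; positivity

lemma kap_le_one (n : ℕ) : kap n ≤ 1 := by
  classical
  have h := npos_card n
  have h1 : (0 : ℝ) ≤ (1 - kap n) * (n.factorial * 2 ^ n) := by rw [← h]; positivity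
  have h2 : (0 : ℝ) < n.factorial * 2 ^ n := by positivity
  have := nonneg_of_mul_nonneg_left h1 h2
  linarith

open Classical in
lemma line_bound (n : ℕ) (hn2 : 2 ≤ n) : ∃ C1 : ℝ, 0 ≤ C1 ∧ ∀ (F : Type) [Field F] [Fintype F], (2 : F) ≠ 0 →
    ∀ g : F[X], g.Monic → g.natDegree = n → Good (g.map (algebraMap F (AlgebraicClosure F))) →
    |((univ.filter fun t : F => SoS (g + C t * (X - 1))).card : ℝ) - kap n * Fintype.card F| ≤
      C1 * √(Fintype.card F) := by
  obtain ⟨C0, hC0⟩ := line_count n hn2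
  refine ⟨C0 + (n + 1), by positivity, ?_⟩
  intro F _ _ h2 g hg hgn hgood
  obtain ⟨h1, h3⟩ := hC0 F h2 g hg hgn hgood
  have hr := ram_count g n hgn (by omega) hgood.one
  obtain ⟨a, ha⟩ : ∃ a, a = (univ.filter fun t : F => Unram g t ∧ SoS (g + C t * (X - 1))).card := ⟨_, rfl⟩
  obtain ⟨b, hb⟩ : ∃ b, b = (univ.filter fun t : F => Unram g t ∧ ¬ SoS (g + C t * (X - 1))).card := ⟨_, rfl⟩
  obtain ⟨r, hrr⟩ : ∃ r, r = (univ.filter fun t : F => ¬ Unram g t).card := ⟨_, rfl⟩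
  obtain ⟨N, hN⟩ : ∃ N, N = (univ.filter fun t : F => SoS (g + C t * (X - 1))).card := ⟨_, rfl⟩
  rw [← ha] at h1
  rw [← hb] at h3
  rw [← hrr] at hr
  rw [← hN]
  have e1 : a ≤ N := by
    rw [ha, hN]; exact Finset.card_le_card fun t ht => by
      rw [Finset.mem_filter] at ht ⊢; exact ⟨ht.1, ht.2.2⟩
  have e2 : N ≤ a + r := by
    rw [ha, hrr, hN]
    refine le_trans (Finset.card_le_card (t := (univ.filter fun t : F => Unram g t ∧ SoS (g + C t * (X - 1))) ∪ (univ.filter fun t : F => ¬ Unram g t)) fun t ht => ?_) (Finset.card_union_le _ _)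
    rw [Finset.mem_filter] at ht
    rw [Finset.mem_union, Finset.mem_filter, Finset.mem_filter]
    by_cases hu : Unram g t
    · exact Or.inl ⟨ht.1, hu, ht.2⟩
    · exact Or.inr ⟨ht.1, hu⟩
  have e3 : Fintype.card F ≤ a + b + r := by
    rw [ha, hb, hrr, ← Finset.card_univ]
    refine le_trans (Finset.card_le_card (t := ((univ.filter fun t : F => Unram g t ∧ SoS (g + C t * (X - 1))) ∪ (univ.filter fun t : F => Unram g t ∧ ¬ SoS (g + C t * (X - 1)))) ∪ (univ.filter fun t : F => ¬ Unram g t)) fun t ht => ?_) ((Finset.card_union_le _ _).trans (Nat.add_le_add_right (Finset.card_union_le _ _) _))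
    simp only [Finset.mem_union, Finset.mem_filter, Finset.mem_univ, true_and]
    tauto
  obtain ⟨q, hq⟩ : ∃ q, q = Fintype.card F := ⟨_, rfl⟩
  rw [← hq] at h1 h3 e3 ⊢
  have hq1 : 1 ≤ q := by rw [hq]; exact Fintype.card_pos
  have hsq : (1 : ℝ) ≤ √(q : ℝ) := by
    rw [Real.one_le_sqrt]; exact_mod_cast hq1
  have hns : (Nat.sqrt q : ℝ) ≤ √(q : ℝ) := Real.nat_sqrt_le_real_sqrt
  have hGp : (0 : ℝ) < n.factorial * 2 ^ n := by positivity
  have h1' : (a : ℝ) * (n.factorial * 2 ^ n) ≤ (q + C0 * Nat.sqrt q) * (kap n * (n.factorial * 2 ^ n)) := by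
    rw [← pos_card]; exact_mod_cast h1
  have h3' : (b : ℝ) * (n.factorial * 2 ^ n) ≤ (q + C0 * Nat.sqrt q) * ((1 - kap n) * (n.factorial * 2 ^ n)) := by
    rw [← npos_card]; exact_mod_cast h3
  have h1'' : (a : ℝ) ≤ (q + C0 * Nat.sqrt q) * kap n := by
    refine le_of_mul_le_mul_right ?_ hGp; linarith
  have h3'' : (b : ℝ) ≤ (q + C0 * Nat.sqrt q) * (1 - kap n) := by
    refine le_of_mul_le_mul_right ?_ hGp; linarith
  have e1' : (a : ℝ) ≤ N := by exact_mod_cast e1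
  have e2' : (N : ℝ) ≤ a + r := by exact_mod_cast e2
  have e3' : (q : ℝ) ≤ a + b + r := by exact_mod_cast e3
  have hr' : (r : ℝ) ≤ n + 1 := by exact_mod_cast hr
  have k0 := kap_nonneg n
  have k1 := kap_le_one n
  have hc : (0 : ℝ) ≤ C0 := by positivity
  have m1 : (C0 : ℝ) * Nat.sqrt q ≤ C0 * √(q : ℝ) := by gcongr
  have m0 : (0 : ℝ) ≤ C0 * Nat.sqrt q := by positivity
  have m2 : (n + 1 : ℝ) ≤ (n + 1) * √(q : ℝ) := le_mul_of_one_le_right (by positivity) hsq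
  have m3 : C0 * Nat.sqrt q * kap n ≤ C0 * Nat.sqrt q := mul_le_of_le_one_right m0 k1
  have m4 : C0 * Nat.sqrt q * (1 - kap n) ≤ C0 * Nat.sqrt q := mul_le_of_le_one_right m0 (by linarith)
  rw [abs_le]
  constructor
  · nlinarith
  · nlinarith

lemma monic_add {F : Type*} [Field F] {n : ℕ} (f : F[X]) (hf : f.Monic) (hn : f.natDegree = n) (h : F[X]) (hh : h.degree < n) :
    (f + h).Monic ∧ (f + h).natDegree = n := by
  have hd : f.degree = n := by rw [degree_eq_natDegree hf.ne_zero, hn]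
  have h1 : h.degree < f.degree := by rw [hd]; exact hh
  refine ⟨hf.add_of_left h1, ?_⟩
  rw [natDegree_add_eq_left_of_degree_lt h1, hn]

open Classical in
lemma space_bound (n : ℕ) (hn : 3 ≤ n) : ∃ C2 : ℝ, 0 ≤ C2 ∧ ∀ (F : Type) [Field F] [Fintype F], (2 : F) ≠ 0 →
    ∀ f : F[X], f.Monic → f.natDegree = n →
    |∑ α : F, ∑ β : F, ((univ.filter fun t : F => SoS (f + C α * X ^ 2 + C β + C t * (X - 1))).card : ℝ)
        - kap n * (Fintype.card F : ℝ) ^ 3| ≤ C2 * (Fintype.card F : ℝ) ^ 2 * √(Fintype.card F) := by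
  obtain ⟨C1, hC1, hl⟩ := line_bound n (by omega)
  obtain ⟨K, hK⟩ : ∃ K, K = (n + n + 1) * n + 2 * n + 2 := ⟨_, rfl⟩
  refine ⟨C1 + K + 2, by positivity, ?_⟩
  intro F _ _ h2 f hf hfn
  have h2k : (2 : AlgebraicClosure F) ≠ 0 := by
    intro h0
    apply h2
    apply (algebraMap F (AlgebraicClosure F)).injective
    rw [map_ofNat, h0, map_zero]
  obtain ⟨Bα, hBα, hgood⟩ := good_exists h2k hn (f.map (algebraMap F (AlgebraicClosure F))) (by rw [natDegree_map, hfn])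
  rw [← hK] at hgood
  obtain ⟨q, hq⟩ : ∃ q, q = Fintype.card F := ⟨_, rfl⟩
  obtain ⟨a, ha⟩ : ∃ a : F → F → ℝ, a = fun α β => ((univ.filter fun t : F => SoS (f + C α * X ^ 2 + C β + C t * (X - 1))).card : ℝ) := ⟨_, rfl⟩
  have hq1 : 1 ≤ q := by rw [hq]; exact Fintype.card_pos
  have hq1' : (1 : ℝ) ≤ q := by exact_mod_cast hq1
  have hsq : (1 : ℝ) ≤ √(q : ℝ) := by
    rw [Real.one_le_sqrt]; exact_mod_cast hq1
  have k0 := kap_nonneg n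
  have k1 := kap_le_one n
  have htriv : ∀ α β, |a α β - kap n * q| ≤ q := by
    intro α β
    have a0 : 0 ≤ a α β := by rw [ha]; positivity
    have a1 : a α β ≤ q := by
      rw [ha, hq]; simp only; exact_mod_cast (Finset.card_le_univ _)
    have b0 : 0 ≤ kap n * q := by positivity
    have b1 : kap n * q ≤ q := mul_le_of_le_one_left (by positivity) k1
    rw [abs_le]; constructor <;> linarith
  have hcount : ∀ B : Finset (AlgebraicClosure F), (univ.filter fun x : F => algebraMap F (AlgebraicClosure F) x ∈ B).card ≤ B.card := by
    intro B
    refine Finset.card_le_card_of_injOn (algebraMap F (AlgebraicClosure F)) ?_ (algebraMap F (AlgebraicClosure F)).injective.injOn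
    intro x hx
    simpa using hx
  have hsumB : ∀ (B : Finset (AlgebraicClosure F)) (u v : ℝ), 0 ≤ u → 0 ≤ v → ∀ w : F → ℝ,
      (∀ x, w x ≤ u) → (∀ x, algebraMap F (AlgebraicClosure F) x ∉ B → w x ≤ v) → ∑ x, w x ≤ B.card * u + q * v := by
    intro B u v hu hv w h1 h3
    rw [← Finset.sum_filter_add_sum_filter_not univ (fun x : F => algebraMap F (AlgebraicClosure F) x ∈ B)]
    refine add_le_add ?_ ?_
    · refine (Finset.sum_le_card_nsmul _ _ u fun x _ => h1 x).trans ?_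
      rw [nsmul_eq_mul]
      exact mul_le_mul_of_nonneg_right (by exact_mod_cast hcount B) hu
    · refine (Finset.sum_le_card_nsmul _ _ v fun x hx => h3 x (Finset.mem_filter.mp hx).2).trans ?_
      rw [nsmul_eq_mul]
      refine mul_le_mul_of_nonneg_right ?_ hv
      rw [hq]; exact_mod_cast (Finset.card_le_univ _)
  have hrow : ∀ α, algebraMap F (AlgebraicClosure F) α ∉ Bα → ∑ β, |a α β - kap n * q| ≤ K * q + q * (C1 * √(q : ℝ)) := by
    intro α hα
    obtain ⟨Bβ, hBβ, hg⟩ := hgood _ hα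
    refine (hsumB Bβ q (C1 * √(q : ℝ)) (by positivity) (by positivity) _ (htriv α) ?_).trans ?_
    · intro β hβ
      have hG := hg _ hβ
      have h3 : (f + C α * X ^ 2 + C β).map (algebraMap F (AlgebraicClosure F)) =
          f.map (algebraMap F (AlgebraicClosure F)) + C (algebraMap F (AlgebraicClosure F) α) * X ^ 2 + C (algebraMap F (AlgebraicClosure F) β) := by
        simp
      rw [← h3] at hG
      have hm := monic_add f hf hfn (C α * X ^ 2 + C β) (by
        refine lt_of_le_of_lt (degree_add_le _ _) (max_lt ?_ ?_)
        · exact lt_of_le_of_lt (degree_C_mul_X_pow_le 2 α) (by exact_mod_cast (show 2 < n by omega))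
        · exact lt_of_le_of_lt degree_C_le (by exact_mod_cast (show 0 < n by omega)))
      rw [← add_assoc] at hm
      have := hl F h2 _ hm.1 hm.2 hG
      rw [ha, hq]
      exact this
    · have : (Bβ.card : ℝ) ≤ K := by exact_mod_cast hBβ
      gcongr
  have htot := hsumB Bα (q * q) (K * q + q * (C1 * √(q : ℝ))) (by positivity) (by positivity) (fun α => ∑ β, |a α β - kap n * q|) (by
    intro α
    refine (Finset.sum_le_card_nsmul _ _ (q : ℝ) fun β _ => htriv α β).trans ?_
    rw [nsmul_eq_mul, Finset.card_univ, ← hq]) hrow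
  have hsum : ∑ α : F, ∑ β : F, a α β - kap n * (q : ℝ) ^ 3 = ∑ α : F, ∑ β : F, (a α β - kap n * q) := by
    simp only [Finset.sum_sub_distrib, Finset.sum_const, Finset.card_univ, nsmul_eq_mul, ← hq]
    ring
  have hB2 : (Bα.card : ℝ) ≤ 2 := by exact_mod_cast hBα
  have hfin : |∑ α : F, ∑ β : F, a α β - kap n * (q : ℝ) ^ 3| ≤ (C1 + K + 2) * (q : ℝ) ^ 2 * √(q : ℝ) := by
    rw [hsum]
    refine (Finset.abs_sum_le_sum_abs _ _).trans ((Finset.sum_le_sum fun α _ => Finset.abs_sum_le_sum_abs _ _).trans (htot.trans ?_))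
    have c1 : (Bα.card : ℝ) * (q * q) ≤ 2 * (q * q) := by gcongr
    have c2 : (K + 2 : ℝ) * (q : ℝ) ^ 2 ≤ (K + 2 : ℝ) * (q : ℝ) ^ 2 * √(q : ℝ) := le_mul_of_one_le_right (by positivity) hsq
    nlinarith
  rw [ha, hq] at hfin
  exact hfin

end S2S


set_option linter.all false
namespace S2S

open Finset Polynomial

lemma shift_mem {F : Type} [Field F] (m : ℕ) (hm : 2 ≤ m) (α β t : F) :
    C α * X ^ 2 + C β + C t * (X - 1) ∈ degreeLT F (m + 1) := by
  rw [mem_degreeLT]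
  have h1 : (C α * X ^ 2 + C β + C t * (X - 1) : F[X]).natDegree ≤ 2 := by
    compute_degree
  exact lt_of_le_of_lt (natDegree_le_iff_degree_le.mp h1) (by exact_mod_cast (show 2 < m + 1 by omega))

open Classical in
lemma main_bound (n : ℕ) (hn : 3 ≤ n) : ∃ C2 : ℝ, ∀ (F : Type) [Field F] [Fintype F], (2 : F) ≠ 0 →
    ∀ f : F[X], f.Monic → f.natDegree = n → ∀ m : ℕ, 2 ≤ m → m ≤ n - 1 →
    |(Nat.card {h : F[X] // h.degree ≤ (m : ℕ) ∧ SoS (f + h)} : ℝ) / (Fintype.card F : ℝ) ^ (m + 1) - kap n| ≤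
      C2 / √(Fintype.card F) := by
  obtain ⟨C2, hC2, hsp⟩ := space_bound n hn
  refine ⟨C2, ?_⟩
  intro F _ _ h2 f hf hfn m hm1 hm2
  obtain ⟨q, hq⟩ : ∃ q, q = Fintype.card F := ⟨_, rfl⟩
  have hq1 : 1 ≤ q := by rw [hq]; exact Fintype.card_pos
  letI : Fintype (degreeLT F (m + 1)) := Fintype.ofEquiv _ (degreeLTEquiv F (m + 1)).symm.toEquiv
  have hcard : Fintype.card (degreeLT F (m + 1)) = q ^ (m + 1) := by
    rw [Fintype.card_congr (degreeLTEquiv F (m + 1)).toEquiv, Fintype.card_fun, Fintype.card_fin, hq]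
  obtain ⟨χ, hχ⟩ : ∃ χ : degreeLT F (m + 1) → ℝ, χ = fun h : degreeLT F (m + 1) => if SoS (f + (h : F[X])) then (1 : ℝ) else 0 := ⟨fun h : degreeLT F (m + 1) => if SoS (f + (h : F[X])) then (1 : ℝ) else 0, rfl⟩
  have hN : (Nat.card {h : F[X] // h.degree ≤ (m : ℕ) ∧ SoS (f + h)} : ℝ) = ∑ h, χ h := by
    have e : {h : F[X] // h.degree ≤ (m : ℕ) ∧ SoS (f + h)} ≃ {h : degreeLT F (m + 1) // SoS (f + (h : F[X]))} :=
      { toFun := fun h => ⟨⟨h.1, by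
          rw [mem_degreeLT]
          exact lt_of_le_of_lt h.2.1 (by exact_mod_cast Nat.lt_succ_self m)⟩, h.2.2⟩
        invFun := fun h => ⟨h.1.1, by
          have := h.1.2
          rw [mem_degreeLT, degree_lt_iff_coeff_zero] at this
          rw [degree_le_iff_coeff_zero]
          intro j hj
          exact this j (by exact_mod_cast hj), h.2⟩
        left_inv := fun h => rfl
        right_inv := fun h => rfl }
    rw [Nat.card_congr e, Nat.card_eq_fintype_card, Fintype.card_subtype, hχ, Finset.sum_boole]
  -- translation averaging
  have hshift : ∀ w : degreeLT F (m + 1), ∑ h, χ (h + w) = ∑ h, χ h := fun w =>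
    Equiv.sum_comp (Equiv.addRight w) χ
  obtain ⟨w, hw⟩ : ∃ w : F → F → F → degreeLT F (m + 1), w = fun α β t => ⟨_, shift_mem m hm1 α β t⟩ := ⟨_, rfl⟩
  have hrow : ∀ (h : degreeLT F (m + 1)) (α β : F),
      ((univ.filter fun t : F => SoS (f + (h : F[X]) + C α * X ^ 2 + C β + C t * (X - 1))).card : ℝ) = ∑ t, χ (h + w α β t) := by
    intro h α β
    rw [hχ, Finset.sum_boole]
    congr 2
    refine Finset.filter_congr fun t _ => ?_
    rw [hw]
    simp only [Submodule.coe_add]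
    rw [← add_assoc, ← add_assoc, ← add_assoc]
  have hpt : ∀ h : degreeLT F (m + 1), |∑ α, ∑ β, ∑ t, χ (h + w α β t) - kap n * (q : ℝ) ^ 3| ≤ C2 * (q : ℝ) ^ 2 * √(q : ℝ) := by
    intro h
    have hd : (h : F[X]).degree < n := by
      have := h.2
      rw [mem_degreeLT] at this
      exact lt_of_lt_of_le this (by exact_mod_cast (show m + 1 ≤ n by omega))
    obtain ⟨h3, h4⟩ := monic_add f hf hfn h hd
    have := hsp F h2 (f + h) h3 h4
    simp only [hrow] at this
    rw [hq]; exact this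
  have hdouble : ∑ h : degreeLT F (m + 1), ∑ α, ∑ β, ∑ t, χ (h + w α β t) = (q : ℝ) ^ 3 * ∑ h, χ h := by
    rw [Finset.sum_comm]
    have : ∀ α : F, ∑ h : degreeLT F (m + 1), ∑ β, ∑ t, χ (h + w α β t) = (q : ℝ) ^ 2 * ∑ h, χ h := by
      intro α
      rw [Finset.sum_comm]
      have : ∀ β : F, ∑ h : degreeLT F (m + 1), ∑ t, χ (h + w α β t) = (q : ℝ) * ∑ h, χ h := by
        intro β
        rw [Finset.sum_comm]
        simp only [hshift, Finset.sum_const, Finset.card_univ, nsmul_eq_mul, ← hq]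
      simp only [this, Finset.sum_const, Finset.card_univ, nsmul_eq_mul, ← hq]
      ring
    simp only [this, Finset.sum_const, Finset.card_univ, nsmul_eq_mul, ← hq]
    ring
  have hsum : |(q : ℝ) ^ 3 * ∑ h, χ h - (q : ℝ) ^ (m + 1) * (kap n * (q : ℝ) ^ 3)| ≤ (q : ℝ) ^ (m + 1) * (C2 * (q : ℝ) ^ 2 * √(q : ℝ)) := by
    have e1 : (q : ℝ) ^ 3 * ∑ h, χ h - (q : ℝ) ^ (m + 1) * (kap n * (q : ℝ) ^ 3) =
        ∑ h : degreeLT F (m + 1), (∑ α, ∑ β, ∑ t, χ (h + w α β t) - kap n * (q : ℝ) ^ 3) := by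
      rw [Finset.sum_sub_distrib, hdouble, Finset.sum_const, Finset.card_univ, hcard, nsmul_eq_mul]
      push_cast
      ring
    rw [e1]
    refine (Finset.abs_sum_le_sum_abs _ _).trans ((Finset.sum_le_card_nsmul _ _ _ fun h _ => hpt h).trans ?_)
    rw [Finset.card_univ, hcard, nsmul_eq_mul]
    push_cast
    exact le_rfl
  rw [hN, ← hq]
  have hqp : (0 : ℝ) < q := by exact_mod_cast hq1
  have hs : (0 : ℝ) < √(q : ℝ) := Real.sqrt_pos.mpr hqp
  have hss : √(q : ℝ) * √(q : ℝ) = q := Real.mul_self_sqrt hqp.le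
  have hP : (0 : ℝ) < (q : ℝ) ^ (m + 1) * (q : ℝ) ^ 3 := by positivity
  have e2 : (∑ h, χ h) / (q : ℝ) ^ (m + 1) - kap n =
      ((q : ℝ) ^ 3 * ∑ h, χ h - (q : ℝ) ^ (m + 1) * (kap n * (q : ℝ) ^ 3)) / ((q : ℝ) ^ (m + 1) * (q : ℝ) ^ 3) := by
    field_simp
  rw [e2, abs_div, abs_of_pos hP, div_le_iff₀ hP]
  refine hsum.trans (le_of_eq ?_)
  rw [div_mul_eq_mul_div, eq_div_iff hs.ne']
  calc (q : ℝ) ^ (m + 1) * (C2 * (q : ℝ) ^ 2 * √(q : ℝ)) * √(q : ℝ)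
      = (q : ℝ) ^ (m + 1) * (C2 * (q : ℝ) ^ 2 * (√(q : ℝ) * √(q : ℝ))) := by ring
    _ = C2 * ((q : ℝ) ^ (m + 1) * (q : ℝ) ^ 3) := by rw [hss]; ring

end S2S

theorem sums_of_two_squares_in_short_intervals (n : ℕ) (hn : 2 < n) :
    ∃ C : ℝ, ∀ (q : ℕ), Odd q → IsPrimePow q →
      ∀ (F : Type) [Field F] [Fintype F], Fintype.card F = q →
      ∀ f₀ : Polynomial F, f₀.Monic → f₀.natDegree = n →
      ∀ m : ℕ, 2 ≤ m → m ≤ n - 1 →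
      |((Nat.card {h : Polynomial F // h.degree ≤ (m : ℕ) ∧
            ∃ A B : Polynomial F, f₀ + h = A ^ 2 + Polynomial.X * B ^ 2} : ℝ)
          / (q : ℝ) ^ (m + 1)
        - (Nat.choose (2 * n) n : ℝ) / 4 ^ n)| ≤ C / Real.sqrt q := by
  obtain ⟨C2, h⟩ := S2S.main_bound n hn
  refine ⟨C2, ?_⟩
  intro q hodd _ F _ _ hF f₀ hf hfn m hm1 hm2
  have h2 : (2 : F) ≠ 0 := by
    intro h0
    have hd : ringChar F ∣ 2 := ringChar.dvd (by exact_mod_cast h0)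
    have h3 : ringChar F = 2 := by
      rcases (Nat.dvd_prime Nat.prime_two).mp hd with h | h
      · exact absurd h CharP.ringChar_ne_one
      · exact h
    have h4 := FiniteField.even_card_iff_char_two.mp h3
    rw [hF] at h4
    obtain ⟨j, hj⟩ := hodd
    omega
  have := h F h2 f₀ hf hfn m hm1 hm2
  rw [hF] at this
  exact this
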